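/- arXiv:1408.0859 — 3 statements merged into one kernel-verified Lean document; each statement's English description precedes it below -/
import Mathlib

section
/- Let k be an algebraically closed field of characteristic p ≥ 7 and set m = (p-1)/2. Then there exists an A_p-Galois cover of the projective line branched only at ∞ whose inertia group I at a point over ∞ has order p·m and whose order-p elements have lower jump p-2 (so that the upper jump is σ = (p-2)/m); but there exists no PSL_2(F_p)-Galois cover of the projective line branched only at ∞ whose inertia group at a point over ∞ has order p·m′ (p ∤ m′) with lower jump J of its order-p elements satisfying J/m′ = (p-2)/m. (Bouw–Pries.) -/
open scoped Polynomial

/-- The projective special linear group `PSL₂(R)`. -/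
abbrev PSL₂ (R : Type) [CommRing R] : Type :=
  Matrix.SpecialLinearGroup (Fin 2) R ⧸ Subgroup.center (Matrix.SpecialLinearGroup (Fin 2) R)

/-- The place at infinity of the rational function field `k(X)`: the valuation
subring `𝒪_∞ = {f/g : deg f ≤ deg g}`. -/
noncomputable def inftyPlace (k : Type) [Field k] : ValuationSubring (RatFunc k) :=
  letI := Classical.decEq (RatFunc k)
  (FunctionField.inftyValuation k).valuationSubring

/-- The inertia group at a point (valuation subring) `O` of `E`, viewed as a
subgroup of the Galois group of `E/k(X)`. -/
noncomputable def inertiaIn (k : Type) [Field k] {E : Type} [Field E]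
    [Algebra (RatFunc k) E] (O : ValuationSubring E) : Subgroup (E ≃ₐ[RatFunc k] E) :=
  (O.inertiaSubgroup (RatFunc k)).map (O.decompositionSubgroup (RatFunc k)).subtype

/-- `π` is a uniformizer of the valuation subring `O` of `E`: its value is the
largest value less than `1` (and is nonzero). -/
def IsUniformizer {E : Type} [Field E] (O : ValuationSubring E) (π : E) : Prop :=
  O.valuation π ≠ 0 ∧ O.valuation π < 1 ∧
    ∀ x : E, O.valuation x < 1 → O.valuation x ≤ O.valuation π

/-- An element `g` of the Galois group has lower jump `j` at the point `O`:
for a uniformizer `π` of `O`, the valuation of `g π - π` is that of `π^(j+1)`. -/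
def HasLowerJump {k E : Type} [Field k] [Field E] [Algebra (RatFunc k) E]
    (O : ValuationSubring E) (g : E ≃ₐ[RatFunc k] E) (j : ℕ) : Prop :=
  ∃ π : E, IsUniformizer O π ∧ O.valuation (g π - π) = (O.valuation π) ^ (j + 1)

section LocalTheory

variable {k E Γ : Type} [Field k] [Field E] [LinearOrderedCommGroupWithZero Γ]

/-- `π` is a uniformizer of the discrete valuation `v`, whose residue field is
represented by the field of constants `κ`. -/
structure IsUnif (v : Valuation E Γ) (κ : k →+* E) (π : E) : Prop where
  ne : v π ≠ 0
  lt : v π < 1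
  const : ∀ c : k, c ≠ 0 → v (κ c) = 1
  res : ∀ x : E, v x ≤ 1 → ∃ c : k, v (x - κ c) < 1
  disc : ∀ x : E, x ≠ 0 → ∃ n : ℤ, v x = v π ^ n

/-- `g` preserves the valuation and fixes the constants. -/
structure Fixes (v : Valuation E Γ) (κ : k →+* E) (g : E ≃+* E) : Prop where
  val : ∀ x : E, v (g x) = v x
  const : ∀ c : k, g (κ c) = κ c

variable {v : Valuation E Γ} {κ : k →+* E} {π : E}

namespace IsUnif

lemma ne_zero (h : IsUnif v κ π) : π ≠ 0 := fun h0 => h.ne (by rw [h0, map_zero])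

lemma zpow_ne (h : IsUnif v κ π) (n : ℤ) : v π ^ n ≠ 0 := zpow_ne_zero n h.ne

lemma zpow_le (h : IsUnif v κ π) {a b : ℤ} : v π ^ a ≤ v π ^ b ↔ b ≤ a :=
  zpow_le_zpow_iff_right_of_lt_one₀ (zero_lt_iff.2 h.ne) h.lt

lemma zpow_lt (h : IsUnif v κ π) {a b : ℤ} : v π ^ a < v π ^ b ↔ b < a :=
  zpow_lt_zpow_iff_right_of_lt_one₀ (zero_lt_iff.2 h.ne) h.lt

lemma zpow_inj (h : IsUnif v κ π) {a b : ℤ} : v π ^ a = v π ^ b ↔ a = b := by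
  rw [le_antisymm_iff, h.zpow_le, h.zpow_le]; omega

lemma lt_iff (h : IsUnif v κ π) {x : E} {n : ℤ} : v x < v π ^ n ↔ v x ≤ v π ^ (n + 1) := by
  by_cases hx : x = 0
  · simp [hx, zero_lt_iff.2 (h.zpow_ne n)]
  · obtain ⟨a, ha⟩ := h.disc x hx
    rw [ha, h.zpow_lt, h.zpow_le]; omega

lemma lt_one_iff (h : IsUnif v κ π) {x : E} : v x < 1 ↔ v x ≤ v π := by
  simpa using h.lt_iff (x := x) (n := 0)

lemma add (_h : IsUnif v κ π) {x y : E} {n : ℤ} (hx : v x ≤ v π ^ n) (hy : v y ≤ v π ^ n) :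
    v (x + y) ≤ v π ^ n := v.map_add_le hx hy

lemma sub (_h : IsUnif v κ π) {x y : E} {n : ℤ} (hx : v x ≤ v π ^ n) (hy : v y ≤ v π ^ n) :
    v (x - y) ≤ v π ^ n := v.map_sub_le hx hy

lemma mul (h : IsUnif v κ π) {x y : E} {a b : ℤ} (hx : v x ≤ v π ^ a) (hy : v y ≤ v π ^ b) :
    v (x * y) ≤ v π ^ (a + b) := by
  rw [map_mul, zpow_add₀ h.ne]; gcongr

lemma mul_eq (h : IsUnif v κ π) {x y : E} {a b : ℤ} (hx : v x = v π ^ a) (hy : v y = v π ^ b) :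
    v (x * y) = v π ^ (a + b) := by
  rw [map_mul, zpow_add₀ h.ne, hx, hy]

lemma mono (h : IsUnif v κ π) {x : E} {a b : ℤ} (hx : v x ≤ v π ^ a) (hb : b ≤ a) :
    v x ≤ v π ^ b := hx.trans (h.zpow_le.2 hb)

lemma const_le (h : IsUnif v κ π) (c : k) : v (κ c) ≤ 1 := by
  by_cases hc : c = 0
  · simp [hc]
  · exact (h.const c hc).le

lemma int_le (h : IsUnif v κ π) (n : ℤ) : v (n : E) ≤ 1 := by
  simpa using h.const_le (n : k)

/-- The perturbation of a main term. -/
lemma eq_of_sub (h : IsUnif v κ π) {x y : E} {n : ℤ} (hx : v x = v π ^ n)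
    (hy : v (y - x) ≤ v π ^ (n + 1)) : v y = v π ^ n := by
  have : v (x + (y - x)) = v x :=
    v.map_add_eq_of_lt_left (by rw [hx]; exact h.lt_iff.2 hy)
  rwa [add_sub_cancel, hx] at this

/-- Elements agree to first order with a constant multiple. -/
lemma exists_const_mul (h : IsUnif v κ π) {x y : E} (hy : y ≠ 0) (hx : v x ≤ v y) :
    ∃ c : k, v (x - κ c * y) < v y := by
  have hy' : v y ≠ 0 := by simpa using hy
  obtain ⟨c, hc⟩ := h.res (x / y) (by rw [map_div₀]; exact div_le_one_of_le₀ hx zero_le)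
  refine ⟨c, ?_⟩
  have : x - κ c * y = (x / y - κ c) * y := by field_simp
  rw [this, map_mul]
  exact mul_lt_of_lt_one_left (zero_lt_iff.2 hy') hc

lemma const_unique (h : IsUnif v κ π) {x y : E} {c d : k}
    (hc : v (x - κ c * y) < v y) (hd : v (x - κ d * y) < v y) : c = d := by
  by_contra hcd
  have h1 : v ((x - κ d * y) - (x - κ c * y)) < v y := v.map_sub_lt hd hc
  have h2 : (x - κ d * y) - (x - κ c * y) = κ (c - d) * y := by rw [map_sub]; ring
  rw [h2, map_mul, h.const _ (sub_ne_zero.2 hcd), one_mul] at h1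
  exact lt_irrefl _ h1

end IsUnif

section Jump

variable {g : E ≃+* E} {J : ℤ}

lemma jump_subring (h : IsUnif v κ π) (hg : Fixes v κ g) (hJ : v (g π - π) ≤ v π ^ (J + 1))
    {x : E} (hx : v x ≤ 1) : v (g x - x) ≤ v π ^ (J + 1) := by
  have main : ∀ N : ℕ, ∃ s : E, v (x - s) ≤ v π ^ (N : ℤ) ∧ v (g s - s) ≤ v π ^ (J + 1) := by
    have hpow : ∀ N : ℕ, v (g (π ^ N) - π ^ N) ≤ v π ^ (J + 1) := by
      intro N
      induction N with
      | zero => simp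
      | succ N ih =>
        have : g (π ^ (N + 1)) - π ^ (N + 1)
            = (g (π ^ N) - π ^ N) * g π + π ^ N * (g π - π) := by
          simp only [map_pow]; ring
        rw [this]
        refine h.add ?_ ?_
        · rw [map_mul, hg.val]
          exact mul_le_of_le_of_le_one ih h.lt.le
        · rw [map_mul, map_pow]
          exact mul_le_of_le_one_of_le (pow_le_one₀ zero_le h.lt.le) hJ
    intro N
    induction N with
    | zero => exact ⟨0, by simpa using hx, by simp⟩
    | succ N ih =>
      obtain ⟨s, hs1, hs2⟩ := ih
      obtain ⟨c, hc⟩ := h.exists_const_mul (x := x - s) (y := π ^ N)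
        (pow_ne_zero _ h.ne_zero) (by rw [map_pow]; simpa using hs1)
      refine ⟨s + κ c * π ^ N, ?_, ?_⟩
      · rw [map_pow, sub_sub, ← zpow_natCast (v π), h.lt_iff] at hc
        exact_mod_cast hc
      · have : g (s + κ c * π ^ N) - (s + κ c * π ^ N)
            = (g s - s) + κ c * (g (π ^ N) - π ^ N) := by
          simp only [map_add, map_mul, hg.const]; ring
        rw [this]
        refine h.add hs2 ?_
        rw [map_mul]
        exact mul_le_of_le_one_of_le (h.const_le c) (hpow N)
  obtain ⟨s, hs1, hs2⟩ := main (J + 1).toNat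
  have hs3 : v (x - s) ≤ v π ^ (J + 1) := h.mono hs1 (Int.self_le_toNat _)
  have : g x - x = (g s - s) + (g (x - s) - (x - s)) := by rw [map_sub]; ring
  rw [this]
  refine h.add hs2 (h.sub ?_ hs3)
  rwa [hg.val]

lemma jump_zpow (h : IsUnif v κ π) (hJ1 : 1 ≤ J) {ε : E} (hε : v ε ≤ v π ^ J) (n : ℤ) :
    v ((1 + ε) ^ n - 1 - n * ε) ≤ v π ^ (J + 1) := by
  have hε1 : v ε < 1 := hε.trans_lt (by simpa using (h.zpow_lt (a := J) (b := 0)).2 (by omega))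
  have hu : v (1 + ε) = 1 := by
    rw [v.map_add_eq_of_lt_left (by simpa using hε1), map_one]
  have hne : (1 + ε) ≠ 0 := by
    intro h0; rw [h0, map_zero] at hu; exact zero_ne_one hu
  have hsq : v (ε * ε) ≤ v π ^ (J + 1) := h.mono (h.mul hε hε) (by omega)
  have hle : ∀ n : ℤ, v ((n : E) * (ε * ε)) ≤ v π ^ (J + 1) := fun n => by
    rw [map_mul]; exact mul_le_of_le_one_of_le (h.int_le n) hsq
  have hwn : ∀ n : ℤ, v ((1 + ε) ^ n) = 1 := fun n => by rw [map_zpow₀, hu, one_zpow]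
  induction n with
  | zero => simp
  | succ n ih =>
    have : (1 + ε) ^ ((n : ℤ) + 1) - 1 - ((n : ℤ) + 1 : ℤ) * ε
        = ((1 + ε) ^ (n : ℤ) - 1 - (n : ℤ) * ε) * (1 + ε) + (n : ℤ) * (ε * ε) := by
      rw [zpow_add_one₀ hne]; push_cast; ring
    rw [this]
    refine h.add ?_ (hle _)
    rw [map_mul, hu, mul_one]; exact ih
  | pred n ih =>
    have : (1 + ε) ^ (-(n : ℤ) - 1) - 1 - ((-(n : ℤ) - 1 : ℤ) : E) * ε
        = (((1 + ε) ^ (-(n : ℤ)) - 1 - ((-(n : ℤ) : ℤ) : E) * ε)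
            - ((-(n : ℤ) - 1 : ℤ) : E) * (ε * ε)) / (1 + ε) := by
      rw [zpow_sub_one₀ hne, eq_div_iff hne]; push_cast; field_simp; ring
    rw [this, map_div₀, hu, div_one]
    exact h.sub ih (hle _)

/-- The action of a wild element on an element of order `n`. -/
lemma jump_apply (h : IsUnif v κ π) (hg : Fixes v κ g) (hJ1 : 1 ≤ J)
    (hJ : v (g π - π) = v π ^ (J + 1)) {z : E} {n : ℤ} (hz : v z = v π ^ n) :
    ((n : k) ≠ 0 → v (g z - z) = v π ^ (n + J)) ∧
      ((n : k) = 0 → v (g z - z) ≤ v π ^ (n + J + 1)) := by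
  have hπ := h.ne_zero
  set ε := (g π - π) / π with hεdef
  have hε : v ε = v π ^ J := by
    rw [hεdef, map_div₀, hJ, zpow_add_one₀ h.ne]; field_simp [h.ne]
  have hgπ : g π = π * (1 + ε) := by rw [hεdef]; field_simp; ring
  set u := z / π ^ n with hudef
  have hu : v u = 1 := by
    rw [hudef, map_div₀, map_zpow₀, hz, div_self (h.zpow_ne n)]
  have hzu : z = π ^ n * u := by rw [hudef]; field_simp
  have e1 : g z - z - n * ε * z
      = g (π ^ n) * (g u - u) + z * ((1 + ε) ^ n - 1 - n * ε) := by
    rw [hzu, map_mul, map_zpow₀, hgπ, mul_zpow]; ring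
  have b1 : v (g z - z - n * ε * z) ≤ v π ^ (n + J + 1) := by
    rw [e1]
    refine h.add ?_ ?_
    · have := h.mul (x := g (π ^ n)) (a := n) (by rw [hg.val, map_zpow₀])
        (jump_subring h hg hJ.le hu.le)
      rwa [← add_assoc] at this
    · have := h.mul hz.le (jump_zpow h hJ1 hε.le n)
      rwa [← add_assoc] at this
  constructor
  · intro hn
    have hnv : v ((n : ℤ) : E) = 1 := by simpa using h.const _ hn
    refine h.eq_of_sub (x := n * ε * z) ?_ b1
    rw [map_mul, map_mul, hnv, one_mul, hε, hz, ← zpow_add₀ h.ne, add_comm]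
  · intro hn
    have : ((n : ℤ) : E) = 0 := by
      have := congrArg κ hn
      simpa using this
    simpa [this] using b1

lemma jump_le (h : IsUnif v κ π) (hg : Fixes v κ g) (hJ1 : 1 ≤ J)
    (hJ : v (g π - π) = v π ^ (J + 1)) {z : E} {n : ℤ} (hz : v z ≤ v π ^ n) :
    v (g z - z) ≤ v π ^ (n + J) := by
  by_cases h0 : z = 0
  · simp [h0]
  obtain ⟨a, ha⟩ := h.disc z h0
  have hna : n ≤ a := by rwa [ha, h.zpow_le] at hz
  have := jump_apply h hg hJ1 hJ ha
  by_cases hk : (a : k) = 0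
  · exact h.mono (this.2 hk) (by omega)
  · exact h.mono (this.1 hk).le (by omega)

end Jump

section Tame

/-- `g z ≡ c z` to first order. -/
def Twist (v : Valuation E Γ) (κ : k →+* E) (g : E ≃+* E) (z : E) (c : k) : Prop :=
  v (g z - κ c * z) < v z

variable {g g' : E ≃+* E} {z w : E} {c d : k}

lemma Twist.exists (h : IsUnif v κ π) (hg : Fixes v κ g) (hz : z ≠ 0) :
    ∃ c, Twist v κ g z c := h.exists_const_mul hz (hg.val z).le

lemma Twist.unique (h : IsUnif v κ π) (hc : Twist v κ g z c) (hd : Twist v κ g z d) : c = d :=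
  h.const_unique hc hd

lemma Twist.ne_zero (hg : Fixes v κ g) (hc : Twist v κ g z c) : c ≠ 0 := by
  rintro rfl
  simp only [Twist, map_zero, zero_mul, sub_zero, hg.val] at hc
  exact lt_irrefl _ hc

lemma Twist.mul (h : IsUnif v κ π) (hg : Fixes v κ g) (hc : Twist v κ g z c)
    (hd : Twist v κ g w d) : Twist v κ g (z * w) (c * d) := by
  have hz : 0 < v z := lt_of_le_of_lt zero_le hc
  have hw : 0 < v w := lt_of_le_of_lt zero_le hd
  have : g (z * w) - κ (c * d) * (z * w)
      = (g z - κ c * z) * g w + κ c * z * (g w - κ d * w) := by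
    simp only [map_mul]; ring
  rw [Twist, this, map_mul v z w]
  refine v.map_add_lt ?_ ?_
  · rw [map_mul, hg.val]; exact mul_lt_mul_of_pos_right hc hw
  · rw [map_mul, map_mul, h.const c (hc.ne_zero hg), one_mul]
    exact mul_lt_mul_of_pos_left hd hz

lemma Twist.comp (h : IsUnif v κ π) (hg' : Fixes v κ g') (hg : Fixes v κ g)
    (hd : Twist v κ g' z d) (hc : Twist v κ g z c) : Twist v κ (g * g') z (c * d) := by
  have : (g * g') z - κ (c * d) * z = g (g' z - κ d * z) + κ d * (g z - κ c * z) := by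
    simp only [RingAut.mul_apply, map_mul, map_sub, hg.const]; ring
  rw [Twist, this]
  refine v.map_add_lt ?_ ?_
  · rw [hg.val]; exact hd
  · rw [map_mul, h.const d (hd.ne_zero hg'), one_mul]; exact hc

lemma Twist.one_of_val (h : IsUnif v κ π) (hg : Fixes v κ g) (hz : v z = 1) :
    Twist v κ g z 1 := by
  obtain ⟨c, hc⟩ := h.res z hz.le
  have : g z - κ 1 * z = g (z - κ c) - (z - κ c) := by
    rw [map_sub, hg.const, map_one]; ring
  rw [Twist, this, hz]
  exact v.map_sub_lt (by rwa [hg.val]) hc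

lemma Twist.one_one (v : Valuation E Γ) (κ : k →+* E) (g : E ≃+* E) : Twist v κ g 1 1 := by
  simp [Twist]

lemma Twist.pow (h : IsUnif v κ π) (hg : Fixes v κ g) (hc : Twist v κ g z c) (n : ℕ) :
    Twist v κ g (z ^ n) (c ^ n) := by
  induction n with
  | zero => simpa using Twist.one_one v κ g
  | succ n ih => rw [pow_succ, pow_succ]; exact ih.mul h hg hc

lemma Twist.inv (h : IsUnif v κ π) (hg : Fixes v κ g) (hc : Twist v κ g z c) :
    Twist v κ g z⁻¹ c⁻¹ := by
  have hz : z ≠ 0 := by rintro rfl; simp [Twist] at hc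
  obtain ⟨d, hd⟩ := Twist.exists h hg (inv_ne_zero hz)
  have h1 := hc.mul h hg hd
  rw [mul_inv_cancel₀ hz] at h1
  have h2 : c * d = 1 := h1.unique h (Twist.one_one v κ g)
  rwa [eq_inv_of_mul_eq_one_right h2] at hd

lemma Twist.zpow (h : IsUnif v κ π) (hg : Fixes v κ g) (hc : Twist v κ g z c) (n : ℤ) :
    Twist v κ g (z ^ n) (c ^ n) := by
  cases n with
  | ofNat n => simpa using hc.pow h hg n
  | negSucc n => simpa using (hc.pow h hg (n + 1)).inv h hg

lemma Twist.of_val (h : IsUnif v κ π) (hg : Fixes v κ g) (hc : Twist v κ g π c) {n : ℤ}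
    (hz : v z = v π ^ n) : Twist v κ g z (c ^ n) := by
  have h1 : Twist v κ g (z / π ^ n) 1 := Twist.one_of_val h hg (by
    rw [map_div₀, map_zpow₀, hz, div_self (h.zpow_ne n)])
  have := h1.mul h hg (hc.zpow h hg n)
  rwa [one_mul, div_mul_cancel₀ _ (zpow_ne_zero _ h.ne_zero)] at this

/-- An element acting trivially to first order has no nontrivial prime-to-`p` part. -/
lemma eq_of_twist_one (h : IsUnif v κ π) (hg : Fixes v κ g) (hc : Twist v κ g π 1) {n : ℕ}
    (hn : (n : k) ≠ 0) (hgn : g ^ n = 1) (y : E) : g y = y := by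
  by_contra hy
  obtain ⟨z, hzy⟩ : ∃ z, z = g y - y := ⟨_, rfl⟩
  have hz : z ≠ 0 := hzy ▸ sub_ne_zero.2 hy
  obtain ⟨a, ha⟩ := h.disc z hz
  have key : ∀ i : ℕ, (g ^ i) y = y + ∑ j ∈ Finset.range i, (g ^ j) z := by
    intro i
    induction i with
    | zero => simp
    | succ i ih =>
      rw [Finset.sum_range_succ, ← add_assoc, ← ih, pow_succ, RingAut.mul_apply]
      rw [hzy, map_sub]; ring
  have h0 : ∑ j ∈ Finset.range n, (g ^ j) z = 0 := by
    have := key n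
    rw [hgn] at this
    simpa using this
  have hf : ∀ j : ℕ, Fixes v κ (g ^ j) ∧ v ((g ^ j) z - z) < v z := by
    intro j
    have hz1 : v (g z - z) < v z := by
      have := hc.of_val h hg ha
      simpa [Twist] using this
    induction j with
    | zero => exact ⟨⟨fun x => by simp, fun c => by simp⟩, by simpa using zero_lt_iff.2 (by simpa using hz)⟩
    | succ j ih =>
      refine ⟨⟨fun x => ?_, fun c => ?_⟩, ?_⟩
      · rw [pow_succ, RingAut.mul_apply, ih.1.val, hg.val]
      · rw [pow_succ, RingAut.mul_apply, hg.const, ih.1.const]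
      · have : (g ^ (j + 1)) z - z = (g ^ j) (g z - z) + ((g ^ j) z - z) := by
          rw [pow_succ, RingAut.mul_apply, map_sub]; ring
        rw [this]
        exact v.map_add_lt (by rwa [ih.1.val]) ih.2
  have h1 : v (∑ j ∈ Finset.range n, ((g ^ j) z - z)) < v z :=
    v.map_sum_lt (by simpa using hz) fun j _ => (hf j).2
  rw [Finset.sum_sub_distrib, h0] at h1
  have h2 : v (n : E) = 1 := by simpa using h.const _ hn
  simp [h2] at h1

end Tame

end LocalTheory

section AtInfinity

open RatFunc

variable {k E : Type} [Field k] [Field E] [Algebra (RatFunc k) E]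

lemma mem_inftyPlace {a : RatFunc k} (ha : a ≠ 0) : a ∈ inftyPlace k ↔ a.intDegree ≤ 0 := by
  classical
  change RatFunc.inftyValuation k a ≤ 1 ↔ _
  rw [RatFunc.inftyValuation_apply,
    RatFunc.inftyValuation_of_nonzero k ha, ← WithZero.exp_zero, WithZero.exp_le_exp]

/-- The inclusion of the constants. -/
noncomputable def constMap (k E : Type) [Field k] [Field E] [Algebra (RatFunc k) E] : k →+* E :=
  (algebraMap (RatFunc k) E).comp RatFunc.C

/-- The coordinate of the line, viewed in the cover. -/
noncomputable def coord (k E : Type) [Field k] [Field E] [Algebra (RatFunc k) E] : E :=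
  algebraMap (RatFunc k) E RatFunc.X

lemma coord_ne_zero : coord k E ≠ 0 := by
  simp [coord, RatFunc.X_ne_zero]

lemma intDegree_zpow (n : ℤ) : ((RatFunc.X : RatFunc k) ^ n).intDegree = n := by
  have hnat : ∀ n : ℕ, ((RatFunc.X : RatFunc k) ^ n).intDegree = n := by
    intro n
    induction n with
    | zero => simp
    | succ n ih =>
      rw [pow_succ, RatFunc.intDegree_mul (pow_ne_zero _ RatFunc.X_ne_zero) RatFunc.X_ne_zero, ih,
        RatFunc.intDegree_X]; push_cast; ring
  cases n with
  | ofNat n => simpa using hnat n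
  | negSucc n => rw [zpow_negSucc, RatFunc.intDegree_inv, hnat]; simp [Int.negSucc_eq]

variable {O : ValuationSubring E}

section
variable (hO : O.comap (algebraMap (RatFunc k) E) = inftyPlace k)
include hO

lemma val_le_one_iff {a : RatFunc k} (ha : a ≠ 0) :
    O.valuation (algebraMap _ E a) ≤ 1 ↔ a.intDegree ≤ 0 := by
  rw [O.valuation_le_one_iff, ← ValuationSubring.mem_comap, hO, mem_inftyPlace ha]

lemma val_eq_one_of_intDegree {a : RatFunc k} (ha : a ≠ 0) (h : a.intDegree = 0) :
    O.valuation (algebraMap _ E a) = 1 := by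
  refine le_antisymm ((val_le_one_iff hO ha).2 h.le) ?_
  have := (val_le_one_iff hO (inv_ne_zero ha)).2 (by rw [RatFunc.intDegree_inv, h]; simp)
  rw [map_inv₀, map_inv₀] at this
  exact (inv_le_one₀ (zero_lt_iff.2 (by simpa using ha))).1 this

lemma val_algebraMap {a : RatFunc k} (ha : a ≠ 0) :
    O.valuation (algebraMap _ E a) = O.valuation (coord k E) ^ a.intDegree := by
  have hX := zpow_ne_zero a.intDegree (RatFunc.X_ne_zero (K := k))
  have h1 := val_eq_one_of_intDegree hO (a := a / RatFunc.X ^ a.intDegree)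
    (div_ne_zero ha hX) (by
      rw [div_eq_mul_inv, RatFunc.intDegree_mul ha (inv_ne_zero hX), RatFunc.intDegree_inv,
        intDegree_zpow]; ring)
  have h2 : a = a / RatFunc.X ^ a.intDegree * RatFunc.X ^ a.intDegree := by field_simp
  conv_lhs => rw [h2]
  rw [map_mul, map_mul, h1, one_mul, map_zpow₀, map_zpow₀, coord]

lemma one_lt_val_coord : 1 < O.valuation (coord k E) := by
  by_contra h
  have := (val_le_one_iff hO RatFunc.X_ne_zero).1 (not_lt.1 h)
  simp at this

lemma val_const {c : k} (hc : c ≠ 0) : O.valuation (constMap k E c) = 1 :=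
  val_eq_one_of_intDegree hO (by simpa using hc) (by simp)

lemma val_const_le (c : k) : O.valuation (constMap k E c) ≤ 1 := by
  by_cases hc : c = 0
  · simp [hc]
  · exact (val_const hO hc).le

/-- The residue field of the place at infinity of the line is the field of constants. -/
lemma exists_const_sub (a : RatFunc k) (ha : O.valuation (algebraMap _ E a) ≤ 1) :
    ∃ c : k, O.valuation (algebraMap _ E a - constMap k E c) < 1 := by
  have ht := one_lt_val_coord hO
  by_cases h0 : a = 0
  · exact ⟨0, by simp [h0]⟩
  have hneg : ∀ b : RatFunc k, b ≠ 0 → b.intDegree < 0 → O.valuation (algebraMap _ E b) < 1 := by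
    intro b hb hb'
    rw [val_algebraMap hO hb]
    exact zpow_lt_one_of_neg₀ ht hb'
  by_cases hd : a.intDegree < 0
  · exact ⟨0, by simpa using hneg a h0 hd⟩
  have hdeg : a.intDegree = 0 := le_antisymm ((val_le_one_iff hO h0).1 ha) (not_lt.1 hd)
  set c := a.num.leadingCoeff / a.denom.leadingCoeff with hc
  have hcn : c ≠ 0 := div_ne_zero (by simpa using h0) (by simp [RatFunc.denom_ne_zero])
  refine ⟨c, ?_⟩
  by_cases h1 : a - RatFunc.C c = 0
  · rw [constMap, RingHom.comp_apply, ← map_sub, h1]; simp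
  rw [constMap, RingHom.comp_apply, ← map_sub]
  refine hneg _ h1 ?_
  have hdd : a.num.natDegree = a.denom.natDegree := by
    unfold RatFunc.intDegree at hdeg; omega
  set P := a.num - Polynomial.C c * a.denom
  have hrep : a - RatFunc.C c = algebraMap _ (RatFunc k) P / algebraMap _ _ a.denom := by
    conv_lhs => rw [← RatFunc.num_div_denom a]
    have : algebraMap (Polynomial k) (RatFunc k) a.denom ≠ 0 := by simp [RatFunc.denom_ne_zero]
    rw [map_sub, map_mul, RatFunc.algebraMap_C]
    field_simp
  have hP : P ≠ 0 := by
    intro hP; apply h1; rw [hrep, hP]; simp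
  have hden := RatFunc.denom_ne_zero a
  rw [hrep, div_eq_mul_inv, RatFunc.intDegree_mul (by simpa using hP) (by simpa using hden),
    RatFunc.intDegree_inv, RatFunc.intDegree_polynomial, RatFunc.intDegree_polynomial]
  have hlt : P.degree < a.num.degree := by
    refine Polynomial.degree_sub_lt_left ?_ (by simpa using h0) ?_
    · rw [Polynomial.degree_C_mul hcn, Polynomial.degree_eq_natDegree (by simpa using h0),
        Polynomial.degree_eq_natDegree hden, hdd]
    · rw [Polynomial.leadingCoeff_mul, Polynomial.leadingCoeff_C, hc, div_mul_cancel₀]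
      simpa using hden
  have := Polynomial.natDegree_lt_natDegree hP hlt
  omega

end

end AtInfinity

lemma IsUnif.isUniformizer {k E : Type} [Field k] [Field E] {O : ValuationSubring E} {κ : k →+* E} {π : E} (h : IsUnif O.valuation κ π) :
    IsUniformizer O π := ⟨h.ne, h.lt, fun _ hx => h.lt_one_iff.1 hx⟩

section AtInfinityFinite

variable {k E : Type} [Field k] [Field E] [Algebra (RatFunc k) E]
  {O : ValuationSubring E}

section
variable [FiniteDimensional (RatFunc k) E] (hO : O.comap (algebraMap (RatFunc k) E) = inftyPlace k)
include hO

lemma exists_residue [IsAlgClosed k] {x : E} (hx : O.valuation x ≤ 1) :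
    ∃ c : k, O.valuation (x - constMap k E c) < 1 := by
  set v := O.valuation
  set P := minpoly (RatFunc k) x with hPdef
  have hint : IsIntegral (RatFunc k) x := IsIntegral.of_finite _ _
  have hP0 : P ≠ 0 := minpoly.ne_zero hint
  obtain ⟨i0, hi0, hmax⟩ := Finset.exists_max_image P.support
    (fun i => v (algebraMap _ E (P.coeff i))) (Polynomial.nonempty_support_iff.2 hP0)
  have ha0 : P.coeff i0 ≠ 0 := Polynomial.mem_support_iff.1 hi0
  have hb : ∀ i, v (algebraMap _ E (P.coeff i / P.coeff i0)) ≤ 1 := by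
    intro i
    rw [map_div₀, map_div₀]
    by_cases hi : i ∈ P.support
    · exact div_le_one_of_le₀ (hmax i hi) zero_le
    · simp [Polynomial.notMem_support_iff.1 hi]
  choose c hc using fun i => exists_const_sub hO _ (hb i)
  have hc0 : c i0 ≠ 0 := by
    intro h0
    have := hc i0
    rw [h0, map_zero, sub_zero, div_self ha0] at this
    simp at this
  set Q : Polynomial k := ∑ i ∈ Finset.range (P.natDegree + 1), Polynomial.monomial i (c i)
  have hQ0 : Q ≠ 0 := by
    intro h0
    have : Q.coeff i0 = c i0 := by
      simp only [Q, Polynomial.finsetSum_coeff, Polynomial.coeff_monomial]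
      rw [Finset.sum_ite_eq', if_pos]
      exact Finset.mem_range_succ_iff.2 (Polynomial.le_natDegree_of_mem_supp _ hi0)
    rw [h0] at this
    exact hc0 (by simpa using this.symm)
  have hQx : v (Q.eval₂ (constMap k E) x) < 1 := by
    have h1 : ∑ i ∈ Finset.range (P.natDegree + 1),
        algebraMap _ E (P.coeff i / P.coeff i0) * x ^ i = 0 := by
      have h2 : Polynomial.aeval x P = 0 := minpoly.aeval _ _
      rw [Polynomial.aeval_eq_sum_range] at h2
      have : ∀ i, algebraMap _ E (P.coeff i / P.coeff i0) * x ^ i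
          = (algebraMap _ E (P.coeff i0))⁻¹ * (P.coeff i • x ^ i) := by
        intro i
        rw [map_div₀, Algebra.smul_def]; ring
      simp_rw [this]
      rw [← Finset.mul_sum, h2, mul_zero]
    have h3 : Q.eval₂ (constMap k E) x = ∑ i ∈ Finset.range (P.natDegree + 1),
        -((algebraMap _ E (P.coeff i / P.coeff i0) - constMap k E (c i)) * x ^ i) := by
      simp only [Q, Polynomial.eval₂_finsetSum, Polynomial.eval₂_monomial, sub_mul,
        Finset.sum_neg_distrib, Finset.sum_sub_distrib, h1]
      simp
    rw [h3]
    refine v.map_sum_lt one_ne_zero fun i _ => ?_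
    rw [Valuation.map_neg, map_mul, map_pow]
    exact mul_lt_one_of_lt_of_le (hc i) (pow_le_one₀ zero_le hx)
  by_contra! hno
  have hQs := (IsAlgClosed.splits Q).eq_prod_roots
  rw [hQs, Polynomial.eval₂_mul, Polynomial.eval₂_C, map_mul,
    val_const hO (by simpa using hQ0), one_mul] at hQx
  refine absurd hQx (not_lt.2 ?_)
  have key : ∀ s : Multiset k,
      1 ≤ v ((s.map fun r => Polynomial.X - Polynomial.C r).prod.eval₂ (constMap k E) x) := by
    intro s
    induction s using Multiset.induction with
    | empty => simp
    | cons a s ih =>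
      rw [Multiset.map_cons, Multiset.prod_cons, Polynomial.eval₂_mul, map_mul]
      refine one_le_mul_of_one_le_of_one_le ?_ ih
      simpa using hno a
  exact key _

lemma exists_pow_val {x : E} (hx : x ≠ 0) :
    ∃ n : ℕ, 0 < n ∧ n ≤ Module.finrank (RatFunc k) E ∧
      ∃ s : ℤ, O.valuation x ^ n = O.valuation (coord k E) ^ s := by
  classical
  set v := O.valuation
  set P := minpoly (RatFunc k) x with hPdef
  have hint : IsIntegral (RatFunc k) x := IsIntegral.of_finite _ _
  have hP0 : P ≠ 0 := minpoly.ne_zero hint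
  have hvx : v x ≠ 0 := by simpa using hx
  set f : ℕ → E := fun i => algebraMap _ E (P.coeff i) * x ^ i
  have hsum : ∑ i ∈ P.support, f i = 0 := by
    have h2 : Polynomial.aeval x P = 0 := minpoly.aeval _ _
    rw [Polynomial.aeval_def, Polynomial.eval₂_eq_sum] at h2
    exact h2
  obtain ⟨i, hi, hmax⟩ := Finset.exists_max_image P.support (fun i => v (f i))
    (Polynomial.nonempty_support_iff.2 hP0)
  have hci : ∀ i ∈ P.support, algebraMap _ E (P.coeff i) ≠ 0 := fun i hi => by
    simpa using Polynomial.mem_support_iff.1 hi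
  have hfi : v (f i) ≠ 0 := by
    simp only [f, ne_eq, map_mul, mul_eq_zero, map_pow, not_or]
    exact ⟨by simpa using hci i hi, pow_ne_zero _ hvx⟩
  obtain ⟨j, hj, hji, hvj⟩ : ∃ j ∈ P.support, j ≠ i ∧ v (f j) = v (f i) := by
    by_contra! hno
    have := v.map_sum_eq_of_lt (s := P.support) (f := f) hi (fun j hj => by
      rw [Finset.mem_sdiff, Finset.mem_singleton] at hj
      exact lt_of_le_of_ne (hmax j hj.1) (hno j hj.1 hj.2))
    rw [hsum, map_zero] at this
    exact hfi this.symm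
  have key : ∀ i j : ℕ, i ∈ P.support → j ∈ P.support → i < j → v (f j) = v (f i) →
      ∃ n : ℕ, 0 < n ∧ n ≤ Module.finrank (RatFunc k) E ∧
        ∃ s : ℤ, v x ^ n = v (coord k E) ^ s := by
    intro i j hi hj hij h
    refine ⟨j - i, Nat.sub_pos_of_lt hij, ?_, (P.coeff i).intDegree - (P.coeff j).intDegree, ?_⟩
    · exact (Nat.sub_le _ _).trans
        ((Polynomial.le_natDegree_of_mem_supp _ hj).trans (minpoly.natDegree_le x))
    · have ht : v (coord k E) ≠ 0 := by simpa using coord_ne_zero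
      have hi' := Polynomial.mem_support_iff.1 hi
      have hj' := Polynomial.mem_support_iff.1 hj
      simp only [f, map_mul, map_pow] at h
      rw [val_algebraMap hO hi', val_algebraMap hO hj'] at h
      rw [zpow_sub₀ ht, eq_div_iff (zpow_ne_zero _ ht)]
      have hx3 : v x ^ j = v x ^ (j - i) * v x ^ i := by
        rw [← pow_add, Nat.sub_add_cancel hij.le]
      rw [hx3, ← mul_assoc] at h
      rw [mul_comm]
      exact mul_right_cancel₀ (pow_ne_zero i hvx) h
  rcases lt_or_gt_of_ne hji with h | h
  · exact key j i hj hi h hvj.symm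
  · exact key i j hi hj h hvj

lemma exists_pow_val_uniform {x : E} (hx : x ≠ 0) :
    ∃ s : ℤ, O.valuation x ^ (Module.finrank (RatFunc k) E).factorial
      = O.valuation (coord k E) ^ s := by
  obtain ⟨n, hn, hn', s, hs⟩ := exists_pow_val hO hx
  obtain ⟨q, hq⟩ := Nat.dvd_factorial hn hn'
  exact ⟨s * q, by rw [hq, pow_mul, hs, zpow_mul, zpow_natCast]⟩

/-- The valuation at a point over infinity is discrete. -/
lemma exists_isUnif [IsAlgClosed k] : ∃ π : E, IsUnif O.valuation (constMap k E) π := by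
  set v := O.valuation
  set N := (Module.finrank (RatFunc k) E).factorial
  have hN : N ≠ 0 := Nat.factorial_ne_zero _
  have ht := one_lt_val_coord hO
  have ht0 : v (coord k E) ≠ 0 := (zero_lt_one.trans ht).ne'
  let S : AddSubgroup ℤ :=
    { carrier := {s | ∃ x : E, x ≠ 0 ∧ v x ^ N = v (coord k E) ^ s}
      zero_mem' := ⟨1, one_ne_zero, by simp⟩
      add_mem' := by
        rintro a b ⟨x, hx, hxa⟩ ⟨y, hy, hyb⟩
        exact ⟨x * y, mul_ne_zero hx hy, by rw [map_mul, mul_pow, hxa, hyb, zpow_add₀ ht0]⟩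
      neg_mem' := by
        rintro a ⟨x, hx, hxa⟩
        exact ⟨x⁻¹, inv_ne_zero hx, by rw [map_inv₀, inv_pow, hxa, zpow_neg]⟩ }
  obtain ⟨d, hd⟩ := Int.subgroup_cyclic S
  have hNS : (N : ℤ) ∈ S := ⟨coord k E, coord_ne_zero, by simp [v]⟩
  have hd0 : d ≠ 0 := by
    rintro rfl
    rw [hd, AddSubgroup.mem_closure_singleton] at hNS
    obtain ⟨n, hn⟩ := hNS
    simp at hn
    exact hN (by exact_mod_cast hn.symm)
  have hdS : d ∈ S := by rw [hd]; exact AddSubgroup.mem_closure_singleton_self d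
  have hgen : ∀ s ∈ S, ∃ n : ℤ, s = n * -|d| := by
    intro s hs
    rw [hd, AddSubgroup.mem_closure_singleton] at hs
    obtain ⟨n, hn⟩ := hs
    rcases abs_choice d with h | h
    · exact ⟨-n, by rw [h, ← hn, smul_eq_mul]; ring⟩
    · exact ⟨n, by rw [h, ← hn, smul_eq_mul]; ring⟩
  have hd' : -|d| ∈ S := by
    rcases abs_choice d with h | h
    · rw [h]; exact neg_mem hdS
    · rw [h, neg_neg]; exact hdS
  obtain ⟨π, hπ0, hπ⟩ := hd'
  have hπv : v π ≠ 0 := by simpa using hπ0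
  refine ⟨π, hπv, ?_, fun c hc => val_const hO hc, fun x hx => exists_residue hO hx, ?_⟩
  · have : v π ^ N < 1 := by
      rw [hπ]; exact zpow_lt_one_of_neg₀ ht (by simpa using hd0)
    exact (pow_lt_one_iff_of_nonneg zero_le hN).1 this
  · intro x hx
    obtain ⟨s, hs⟩ := exists_pow_val_uniform hO hx
    obtain ⟨n, rfl⟩ := hgen s ⟨x, hx, hs⟩
    refine ⟨n, ?_⟩
    rw [← pow_left_inj₀ zero_le zero_le hN, hs, mul_comm, zpow_mul, ← hπ, ← zpow_natCast,
      ← zpow_natCast, ← zpow_mul, ← zpow_mul, mul_comm]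

lemma IsUniformizer.isUnif [IsAlgClosed k] {π : E} (hπ : IsUniformizer O π) :
    IsUnif O.valuation (constMap k E) π := by
  obtain ⟨ϖ, h⟩ := exists_isUnif hO
  have : O.valuation π = O.valuation ϖ := by
    refine le_antisymm (h.lt_one_iff.1 hπ.2.1) (hπ.2.2 _ h.lt)
  exact ⟨hπ.1, hπ.2.1, h.const, h.res, by rw [this]; exact h.disc⟩

end

section
variable [FiniteDimensional (RatFunc k) E] (hO : O.comap (algebraMap (RatFunc k) E) = inftyPlace k)
include hO

lemma val_apply_of_mem {g : E ≃ₐ[RatFunc k] E} (hg : ∀ x, g x ∈ O ↔ x ∈ O) (x : E) :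
    O.valuation (g x) = O.valuation x := by
  by_cases hx : x = 0
  · simp [hx]
  set N := (Module.finrank (RatFunc k) E).factorial
  have hN : N ≠ 0 := Nat.factorial_ne_zero _
  have ht : coord k E ≠ 0 := coord_ne_zero
  obtain ⟨s, hs⟩ := exists_pow_val_uniform hO hx
  have hvt : O.valuation (coord k E) ^ s ≠ 0 := zpow_ne_zero _ (by simpa using ht)
  have h1 : ∀ u : E, O.valuation u = 1 → O.valuation (g u) = 1 := by
    intro u hu
    have hu0 : u ≠ 0 := by rintro rfl; simp at hu
    refine le_antisymm ?_ ?_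
    · rw [O.valuation_le_one_iff, hg, ← O.valuation_le_one_iff, hu]
    · have : O.valuation (g u⁻¹) ≤ 1 := by
        rw [O.valuation_le_one_iff, hg, ← O.valuation_le_one_iff, map_inv₀, hu, inv_one]
      rw [map_inv₀, map_inv₀] at this
      exact (inv_le_one₀ (zero_lt_iff.2 (by simpa using hu0))).1 this
  have h2 := h1 (x ^ N / coord k E ^ s) (by
    rw [map_div₀, map_pow, map_zpow₀, hs, div_self hvt])
  have h3 : g (coord k E) = coord k E := g.commutes _
  rw [map_div₀, map_div₀, map_zpow₀, map_zpow₀, h3, map_pow, map_pow,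
    div_eq_one_iff_eq hvt, ← hs] at h2
  exact (pow_left_inj₀ zero_le zero_le hN).1 h2

open scoped Pointwise in
/-- Over an algebraically closed field of constants, inertia is the full stabilizer. -/
lemma mem_inertiaIn_iff [IsAlgClosed k] {g : E ≃ₐ[RatFunc k] E} :
    g ∈ inertiaIn k O ↔ ∀ x, O.valuation (g x) = O.valuation x := by
  constructor
  · rintro ⟨⟨g, hg⟩, -, rfl⟩
    refine val_apply_of_mem hO fun x => ?_
    rw [MulAction.mem_stabilizer_iff] at hg
    have := ValuationSubring.smul_mem_pointwise_smul_iff (g := g) (S := O) (x := x)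
    rwa [hg] at this
  · intro h
    have hmem : ∀ x, g x ∈ O ↔ x ∈ O := fun x => by
      rw [← O.valuation_le_one_iff, h, O.valuation_le_one_iff]
    have hg : g ∈ O.decompositionSubgroup (RatFunc k) := by
      rw [MulAction.mem_stabilizer_iff]
      ext x
      rw [ValuationSubring.mem_pointwise_smul_iff_inv_smul_mem, ← hmem]
      simp [AlgEquiv.smul_def]
    refine ⟨⟨g, hg⟩, ?_, rfl⟩
    rw [SetLike.mem_coe, ValuationSubring.inertiaSubgroup, MonoidHom.mem_ker]
    ext r
    obtain ⟨x, rfl⟩ := IsLocalRing.residue_surjective r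
    change IsLocalRing.residue O ((⟨g, hg⟩ : O.decompositionSubgroup (RatFunc k)) • x)
      = IsLocalRing.residue O x
    rw [← sub_eq_zero, ← map_sub, IsLocalRing.residue_eq_zero_iff]
    refine (O.valuation_lt_one_iff _).2 ?_
    change O.valuation (g x - x) < 1
    obtain ⟨c, hc⟩ := exists_residue hO (O.valuation_le_one x)
    have : g x - x = g (x - constMap k E c) - (x - constMap k E c) := by
      have : g (constMap k E c) = constMap k E c := g.commutes _
      rw [map_sub, this]; ring
    rw [this]
    exact O.valuation.map_sub_lt (by rwa [h]) hc

lemma fixes_of_mem [IsAlgClosed k] {g : E ≃ₐ[RatFunc k] E} (hg : g ∈ inertiaIn k O) :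
    Fixes O.valuation (constMap k E) (g : E ≃+* E) :=
  ⟨(mem_inertiaIn_iff hO).1 hg, fun _ => g.commutes _⟩

end

end AtInfinityFinite

section Ramification

variable {k E : Type} [Field k] [Field E] [Algebra (RatFunc k) E]
  {O : ValuationSubring E}

section Hom

variable {Γ : Type} [LinearOrderedCommGroupWithZero Γ] {v : Valuation E Γ} {κ : k →+* E} {π z : E}

/-- The character by which a group fixing the valuation acts on `z` to first order. -/
noncomputable def twistHom (h : IsUnif v κ π) (H : Subgroup (E ≃ₐ[RatFunc k] E))
    (hH : ∀ g ∈ H, Fixes v κ (g : E ≃+* E)) (hz : z ≠ 0) : H →* kˣ where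
  toFun g := Units.mk0 (Twist.exists h (hH g g.2) hz).choose
    ((Twist.exists h (hH g g.2) hz).choose_spec.ne_zero (hH g g.2))
  map_one' := by
    ext
    exact (Twist.exists h (hH 1 H.one_mem) hz).choose_spec.unique h
      (by simpa [Twist] using zero_lt_iff.2 ((map_ne_zero v).2 hz))
  map_mul' g g' := by
    ext
    exact (Twist.exists h (hH _ (g * g').2) hz).choose_spec.unique h
      ((Twist.exists h (hH g' g'.2) hz).choose_spec.comp h (hH _ g'.2) (hH _ g.2)
        (Twist.exists h (hH g g.2) hz).choose_spec)

lemma twistHom_spec (h : IsUnif v κ π) (H : Subgroup (E ≃ₐ[RatFunc k] E))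
    (hH : ∀ g ∈ H, Fixes v κ (g : E ≃+* E)) (hz : z ≠ 0) (g : H) :
    Twist v κ (g : E ≃ₐ[RatFunc k] E) z (twistHom h H hH hz g : k) :=
  (Twist.exists h (hH g g.2) hz).choose_spec

lemma twistHom_eq_iff (h : IsUnif v κ π) (H : Subgroup (E ≃ₐ[RatFunc k] E))
    (hH : ∀ g ∈ H, Fixes v κ (g : E ≃+* E)) (hz : z ≠ 0) (g : H) {c : k} :
    (twistHom h H hH hz g : k) = c ↔ Twist v κ (g : E ≃ₐ[RatFunc k] E) z c :=
  ⟨fun hc => hc ▸ twistHom_spec h H hH hz g, fun hc => (twistHom_spec h H hH hz g).unique h hc⟩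

lemma toRingEquiv_pow (g : E ≃ₐ[RatFunc k] E) (n : ℕ) :
    ((g ^ n : E ≃ₐ[RatFunc k] E) : E ≃+* E) = (g : E ≃+* E) ^ n := by
  induction n with
  | zero => rfl
  | succ n ih => rw [pow_succ, pow_succ, ← ih]; rfl

lemma isPGroup_ker_twistHom [FiniteDimensional (RatFunc k) E] {p : ℕ} [CharP k p] (hp : p.Prime)
    (h : IsUnif v κ π)
    (H : Subgroup (E ≃ₐ[RatFunc k] E)) (hH : ∀ g ∈ H, Fixes v κ (g : E ≃+* E)) :
    IsPGroup p (twistHom h H hH h.ne_zero).ker := by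
  intro g
  obtain ⟨n, m, hm, hnm⟩ := Nat.exists_eq_pow_mul_and_not_dvd (orderOf_pos g).ne' p hp.ne_one
  refine ⟨n, ?_⟩
  have hgm : (g ^ p ^ n) ^ m = 1 := by rw [← pow_mul, ← hnm, pow_orderOf_eq_one]
  generalize g ^ p ^ n = f at hgm
  have hf : Twist v κ (f.1.1 : E ≃ₐ[RatFunc k] E) π 1 :=
    (twistHom_eq_iff h H hH h.ne_zero f.1).1 (by
      have := f.2
      rw [MonoidHom.mem_ker] at this
      rw [this]; simp)
  have hgm' : f.1.1 ^ m = 1 := by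
    have := congrArg (fun x => x.1.1) hgm
    simpa using this
  have hk : (m : k) ≠ 0 := by rwa [Ne, CharP.cast_eq_zero_iff k p]
  have := eq_of_twist_one h (hH _ f.1.2) hf hk (by rw [← toRingEquiv_pow, hgm']; rfl)
  ext y
  exact this y

end Hom

section
variable [FiniteDimensional (RatFunc k) E] [IsAlgClosed k]
  (hO : O.comap (algebraMap (RatFunc k) E) = inftyPlace k)
include hO

lemma exists_separating {h : E ≃ₐ[RatFunc k] E} (hh : h ∉ inertiaIn k O) :
    ∃ y : E, 1 < O.valuation y ∧ O.valuation (h y) < 1 := by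
  have hiff : ¬ ∀ x, h x ∈ O ↔ x ∈ O := fun hall =>
    hh ((mem_inertiaIn_iff hO).2 (val_apply_of_mem hO hall))
  have hpow : ∀ g : E ≃ₐ[RatFunc k] E, (∀ x, x ∈ O → g x ∈ O) → ∀ x, g x ∈ O → x ∈ O := by
    intro g hg x hx
    have hn : ∀ n : ℕ, ∀ y ∈ O, (g ^ n) y ∈ O := by
      intro n
      induction n with
      | zero => exact fun y hy => hy
      | succ n ih =>
        intro y hy
        rw [pow_succ', AlgEquiv.mul_apply]
        exact hg _ (ih y hy)
    have h1 : (g ^ (orderOf g - 1)) (g x) = x := by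
      rw [← AlgEquiv.mul_apply, ← pow_succ, Nat.sub_add_cancel (orderOf_pos g),
        pow_orderOf_eq_one]; rfl
    rw [← h1]; exact hn _ _ hx
  have h1 : ∃ a, a ∈ O ∧ h a ∉ O := by
    by_contra! hno
    exact hiff fun x => ⟨hpow h hno x, hno x⟩
  have h2 : ∃ b, b ∉ O ∧ h b ∈ O := by
    by_contra! hno
    have h3 : ∀ x, x ∈ O → h⁻¹ x ∈ O := by
      intro x hx
      by_contra hx'
      refine hno _ hx' ?_
      rwa [← AlgEquiv.mul_apply, mul_inv_cancel]
    refine hiff fun x => ⟨fun hx => ?_, fun hx => hpow _ h3 _ ?_⟩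
    · by_contra hx'; exact hno x hx' hx
    · rwa [← AlgEquiv.mul_apply, inv_mul_cancel]
  obtain ⟨a, ha, ha'⟩ := h1
  obtain ⟨b, hb, hb'⟩ := h2
  rw [← O.valuation_le_one_iff] at ha ha' hb hb'
  rw [not_le] at ha' hb
  have ha0 : a ≠ 0 := by rintro rfl; simp at ha'
  have hva : 0 < O.valuation a := zero_lt_iff.2 (by simpa using ha0)
  refine ⟨b / a, ?_, ?_⟩
  · rw [map_div₀, one_lt_div₀ hva]
    exact lt_of_le_of_lt ha hb
  · rw [map_div₀, map_div₀, div_lt_one₀ (zero_lt_one.trans ha')]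
    exact lt_of_le_of_lt hb' ha'

omit [FiniteDimensional (RatFunc k) E] [IsAlgClosed k] [Algebra (RatFunc k) E] hO in
lemma eventually_pow_mul_lt {κ : k →+* E} {π : E} (h : IsUnif O.valuation κ π) {a b : E}
    (ha : O.valuation a < 1) :
    ∀ᶠ R : ℕ in Filter.atTop, O.valuation (a ^ R * b) < 1 := by
  by_cases hb : b = 0
  · simp [hb]
  obtain ⟨n, hn⟩ := h.disc b hb
  filter_upwards [Filter.eventually_ge_atTop ((1 - n).toNat)] with R hR
  have h1 : O.valuation (a ^ R) ≤ O.valuation π ^ (R : ℤ) := by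
    rw [map_pow, zpow_natCast]
    exact pow_le_pow_left₀ zero_le (h.lt_one_iff.1 ha) R
  have h2 := h.mul h1 hn.le
  refine h.lt_one_iff.2 ?_
  have := h.mono h2 (b := 1) (by omega)
  simpa using this

lemma exists_unit_separating {h : E ≃ₐ[RatFunc k] E} (hh : h ∉ inertiaIn k O) :
    ∃ u : E, O.valuation (u - 1) < 1 ∧ O.valuation (h u) < 1 ∧
      ∀ g : E ≃ₐ[RatFunc k] E, O.valuation (g u) ≤ 1 := by
  obtain ⟨π, hπ⟩ := exists_isUnif hO
  obtain ⟨y, hy, hhy⟩ := exists_separating hO hh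
  have ht := one_lt_val_coord hO
  have hgt : ∀ g : E ≃ₐ[RatFunc k] E, g (coord k E) = coord k E := fun g => g.commutes _
  have hev : ∀ᶠ R : ℕ in Filter.atTop, ∀ g : E ≃ₐ[RatFunc k] E,
      O.valuation (g y) < 1 → O.valuation (g y ^ R * coord k E) < 1 := by
    rw [Filter.eventually_all]
    intro g
    by_cases hg : O.valuation (g y) < 1
    · filter_upwards [eventually_pow_mul_lt hπ hg (b := coord k E)] with R hR _ using hR
    · exact Filter.Eventually.of_forall fun _ h' => absurd h' hg
  obtain ⟨R, hR⟩ := hev.exists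
  set w := y ^ R * coord k E
  have hw : 1 < O.valuation w := by
    rw [map_mul, map_pow]
    exact one_lt_mul_of_le_of_lt (one_le_pow₀ hy.le) ht
  have hgw : ∀ g : E ≃ₐ[RatFunc k] E, g w = g y ^ R * coord k E := fun g => by
    rw [map_mul, map_pow, hgt]
  have hwg : ∀ g : E ≃ₐ[RatFunc k] E, O.valuation (g w) < 1 ∨ 1 < O.valuation (g w) := by
    intro g
    rw [hgw]
    rcases lt_or_ge (O.valuation (g y)) 1 with h1 | h1
    · exact Or.inl (hR g h1)
    · right
      rw [map_mul, map_pow]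
      exact one_lt_mul_of_le_of_lt (one_le_pow₀ h1) ht
  have hadd : ∀ z : E, 1 < O.valuation z → O.valuation (1 + z) = O.valuation z := fun z hz =>
    O.valuation.map_add_eq_of_lt_right (by rwa [map_one])
  have hadd' : ∀ z : E, O.valuation z < 1 → O.valuation (1 + z) = 1 := fun z hz => by
    rw [O.valuation.map_add_eq_of_lt_left (by rwa [map_one]), map_one]
  have hw1 : 1 + w ≠ 0 := by
    intro h0
    have := hadd w hw
    rw [h0, map_zero] at this
    rw [← this] at hw
    exact not_lt.2 zero_le hw
  have hsmall : ∀ g : E ≃ₐ[RatFunc k] E, O.valuation (g w) < 1 →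
      O.valuation (g (w / (1 + w))) = O.valuation (g w) := by
    intro g hg
    rw [map_div₀, map_add, map_one, map_div₀, hadd' _ hg, div_one]
  refine ⟨w / (1 + w), ?_, ?_, fun g => ?_⟩
  · have : w / (1 + w) - 1 = -(1 + w)⁻¹ := by field_simp; ring
    rw [this, Valuation.map_neg, map_inv₀, hadd w hw]
    exact inv_lt_one_of_one_lt₀ hw
  · have hhw : O.valuation (h w) < 1 := by rw [hgw]; exact hR h hhy
    rw [hsmall h hhw]; exact hhw
  · rcases hwg g with h1 | h1
    · rw [hsmall g h1]; exact h1.le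
    · rw [map_div₀, map_add, map_one, map_div₀, hadd _ h1, div_self (zero_lt_one.trans h1).ne']

/-- The ramification index divides the order of the inertia group. -/
lemma ramification_dvd_card [IsGalois (RatFunc k) E] {π : E}
    (hπ : IsUnif O.valuation (constMap k E) π) {e : ℤ}
    (he : O.valuation (coord k E) = O.valuation π ^ (-e)) :
    e ∣ (Nat.card (inertiaIn k O) : ℤ) := by
  classical
  set v := O.valuation
  set D := inertiaIn k O
  have hch : ∀ h : E ≃ₐ[RatFunc k] E, ∃ u : E, h ∉ D → (v (u - 1) < 1 ∧ v (h u) < 1 ∧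
      ∀ g : E ≃ₐ[RatFunc k] E, v (g u) ≤ 1) := by
    intro h
    by_cases hh : h ∈ D
    · exact ⟨0, fun h' => absurd hh h'⟩
    · obtain ⟨u, hu⟩ := exists_unit_separating hO hh
      exact ⟨u, fun _ => hu⟩
  choose U hU using hch
  set S : Finset (E ≃ₐ[RatFunc k] E) := Finset.univ.filter (· ∉ D)
  set u := ∏ h ∈ S, U h
  have hu1 : v (u - 1) < 1 := by
    refine Finset.prod_induction U (fun a => v (a - 1) < 1) ?_ (by simp) fun h hh =>
      (hU h (by simpa [S] using hh)).1
    intro a b ha hb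
    have hb1 : v b = 1 := by
      have := v.map_add_eq_of_lt_right (x := b - 1) (y := 1) (by rwa [map_one])
      rwa [sub_add_cancel, map_one] at this
    have : a * b - 1 = (a - 1) * b + (b - 1) := by ring
    rw [this]
    refine v.map_add_lt ?_ hb
    rwa [map_mul, hb1, mul_one]
  have hvu : v u = 1 := by
    have := v.map_add_eq_of_lt_right (x := u - 1) (y := 1) (by rwa [map_one])
    rwa [sub_add_cancel, map_one] at this
  have hhu : ∀ h ∉ D, v (h u) < 1 := by
    intro h hh
    have hS : h ∈ S := by simpa [S] using hh
    rw [map_prod, map_prod, ← Finset.mul_prod_erase S _ hS]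
    refine mul_lt_one_of_lt_of_le (hU h hh).2.1 (Finset.prod_le_one (fun _ _ => zero_le) ?_)
    intro h' hh'
    exact (hU h' (by simpa [S] using Finset.mem_of_mem_erase hh')).2.2 h
  obtain ⟨M, hM⟩ := (eventually_pow_mul_lt hπ (a := u - 1) (b := π⁻¹) hu1).exists
  have hev : ∀ᶠ R : ℕ in Filter.atTop, ∀ h : E ≃ₐ[RatFunc k] E, h ∉ D →
      v ((h u) ^ R * h π) < 1 := by
    rw [Filter.eventually_all]
    intro g
    by_cases hg : g ∈ D
    · exact Filter.Eventually.of_forall fun _ h' => absurd hg h'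
    · filter_upwards [eventually_pow_mul_lt hπ (hhu g hg) (b := g π)] with R hR _ using hR
  obtain ⟨R, hR⟩ := hev.exists
  set w := u ^ R * π + (u - 1) ^ M
  have hwv : v w = v π := by
    have h1 : v (u ^ R * π) = v π := by rw [map_mul, map_pow, hvu, one_pow, one_mul]
    rw [v.map_add_eq_of_lt_left, h1]
    rw [h1]
    rw [map_mul, map_inv₀] at hM
    have := mul_lt_mul_of_pos_right hM (zero_lt_iff.2 hπ.ne)
    rwa [mul_assoc, inv_mul_cancel₀ hπ.ne, mul_one, one_mul] at this
  have hgw : ∀ g : E ≃ₐ[RatFunc k] E, v (g w) = if g ∈ D then v π else 1 := by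
    intro g
    split_ifs with hg
    · rw [(mem_inertiaIn_iff hO).1 hg, hwv]
    · have h1 : v (g ((u - 1) ^ M)) = 1 := by
        have := v.map_sub_eq_of_lt_right (x := g u) (y := 1) (by rw [map_one]; exact hhu g hg)
        rw [map_pow, map_sub, map_one, map_pow, this, map_one, one_pow]
      rw [map_add, map_mul, map_pow, v.map_add_eq_of_lt_right, h1]
      rw [h1]
      exact hR g hg
  have hnorm := congrArg v (Algebra.norm_eq_prod_automorphisms (RatFunc k) w)
  rw [map_prod] at hnorm
  simp_rw [hgw] at hnorm
  have hcard : (Finset.univ.filter (· ∈ D)).card = Nat.card D := by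
    rw [Nat.card_eq_fintype_card, Fintype.card_subtype]
  rw [Finset.prod_ite, Finset.prod_const, Finset.prod_const_one, mul_one, hcard] at hnorm
  have hn0 : Algebra.norm (RatFunc k) w ≠ 0 := by
    intro h0
    rw [h0, map_zero, map_zero] at hnorm
    exact pow_ne_zero _ hπ.ne hnorm.symm
  rw [val_algebraMap hO hn0, he, ← zpow_mul, ← zpow_natCast, hπ.zpow_inj] at hnorm
  exact ⟨-(Algebra.norm (RatFunc k) w).intDegree, by rw [← hnorm]; ring⟩

end

end Ramification

section Finite

open Polynomial

variable {k E : Type} [Field k] [Field E] [Algebra (RatFunc k) E] [Algebra (Polynomial k) E]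
  [IsScalarTower (Polynomial k) (RatFunc k) E]

instance galSMulComm : SMulCommClass (E ≃ₐ[RatFunc k] E) (Polynomial k) E := ⟨fun g f x => by
  rw [← algebraMap_smul (RatFunc k) f, AlgEquiv.smul_def, map_smul, algebraMap_smul]; rfl⟩

lemma algebraMap_X_eq : algebraMap (Polynomial k) E X = coord k E := by
  rw [IsScalarTower.algebraMap_apply (Polynomial k) (RatFunc k) E, RatFunc.algebraMap_X]; rfl

lemma algebraMap_C_eq (c : k) : algebraMap (Polynomial k) E (C c) = constMap k E c := by
  rw [IsScalarTower.algebraMap_apply (Polynomial k) (RatFunc k) E, RatFunc.algebraMap_C]; rfl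

lemma isIntegral_const (c : k) : IsIntegral (Polynomial k) (constMap k E c) := by
  rw [← algebraMap_C_eq]; exact isIntegral_algebraMap

lemma algebraMap_poly_injective : Function.Injective (algebraMap (Polynomial k) E) := by
  rw [IsScalarTower.algebraMap_eq (Polynomial k) (RatFunc k) E]
  exact (algebraMap (RatFunc k) E).injective.comp (RatFunc.algebraMap_injective k)

lemma isIntegral_apply (g : E ≃ₐ[RatFunc k] E) {x : E} (hx : IsIntegral (Polynomial k) x) :
    IsIntegral (Polynomial k) (g x) :=
  hx.map (g.restrictScalars (Polynomial k))

section ResidueMap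

variable {B : Type} [CommRing B] [Algebra (Polynomial k) B] [Algebra.IsIntegral (Polynomial k) B]
  [IsAlgClosed k]

lemma exists_residueHom (Q : Ideal B) [Q.IsMaximal] (α : k)
    (hQ : algebraMap (Polynomial k) B (X - C α) ∈ Q) :
    ∃ φ : B →+* k, (∀ f, φ (algebraMap (Polynomial k) B f) = f.eval α) ∧ RingHom.ker φ = Q := by
  let _ : Field (B ⧸ Q) := Ideal.Quotient.field Q
  let i : k →+* B ⧸ Q := (Ideal.Quotient.mk Q).comp ((algebraMap (Polynomial k) B).comp C)
  have hi : (Ideal.Quotient.mk Q).comp (algebraMap (Polynomial k) B) = i.comp (evalRingHom α) := by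
    ext
    · simp [i]
    · have := Ideal.Quotient.eq_zero_iff_mem.2 hQ
      rw [map_sub, map_sub, sub_eq_zero] at this
      simpa [i] using this
  have hint : i.IsIntegral := by
    refine RingHom.IsIntegral.tower_top (evalRingHom α) i ?_
    rw [← hi]
    exact RingHom.IsIntegral.trans _ _ (algebraMap_isIntegral_iff.2 inferInstance)
      (RingHom.isIntegral_of_surjective _ Ideal.Quotient.mk_surjective)
  let e : k ≃+* B ⧸ Q := RingEquiv.ofBijective i (IsAlgClosed.ringHom_bijective_of_isIntegral i hint)
  refine ⟨(e.symm : B ⧸ Q →+* k).comp (Ideal.Quotient.mk Q), fun f => ?_, ?_⟩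
  · have := congrArg (fun h => h f) hi
    simp only [RingHom.comp_apply] at this
    simp only [RingHom.comp_apply, this]
    exact e.symm_apply_apply _
  · ext b
    rw [RingHom.mem_ker, RingHom.comp_apply]
    simp [Ideal.Quotient.eq_zero_iff_mem]

end ResidueMap

lemma algebraMap_X_sub_C_mem {B : Type} [CommRing B] [Algebra (Polynomial k) B]
    (Q : Ideal B) (α : k)
    [h : Q.LiesOver (Ideal.span {X - C α})] : algebraMap (Polynomial k) B (X - C α) ∈ Q := by
  have := h.over
  rw [← Ideal.mem_comap]
  change _ ∈ Q.under _
  rw [← this]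
  exact Ideal.mem_span_singleton_self _

variable [FiniteDimensional (RatFunc k) E]

instance fractionIntegralClosure : IsFractionRing (integralClosure (Polynomial k) E) E :=
  integralClosure.isFractionRing_of_finite_extension (RatFunc k) E

variable [IsGalois (RatFunc k) E]

instance galoisIntegralClosure :
    IsGaloisGroup (E ≃ₐ[RatFunc k] E) (Polynomial k) (integralClosure (Polynomial k) E) :=
  IsGaloisGroup.of_isFractionRing _ _ _ (RatFunc k) E

/-- An integral element fixed by the Galois group is a polynomial. -/
lemma exists_poly_of_fixed {x : E} (hx : IsIntegral (Polynomial k) x)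
    (hfix : ∀ σ : E ≃ₐ[RatFunc k] E, σ x = x) : ∃ f : Polynomial k, algebraMap _ E f = x := by
  obtain ⟨a, rfl⟩ := (IsGalois.mem_range_algebraMap_iff_fixed x).2 hfix
  have : IsIntegral (Polynomial k) a :=
    (isIntegral_algebraMap_iff (algebraMap (RatFunc k) E).injective).1 hx
  obtain ⟨f, rfl⟩ := IsIntegrallyClosed.isIntegral_iff.1 this
  exact ⟨f, IsScalarTower.algebraMap_apply _ _ _ f⟩

/-- In an étale cover of the line, an integral element vanishing at all points of a fibre is
divisible by the local parameter of the base. -/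
lemma exists_residue_divisible [IsAlgClosed k]
    [Algebra.Etale (Polynomial k) (integralClosure (Polynomial k) E)] (α : k) :
    ∃ φ : integralClosure (Polynomial k) E →+* k,
      (∀ f : Polynomial k, φ (algebraMap _ _ f) = f.eval α) ∧
      ∀ b : integralClosure (Polynomial k) E, (∀ σ : E ≃ₐ[RatFunc k] E, φ (σ • b) = 0) →
        ∃ b', b = algebraMap _ _ (X - C α) * b' := by
  set B := integralClosure (Polynomial k) E
  have hmax : (Ideal.span {(X - C α : Polynomial k)}).IsMaximal :=
    PrincipalIdealRing.isMaximal_of_irreducible (irreducible_X_sub_C α)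
  have : FaithfulSMul (Polynomial k) B :=
    (faithfulSMul_iff_algebraMap_injective _ _).2 fun a b hab =>
      algebraMap_poly_injective (E := E) (congrArg Subtype.val hab)
  obtain ⟨Q, hQm, hQ⟩ := Ideal.exists_maximal_ideal_liesOver_of_isIntegral
    (S := B) (Ideal.span {(X - C α : Polynomial k)})
  obtain ⟨φ, hφ, hker⟩ := exists_residueHom Q α (algebraMap_X_sub_C_mem Q α)
  refine ⟨φ, hφ, fun b hb => ?_⟩
  have hrad := Algebra.FormallyUnramified.isRadical_map_isMaximal (Polynomial k) B
    (Ideal.span {(X - C α : Polynomial k)})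
  have : b ∈ (Ideal.map (algebraMap (Polynomial k) B) (Ideal.span {X - C α})).radical := by
    rw [Ideal.radical_eq_sInf, Ideal.mem_sInf]
    rintro P ⟨hle, hP⟩
    have hu : Q.under (Polynomial k) = P.under (Polynomial k) := by
      rw [← hQ.over]
      exact hmax.eq_of_le (Ideal.IsPrime.under _ P).ne_top (Ideal.map_le_iff_le_comap.1 hle)
    obtain ⟨g, rfl⟩ := Algebra.IsInvariant.exists_smul_of_under_eq (Polynomial k) B
      (E ≃ₐ[RatFunc k] E) Q P hu
    rw [Ideal.mem_pointwise_smul_iff_inv_smul_mem, ← hker, RingHom.mem_ker]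
    exact hb _
  rw [hrad.radical, Ideal.map_span, Set.image_singleton, Ideal.mem_span_singleton] at this
  exact this

end Finite

section Equivariant

open Polynomial

variable {k E : Type} [Field k] [Field E] [Algebra (RatFunc k) E] [Algebra (Polynomial k) E]
  {n : Type} [Fintype n] [DecidableEq n]
  (R : (E ≃ₐ[RatFunc k] E) →* Matrix n n k)

/-- Vectors of integral elements on which the Galois group acts through a representation over the
field of constants. -/
structure Equi (N : n → E) : Prop where
  integral : ∀ i, IsIntegral (Polynomial k) (N i)
  apply : ∀ (σ : E ≃ₐ[RatFunc k] E) i, σ (N i) = ∑ j, constMap k E (R σ⁻¹ i j) * N j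

variable {R}

lemma Equi.add {N N' : n → E} (h : Equi R N) (h' : Equi R N') : Equi R (N + N') :=
  ⟨fun i => (h.integral i).add (h'.integral i), fun σ i => by
    simp only [Pi.add_apply, map_add, h.apply σ, h'.apply σ, mul_add, Finset.sum_add_distrib]⟩

lemma equi_zero : Equi R (0 : n → E) :=
  ⟨fun _ => isIntegral_zero, fun σ i => by simp⟩

variable [IsScalarTower (Polynomial k) (RatFunc k) E]

lemma apply_algebraMap_poly (σ : E ≃ₐ[RatFunc k] E) (f : Polynomial k) :
    σ (algebraMap (Polynomial k) E f) = algebraMap (Polynomial k) E f := by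
  rw [IsScalarTower.algebraMap_apply (Polynomial k) (RatFunc k) E, σ.commutes]

lemma Equi.smul {N : n → E} (h : Equi R N) (f : Polynomial k) :
    Equi R (fun i => algebraMap _ E f * N i) :=
  ⟨fun i => isIntegral_algebraMap.mul (h.integral i), fun σ i => by
    rw [map_mul, apply_algebraMap_poly, h.apply, Finset.mul_sum]
    exact Finset.sum_congr rfl fun j _ => by ring⟩

lemma Equi.of_smul {N : n → E} {f : Polynomial k} (hf : f ≠ 0)
    (h : Equi R (fun i => algebraMap _ E f * N i))
    (hN : ∀ i, IsIntegral (Polynomial k) (N i)) : Equi R N :=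
  ⟨hN, fun σ i => by
    have h2 := h.apply σ i
    rw [map_mul, apply_algebraMap_poly] at h2
    have h3 : algebraMap (Polynomial k) E f ≠ 0 := by
      rw [Ne, ← map_zero (algebraMap (Polynomial k) E), algebraMap_poly_injective.eq_iff]
      exact hf
    refine mul_left_cancel₀ h3 (h2.trans ?_)
    rw [Finset.mul_sum]
    exact Finset.sum_congr rfl fun j _ => by ring⟩

omit [IsScalarTower (Polynomial k) (RatFunc k) E] in
lemma Equi.sum {ι : Type} {s : Finset ι} {N : ι → n → E} (h : ∀ i, Equi R (N i)) :
    Equi R (∑ i ∈ s, N i) := by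
  classical
  induction s using Finset.induction with
  | empty => exact equi_zero
  | insert a s ha ih => rw [Finset.sum_insert ha]; exact (h a).add ih

variable [FiniteDimensional (RatFunc k) E]

lemma equi_trace (x : E) (hx : IsIntegral (Polynomial k) x) (U : n → k) :
    Equi R (fun i => ∑ σ : E ≃ₐ[RatFunc k] E, σ x * constMap k E ((R σ).mulVec U i)) := by
  refine ⟨fun i => IsIntegral.sum _ fun σ _ => (isIntegral_apply σ hx).mul (isIntegral_const _),
    fun τ i => ?_⟩
  simp only [map_sum, map_mul, Finset.mul_sum]
  conv_rhs => rw [Finset.sum_comm, ← Equiv.sum_comp (Equiv.mulLeft τ)]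
  refine Finset.sum_congr rfl fun σ _ => ?_
  have h1 : ∀ c, τ (constMap k E c) = constMap k E c := fun c => τ.commutes _
  have h2 : (R σ).mulVec U = (R τ⁻¹).mulVec ((R (τ * σ)).mulVec U) := by
    rw [Matrix.mulVec_mulVec, ← map_mul, inv_mul_cancel_left]
  have h3 : constMap k E ((R σ).mulVec U i)
      = ∑ j, constMap k E (R τ⁻¹ i j) * constMap k E ((R (τ * σ)).mulVec U j) := by
    rw [h2, Matrix.mulVec, dotProduct, map_sum]
    simp only [map_mul]
  rw [h1, h3, Finset.mul_sum]
  refine Finset.sum_congr rfl fun j _ => ?_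
  rw [Equiv.coe_mulLeft, AlgEquiv.mul_apply]
  ring

lemma span_equi_eq_top : Submodule.span E {N : n → E | Equi R N} = ⊤ := by
  by_contra hne
  obtain ⟨f, hf, hle⟩ := Submodule.exists_le_ker_of_lt_top _ (lt_top_iff_ne_top.2 hne)
  have hker : ∀ x : E, IsIntegral (Polynomial k) x → ∀ U : n → k,
      ∑ σ : E ≃ₐ[RatFunc k] E, f (fun i => constMap k E ((R σ).mulVec U i)) * σ x = 0 := by
    intro x hx U
    have h1 : f _ = 0 := hle (Submodule.subset_span (equi_trace (R := R) x hx U))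
    rw [← h1]
    have : (fun i => ∑ σ : E ≃ₐ[RatFunc k] E, σ x * constMap k E ((R σ).mulVec U i))
        = ∑ σ : E ≃ₐ[RatFunc k] E, σ x • (fun i => constMap k E ((R σ).mulVec U i)) := by
      ext i; simp
    rw [this, map_sum]
    exact Finset.sum_congr rfl fun σ _ => by rw [map_smul, smul_eq_mul, mul_comm]
  have hall : ∀ x : E, ∀ U : n → k,
      ∑ σ : E ≃ₐ[RatFunc k] E, f (fun i => constMap k E ((R σ).mulVec U i)) * σ x = 0 := by
    intro x U
    have hx : IsAlgebraic (Polynomial k) x :=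
      (IsFractionRing.isAlgebraic_iff (Polynomial k) (RatFunc k) E).2
        (Algebra.IsAlgebraic.isAlgebraic x)
    obtain ⟨d, hd, hyd⟩ := hx.exists_integral_multiple
    have h3 : algebraMap (Polynomial k) E d ≠ 0 := by
      rw [Ne, ← map_zero (algebraMap (Polynomial k) E), algebraMap_poly_injective.eq_iff]
      exact hd
    have := hker _ hyd U
    refine mul_left_cancel₀ h3 ?_
    rw [mul_zero, Finset.mul_sum, ← this]
    refine Finset.sum_congr rfl fun σ _ => ?_
    rw [Algebra.smul_def, map_mul, apply_algebraMap_poly]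
    ring
  have hli := linearIndependent_monoidHom E E
  have hinj : Function.Injective fun σ : E ≃ₐ[RatFunc k] E =>
      ((σ : E →ₐ[RatFunc k] E) : E →* E) := by
    intro σ τ h
    ext x
    exact DFunLike.congr_fun h x
  have hli' := hli.comp _ hinj
  rw [Fintype.linearIndependent_iff] at hli'
  apply hf
  refine LinearMap.ext fun N => ?_
  have hconst : ∀ i, f (Pi.single i 1) = 0 := by
    intro i
    have := hli' (fun σ => f (fun i' => constMap k E ((R σ).mulVec (Pi.single i 1) i'))) (by
      ext x
      have := hall x (Pi.single i 1)
      simpa using this) 1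
    rw [map_one] at this
    convert this using 2
    ext j
    by_cases h : j = i
    · subst h; simp
    · simp [h]
  rw [← Finset.univ_sum_single N, map_sum, LinearMap.zero_apply]
  refine Finset.sum_eq_zero fun i _ => ?_
  have : (Pi.single i (N i) : n → E) = N i • Pi.single i 1 := by
    rw [← Pi.single_smul, smul_eq_mul, mul_one]
  rw [this, map_smul, hconst, smul_zero]

lemma exists_equi_det_ne_zero :
    ∃ N : Matrix n n E, (∀ i, Equi R (N i)) ∧ N.det ≠ 0 := by
  let b := Module.Basis.ofSpan (span_equi_eq_top (R := R)).ge
  have hb : ∀ i, Equi R (b i) := fun i =>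
    Module.Basis.ofSpan_subset (span_equi_eq_top (R := R)).ge ⟨i, rfl⟩
  have : Fintype _ := FiniteDimensional.fintypeBasisIndex b
  have hcard := (Module.finrank_eq_card_basis b).symm.trans (Module.finrank_fintype_fun_eq_card E)
  let e := Fintype.equivOfCardEq hcard
  refine ⟨Matrix.of (fun i => b (e.symm i)), fun i => hb _, ?_⟩
  rw [← isUnit_iff_ne_zero, ← Matrix.isUnit_iff_isUnit_det,
    ← Matrix.linearIndependent_rows_iff_isUnit]
  exact b.linearIndependent.comp _ e.symm.injective

variable [IsGalois (RatFunc k) E]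

lemma exists_poly_eq_det (hR : ∀ σ, (R σ).det = 1) {N : Matrix n n E} (hN : ∀ i, Equi R (N i)) :
    ∃ f : Polynomial k, algebraMap _ E f = N.det := by
  refine exists_poly_of_fixed ?_ fun σ => ?_
  · let M : Matrix n n (integralClosure (Polynomial k) E) := fun i j => ⟨N i j, (hN i).integral j⟩
    have hM : M.map (algebraMap (integralClosure (Polynomial k) E) E) = N := rfl
    rw [← hM, ← RingHom.mapMatrix_apply, ← RingHom.map_det]
    exact M.det.2
  · have h1 : N.map σ = N * ((R σ⁻¹).map (constMap k E)).transpose := by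
      ext i j
      rw [Matrix.map_apply, (hN i).apply, Matrix.mul_apply]
      exact Finset.sum_congr rfl fun l _ => mul_comm _ _
    have h2 : ((R σ⁻¹).map (constMap k E)).det = 1 := by
      rw [← RingHom.mapMatrix_apply, ← RingHom.map_det, hR, map_one]
    have h3 : σ N.det = (N.map σ).det :=
      (AlgHom.map_det (σ : E →ₐ[RatFunc k] E) N)
    rw [h3, h1, Matrix.det_mul, Matrix.det_transpose, h2, mul_one]

/-- The lattice of equivariant vectors of an étale cover of the line has a basis whose
determinant is constant. -/
lemma exists_equi_det_const [IsAlgClosed k]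
    [Algebra.Etale (Polynomial k) (integralClosure (Polynomial k) E)]
    (hR : ∀ σ, (R σ).det = 1) :
    ∃ N : Matrix n n E, (∀ i, Equi R (N i)) ∧ ∃ c : k, c ≠ 0 ∧ N.det = constMap k E c := by
  suffices H : ∀ d : ℕ, ∀ (N : Matrix n n E) (f : Polynomial k), (∀ i, Equi R (N i)) →
      algebraMap _ E f = N.det → f ≠ 0 → f.natDegree = d →
      ∃ N : Matrix n n E, (∀ i, Equi R (N i)) ∧ ∃ c : k, c ≠ 0 ∧ N.det = constMap k E c by
    obtain ⟨N, hN, hdet⟩ := exists_equi_det_ne_zero (R := R)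
    obtain ⟨f, hf⟩ := exists_poly_eq_det hR hN
    exact H _ N f hN hf (by rintro rfl; exact hdet (by rw [← hf, map_zero])) rfl
  intro d
  induction d with
  | zero =>
    intro N f hN hf hf0 hd
    obtain ⟨c, rfl⟩ := natDegree_eq_zero.1 hd
    exact ⟨N, hN, c, by rintro rfl; simp at hf0, by rw [← hf, algebraMap_C_eq]⟩
  | succ d ih =>
    intro N f hN hf hf0 hd
    obtain ⟨α, hα⟩ := IsAlgClosed.exists_root f (by
      rw [degree_eq_natDegree hf0, hd]; exact_mod_cast Nat.succ_ne_zero d)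
    set B := integralClosure (Polynomial k) E
    obtain ⟨φ, hφ, hdiv⟩ := exists_residue_divisible (E := E) α
    let M : Matrix n n B := fun i j => ⟨N i j, (hN i).integral j⟩
    have hM : M.map (algebraMap B E) = N := rfl
    have hMdet : M.det = algebraMap (Polynomial k) B f := by
      have : algebraMap B E M.det = algebraMap B E (algebraMap (Polynomial k) B f) := by
        rw [RingHom.map_det, RingHom.mapMatrix_apply, hM, ← hf]; rfl
      exact Subtype.val_injective this
    have hc : (M.map φ).det = 0 := by
      rw [← RingHom.mapMatrix_apply, ← RingHom.map_det, hMdet, hφ]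
      exact hα
    obtain ⟨l, hl0, hl⟩ := Matrix.exists_vecMul_eq_zero_iff.2 hc
    obtain ⟨i₀, hi₀⟩ := Function.ne_iff.1 hl0
    let N' : n → E := ∑ i, fun j => algebraMap (Polynomial k) E (C (l i)) * N i j
    have hN' : Equi R N' := Equi.sum fun i => (hN i).smul _
    have hφN : ∀ j, φ ⟨N' j, hN'.integral j⟩ = 0 := by
      intro j
      have h1 : (⟨N' j, hN'.integral j⟩ : B)
          = ∑ i, algebraMap (Polynomial k) B (C (l i)) * M i j := by
        apply Subtype.val_injective
        rw [AddSubmonoidClass.coe_finsetSum]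
        simp only [N', Finset.sum_apply]
        rfl
      rw [h1, map_sum]
      refine (Finset.sum_congr rfl fun i _ => ?_).trans (congrFun hl j)
      rw [map_mul]
      exact congrArg (· * _) ((hφ _).trans eval_C)
    have hdvd : ∀ j, ∃ b' : B, (⟨N' j, hN'.integral j⟩ : B) = algebraMap _ _ (X - C α) * b' := by
      intro j
      refine hdiv _ fun σ => ?_
      have h1 : (σ • (⟨N' j, hN'.integral j⟩ : B) : B)
          = ∑ i, algebraMap (Polynomial k) B (C (R σ⁻¹ j i)) * ⟨N' i, hN'.integral i⟩ := by
        apply Subtype.val_injective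
        rw [AddSubmonoidClass.coe_finsetSum]
        refine (hN'.apply σ j).trans (Finset.sum_congr rfl fun i _ => ?_)
        rw [← algebraMap_C_eq]
        rfl
      rw [h1, map_sum]
      exact Finset.sum_eq_zero fun i _ => by rw [map_mul, hφN, mul_zero]
    choose b hb using hdvd
    have hb' : ∀ j, N' j = algebraMap (Polynomial k) E (X - C α) * b j :=
      fun j => congrArg Subtype.val (hb j)
    have hbE : Equi R (fun j => (b j : E)) :=
      Equi.of_smul (f := X - C α) (X_sub_C_ne_zero α) (by
        rw [← funext hb']; exact hN') fun j => (b j).2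
    have hupd : ∀ i, Equi R (N.updateRow i₀ (fun j => (b j : E)) i) := by
      intro i
      by_cases h : i = i₀
      · subst h; rwa [Matrix.updateRow_self]
      · rw [Matrix.updateRow_ne h]; exact hN i
    have hdet : algebraMap (Polynomial k) E (X - C α) * (N.updateRow i₀ (fun j => (b j : E))).det
        = algebraMap (Polynomial k) E (C (l i₀)) * N.det := by
      have h1 := Matrix.det_updateRow_sum N i₀ (fun i => algebraMap (Polynomial k) E (C (l i)))
      rw [← smul_eq_mul, ← smul_eq_mul, ← h1]
      refine (Matrix.det_updateRow_smul N i₀ _ _).symm.trans ?_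
      congr 2
      ext j
      rw [Finset.sum_apply]
      refine (hb' j).symm.trans ?_
      simp only [N', Finset.sum_apply]
      rfl
    obtain ⟨f', hf'⟩ := exists_poly_eq_det hR hupd
    have hmul : (X - C α) * f' = C (l i₀) * f := by
      apply algebraMap_poly_injective (E := E)
      rw [map_mul, map_mul, hf', hf, hdet]
    have hf'0 : f' ≠ 0 := by
      rintro rfl
      rw [mul_zero] at hmul
      exact mul_ne_zero (C_ne_zero.2 hi₀) hf0 hmul.symm
    refine ih _ f' hupd hf' hf'0 ?_
    have := congrArg natDegree hmul
    rw [natDegree_mul (X_sub_C_ne_zero α) hf'0, natDegree_C_mul hi₀, natDegree_X_sub_C, hd] at this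
    omega

end Equivariant

section Proper

variable {k E : Type} [Field k] [Field E] [Algebra (RatFunc k) E] [Algebra (Polynomial k) E]
  [IsScalarTower (Polynomial k) (RatFunc k) E] {O : ValuationSubring E}
  (hO : O.comap (algebraMap (RatFunc k) E) = inftyPlace k)
include hO

lemma val_poly {f : Polynomial k} (hf : f ≠ 0) :
    O.valuation (algebraMap (Polynomial k) E f) = O.valuation (coord k E) ^ f.natDegree := by
  rw [IsScalarTower.algebraMap_apply (Polynomial k) (RatFunc k) E, val_algebraMap hO
    (by simpa using hf), RatFunc.intDegree_polynomial, zpow_natCast]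

lemma poly_eq_zero_of_val {f : Polynomial k} (hf : O.valuation (algebraMap _ E f) < 1) : f = 0 := by
  by_contra h
  rw [val_poly hO h] at hf
  exact absurd hf (not_lt.2 (one_le_pow₀ (one_lt_val_coord hO).le))

variable [FiniteDimensional (RatFunc k) E] [IsGalois (RatFunc k) E] [IsAlgClosed k]

/-- An integral function without poles at infinity is constant. -/
lemma exists_const_of_conj {x : E} (hx : IsIntegral (Polynomial k) x)
    (h : ∀ σ : E ≃ₐ[RatFunc k] E, O.valuation (σ x) ≤ 1) : ∃ c, x = constMap k E c := by
  classical
  obtain ⟨c, hc⟩ := exists_residue hO (by simpa using h 1)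
  refine ⟨c, sub_eq_zero.1 ?_⟩
  set y := x - constMap k E c
  have hy : IsIntegral (Polynomial k) y := hx.sub (isIntegral_const c)
  obtain ⟨f, hf⟩ := exists_poly_of_fixed (k := k)
    (x := ∏ σ : E ≃ₐ[RatFunc k] E, σ y) (IsIntegral.prod _ fun σ _ => isIntegral_apply σ hy)
    fun τ => by
      rw [map_prod, ← Equiv.prod_comp (Equiv.mulLeft τ) fun σ : E ≃ₐ[RatFunc k] E => σ y]
      rfl
  have hle : ∀ σ : E ≃ₐ[RatFunc k] E, O.valuation (σ y) ≤ 1 := fun σ => by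
    have h1 : σ (constMap k E c) = constMap k E c := σ.commutes _
    rw [map_sub, h1]
    exact O.valuation.map_sub_le (h σ) (val_const_le hO c)
  have hf0 : f = 0 := by
    refine poly_eq_zero_of_val hO ?_
    rw [hf, ← Finset.mul_prod_erase _ _ (Finset.mem_univ (1 : E ≃ₐ[RatFunc k] E)), map_mul]
    refine mul_lt_one_of_lt_of_le hc ?_
    rw [map_prod]
    exact Finset.prod_le_one' fun σ _ => hle σ
  rw [hf0, map_zero, eq_comm, Finset.prod_eq_zero_iff] at hf
  obtain ⟨σ, -, hσ⟩ := hf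
  exact (map_eq_zero σ).1 hσ

/-- Equivariant vectors without poles at infinity are constant and invariant. -/
lemma Equi.exists_const {n : Type} [Fintype n] [DecidableEq n]
    {R : (E ≃ₐ[RatFunc k] E) →* Matrix n n k} {N : n → E} (hN : Equi R N)
    (h : ∀ i, O.valuation (N i) ≤ 1) :
    ∃ c : n → k, (∀ i, N i = constMap k E (c i)) ∧ ∀ σ, (R σ).mulVec c = c := by
  have hc : ∀ i, ∃ c, N i = constMap k E c := fun i =>
    exists_const_of_conj hO (hN.integral i) fun σ => by
      rw [hN.apply]
      refine O.valuation.map_sum_le fun j _ => ?_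
      rw [map_mul]
      exact mul_le_one' (val_const_le hO _) (h j)
  choose c hc using hc
  refine ⟨c, hc, fun σ => ?_⟩
  ext i
  have h1 := hN.apply σ⁻¹ i
  have h2 : σ⁻¹ (constMap k E (c i)) = constMap k E (c i) := σ⁻¹.commutes _
  rw [inv_inv, hc, h2] at h1
  simp only [hc, ← map_mul, ← map_sum] at h1
  exact ((constMap k E).injective h1).symm

end Proper

section ProjectiveSpecialLinear

open Matrix

/-- The adjoint action of `SL₂` in coordinates `(x, y, w)` of `!![x, y; w, -x]`, from the right. -/
def adMat {S : Type} [CommRing S] (A : SpecialLinearGroup (Fin 2) S) : Matrix (Fin 3) (Fin 3) S :=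
  !![A 0 0 * A 1 1 + A 0 1 * A 1 0, A 1 0 * A 1 1, -(A 0 0 * A 0 1);
     2 * (A 0 1 * A 1 1), A 1 1 ^ 2, -A 0 1 ^ 2;
     -2 * (A 0 0 * A 1 0), -A 1 0 ^ 2, A 0 0 ^ 2]

lemma adMat_mul {S : Type} [CommRing S] (A B : SpecialLinearGroup (Fin 2) S) :
    adMat (A * B) = adMat B * adMat A := by
  ext i j
  fin_cases i <;> fin_cases j <;>
    simp [adMat, Matrix.mul_apply, Fin.sum_univ_succ] <;> ring

lemma det_adMat {S : Type} [CommRing S] (A : SpecialLinearGroup (Fin 2) S) :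
    (adMat A).det = 1 := by
  have h := A.det_coe
  rw [Matrix.det_fin_two] at h
  rw [Matrix.det_fin_three]
  simp only [adMat, Matrix.of_apply, Matrix.cons_val', Matrix.cons_val_zero, Matrix.cons_val_one,
    Matrix.cons_val]
  linear_combination ((A 0 0 * A 1 1 - A 0 1 * A 1 0) ^ 2 + (A 0 0 * A 1 1 - A 0 1 * A 1 0) + 1) * h

lemma adMat_center {S : Type} [CommRing S] {A : SpecialLinearGroup (Fin 2) S}
    (hA : A ∈ Subgroup.center (SpecialLinearGroup (Fin 2) S)) : adMat A = 1 := by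
  obtain ⟨r, hr, hA⟩ := Matrix.SpecialLinearGroup.mem_center_iff.1 hA
  have h2 : r ^ 2 = 1 := by simpa using hr
  have h3 : r * r = 1 := by rw [← sq, h2]
  ext i j
  fin_cases i <;> fin_cases j <;> simp [adMat, ← hA, h2, h3]

/-- The adjoint representation of `PSL₂` with entries mapped to a larger ring. -/
noncomputable def adHom {S T : Type} [CommRing S] [CommRing T] (ι : S →+* T) :
    PSL₂ S →* Matrix (Fin 3) (Fin 3) T :=
  QuotientGroup.lift _
    { toFun := fun A => (adMat A⁻¹).map ι
      map_one' := by rw [inv_one, adMat_center (one_mem _)]; simp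
      map_mul' := fun A B => by rw [_root_.mul_inv_rev, adMat_mul, Matrix.map_mul] }
    fun A hA => by
      change (adMat A⁻¹).map ι = 1
      rw [adMat_center (inv_mem hA)]; simp

lemma adHom_inv_mk {S T : Type} [CommRing S] [CommRing T] (ι : S →+* T)
    (A : SpecialLinearGroup (Fin 2) S) :
    adHom ι (QuotientGroup.mk A : PSL₂ S)⁻¹ = (adMat A).map ι := by
  rw [← QuotientGroup.mk_inv]
  change (adMat A⁻¹⁻¹).map ι = _
  rw [inv_inv]

lemma det_adHom {S T : Type} [CommRing S] [CommRing T] (ι : S →+* T) (x : PSL₂ S) :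
    (adHom ι x).det = 1 := by
  obtain ⟨A, hA⟩ := QuotientGroup.mk_surjective x⁻¹
  rw [← inv_inv x, ← hA, adHom_inv_mk, ← RingHom.mapMatrix_apply, ← RingHom.map_det, det_adMat,
    map_one]

/-- Upper triangular elements of `SL₂`. -/
def upperSL {F : Type} [Field F] (a : Fˣ) (b : F) : SpecialLinearGroup (Fin 2) F :=
  ⟨!![a, b; 0, a⁻¹], by simp [Matrix.det_fin_two]⟩

lemma upperSL_mul {F : Type} [Field F] (a a' : Fˣ) (b b' : F) :
    upperSL a b * upperSL a' b' = upperSL (a * a') (a * b' + b * (a'⁻¹ : Fˣ)) := by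
  apply Subtype.ext
  rw [Matrix.SpecialLinearGroup.coe_mul]
  ext i j
  fin_cases i <;> fin_cases j <;> simp [upperSL, mul_comm]

lemma upperSL_one_zero {F : Type} [Field F] : upperSL (1 : Fˣ) (0 : F) = 1 := by
  apply Subtype.ext
  ext i j; fin_cases i <;> fin_cases j <;> simp [upperSL]

/-- Conjugation of `SL₂` by an element of `GL₂`. -/
noncomputable def conjSL {F : Type} [Field F] (P : GL (Fin 2) F) :
    SpecialLinearGroup (Fin 2) F ≃* SpecialLinearGroup (Fin 2) F where
  toFun A := ⟨P.val * A.val * P⁻¹.val, by rw [Matrix.det_units_conj, A.2]⟩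
  invFun A := ⟨P⁻¹.val * A.val * P.val, by rw [Matrix.det_units_conj', A.2]⟩
  left_inv A := by
    apply Subtype.ext
    change P⁻¹.val * (P.val * A.val * P⁻¹.val) * P.val = A.val
    rw [← mul_assoc, ← mul_assoc, Units.inv_mul, one_mul, mul_assoc, Units.inv_mul, mul_one]
  right_inv A := by
    apply Subtype.ext
    change P.val * (P⁻¹.val * A.val * P.val) * P⁻¹.val = A.val
    rw [← mul_assoc, ← mul_assoc, Units.mul_inv, one_mul, mul_assoc, Units.mul_inv, mul_one]
  map_mul' A B := by
    apply Subtype.ext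
    change P.val * (A.val * B.val) * P⁻¹.val
      = (P.val * A.val * P⁻¹.val) * (P.val * B.val * P⁻¹.val)
    simp only [mul_assoc]
    rw [← mul_assoc P⁻¹.val P.val, Units.inv_mul, one_mul]

/-- A nontrivial unipotent element of `SL₂` is conjugate to the standard one. -/
lemma exists_conjSL_eq {F : Type} [Field F] {p : ℕ} [CharP F p] (hp : p.Prime)
    {A : SpecialLinearGroup (Fin 2) F} (hA : A ^ p = 1) (hA1 : A ≠ 1) :
    ∃ P : GL (Fin 2) F, conjSL P (upperSL 1 1) = A := by
  have : Fact p.Prime := ⟨hp⟩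
  set N : Matrix (Fin 2) (Fin 2) F := A.val - 1 with hN
  have hNp : N ^ p = 0 := by
    have hc : CharP (Matrix (Fin 2) (Fin 2) F) p := inferInstance
    have h1 : A.val ^ p = 1 := congrArg Subtype.val hA
    rw [hN, sub_pow_char_of_commute p (Commute.one_right _), h1, one_pow, sub_self]
  have hN0 : N ≠ 0 := fun h => hA1 (Subtype.ext (sub_eq_zero.1 h))
  have hdet : N 0 0 * N 1 1 - N 0 1 * N 1 0 = 0 := by
    rw [← Matrix.det_fin_two]
    have : N.det ^ p = 0 := by rw [← Matrix.det_pow, hNp]; simp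
    exact pow_eq_zero_iff hp.ne_zero |>.1 this
  have hsq : N * N = (N 0 0 + N 1 1) • N := by
    ext i j
    fin_cases i <;> fin_cases j <;> simp [Matrix.mul_apply, Fin.sum_univ_two] <;>
      first | ring1 | linear_combination -hdet
  have hpow : ∀ j : ℕ, N ^ (j + 1) = (N 0 0 + N 1 1) ^ j • N := by
    intro j
    induction j with
    | zero => simp
    | succ j ih => rw [pow_succ, ih, Matrix.smul_mul, hsq, smul_smul, pow_succ]
  have htr : N 0 0 + N 1 1 = 0 := by
    have := hpow (p - 1)
    rw [Nat.sub_add_cancel hp.one_le, hNp, eq_comm, smul_eq_zero] at this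
    exact eq_zero_of_pow_eq_zero (this.resolve_right hN0)
  have h11 : N 1 1 = -N 0 0 := by linear_combination htr
  have key : ∀ P : GL (Fin 2) F, N * P.val = P.val * !![0, 1; 0, 0] →
      conjSL P (upperSL 1 1) = A := by
    intro P hP
    apply Subtype.ext
    change P.val * (upperSL (1 : Fˣ) (1 : F)).val * P⁻¹.val = A.val
    have hT : (upperSL (1 : Fˣ) (1 : F)).val = 1 + !![0, 1; 0, 0] := by
      ext i j; fin_cases i <;> fin_cases j <;> simp [upperSL]
    rw [hT, mul_add, ← hP, mul_one, add_mul, Units.mul_inv, mul_assoc, Units.mul_inv, mul_one, hN]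
    abel
  by_cases h01 : N 0 1 = 0
  · have h00 : N 0 0 = 0 := by
      rw [h11, h01] at hdet
      have : N 0 0 * N 0 0 = 0 := by linear_combination -hdet
      simpa using this
    have h10 : N 1 0 ≠ 0 := by
      intro h10
      apply hN0
      ext i j; fin_cases i <;> fin_cases j <;> simp [h00, h10, h01, h11]
    refine ⟨Matrix.GeneralLinearGroup.mkOfDetNeZero !![0, 1; N 1 0, 0]
      (by simp [Matrix.det_fin_two, h10]), key _ ?_⟩
    change N * !![0, 1; N 1 0, 0] = !![0, 1; N 1 0, 0] * !![0, 1; 0, 0]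
    ext i j
    fin_cases i <;> fin_cases j <;> simp [Matrix.mul_apply, Fin.sum_univ_two, h00, h11, h01]
  · refine ⟨Matrix.GeneralLinearGroup.mkOfDetNeZero !![N 0 1, 0; -N 0 0, 1]
      (by simp [Matrix.det_fin_two, h01]), key _ ?_⟩
    change N * !![N 0 1, 0; -N 0 0, 1] = !![N 0 1, 0; -N 0 0, 1] * !![0, 1; 0, 0]
    ext i j
    fin_cases i <;> fin_cases j <;> simp [Matrix.mul_apply, Fin.sum_univ_two, h11] <;>
      first | ring1 | linear_combination (-1 : F) * hdet + N 0 0 * htr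

/-- The automorphism of `PSL₂` induced by conjugation by an element of `GL₂`. -/
noncomputable def conjPSL {F : Type} [Field F] (P : GL (Fin 2) F) : PSL₂ F ≃* PSL₂ F :=
  QuotientGroup.congr _ _ (conjSL P)
    (Subgroup.characteristic_iff_map_eq.1 inferInstance (conjSL P))

lemma upperSL_one_pow {F : Type} [Field F] (n : ℕ) :
    (upperSL (1 : Fˣ) (1 : F)) ^ n = upperSL 1 (n : F) := by
  induction n with
  | zero => rw [pow_zero, Nat.cast_zero, upperSL_one_zero]
  | succ n ih => rw [pow_succ, ih, upperSL_mul]; simp [add_comm]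

lemma PSL₂.sq_eq_one_of_mem_center {F : Type} [Field F] {z : SpecialLinearGroup (Fin 2) F}
    (hz : z ∈ Subgroup.center (SpecialLinearGroup (Fin 2) F)) : z ^ 2 = 1 := by
  obtain ⟨r, hr, hA⟩ := Matrix.SpecialLinearGroup.mem_center_iff.1 hz
  have h2 : r ^ 2 = 1 := by simpa using hr
  apply Subtype.ext
  change z.val ^ 2 = 1
  rw [← hA, ← map_pow, h2, map_one]

/-- An element of order `p` becomes the standard unipotent after a change of coordinates. -/
lemma PSL₂.exists_equiv_of_orderOf {G : Type} [Group G] {p : ℕ} [Fact p.Prime] (hp2 : p ≠ 2)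
    (e : PSL₂ (ZMod p) ≃* G) {g : G} (hg : orderOf g = p) :
    ∃ e' : PSL₂ (ZMod p) ≃* G, e' (QuotientGroup.mk (upperSL 1 1)) = g := by
  have hp := (Fact.out : p.Prime)
  obtain ⟨B, hB⟩ := QuotientGroup.mk_surjective (e.symm (g ^ ((p + 1) / 2)))
  have hodd : 2 * ((p + 1) / 2) = p + 1 := by
    have := hp.eq_two_or_odd
    omega
  have hgp : g ^ p = 1 := by rw [← orderOf_dvd_iff_pow_eq_one, hg]
  have hB2 : e (QuotientGroup.mk (B ^ 2)) = g := by
    rw [QuotientGroup.mk_pow, hB, map_pow, e.apply_symm_apply, ← pow_mul, mul_comm, hodd, pow_succ,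
      hgp, one_mul]
  have hBp : (B ^ 2) ^ p = 1 := by
    rw [← pow_mul, mul_comm, pow_mul]
    apply PSL₂.sq_eq_one_of_mem_center
    rw [← QuotientGroup.eq_one_iff, QuotientGroup.mk_pow, hB, ← map_pow, ← pow_mul, mul_comm,
      pow_mul, hgp, one_pow, map_one]
  have hB1 : B ^ 2 ≠ 1 := by
    intro h
    rw [h, QuotientGroup.mk_one, map_one] at hB2
    rw [← hB2, orderOf_one] at hg
    exact hp.one_lt.ne hg
  obtain ⟨P, hP⟩ := exists_conjSL_eq hp hBp hB1
  refine ⟨(conjPSL P).trans e, ?_⟩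
  rw [← hB2, ← hP]
  rfl

/-- Elements normalizing the standard unipotent subgroup are upper triangular. -/
lemma PSL₂.exists_upperSL {p : ℕ} [Fact p.Prime] {x : PSL₂ (ZMod p)} {j : ℕ}
    (hx : x * QuotientGroup.mk (upperSL 1 1) = (QuotientGroup.mk (upperSL 1 1)) ^ j * x) :
    ∃ a b, x = QuotientGroup.mk (upperSL a b) := by
  obtain ⟨A, rfl⟩ := QuotientGroup.mk_surjective x
  rw [← QuotientGroup.mk_pow, ← QuotientGroup.mk_mul, ← QuotientGroup.mk_mul, eq_comm,
    QuotientGroup.eq, upperSL_one_pow] at hx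
  obtain ⟨r, -, hr⟩ := Matrix.SpecialLinearGroup.mem_center_iff.1 hx
  have h1 : A.val * (upperSL (1 : (ZMod p)ˣ) (1 : ZMod p)).val
      = r • ((upperSL (1 : (ZMod p)ˣ) (j : ZMod p)).val * A.val) := by
    have h2 : A * upperSL (1 : (ZMod p)ˣ) (1 : ZMod p) = (upperSL (1 : (ZMod p)ˣ) (j : ZMod p) * A)
        * ((upperSL (1 : (ZMod p)ˣ) (j : ZMod p) * A)⁻¹ * (A * upperSL 1 1)) := by group
    have h3 : A.val * (upperSL (1 : (ZMod p)ˣ) (1 : ZMod p)).val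
        = (upperSL (1 : (ZMod p)ˣ) (j : ZMod p)).val * A.val * _ := congrArg Subtype.val h2
    rw [h3, ← hr]
    ext i k; simp [mul_comm]
  have h10 := congrFun (congrFun h1 1) 0
  have h11 := congrFun (congrFun h1 1) 1
  simp only [upperSL, Matrix.mul_apply, Fin.sum_univ_two, Matrix.smul_apply] at h10 h11
  simp at h10 h11
  have hc : A.val 1 0 = 0 := by
    by_contra hne
    have hr1 : r = 1 := by
      have : (r - 1) * A.val 1 0 = 0 := by linear_combination -h10
      simpa [sub_eq_zero, hne] using this
    rw [hr1, one_mul] at h11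
    exact hne (by linear_combination h11)
  have hdet := A.2
  rw [Matrix.det_fin_two, hc, mul_zero, sub_zero] at hdet
  refine ⟨⟨A.val 0 0, A.val 1 1, hdet, by rw [mul_comm, hdet]⟩, A.val 0 1, ?_⟩
  congr 1
  have h11' : A.val 1 1 = (A.val 0 0)⁻¹ := eq_inv_of_mul_eq_one_right hdet
  apply Subtype.ext
  ext i k
  fin_cases i <;> fin_cases k <;> simp [upperSL, hc, h11']

lemma exists_upperSL_pow {F : Type} [Field F] (a : Fˣ) (b : F) (n : ℕ) :
    ∃ b', (upperSL a b) ^ n = upperSL (a ^ n) b' := by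
  induction n with
  | zero =>
    exact ⟨0, by rw [pow_zero, pow_zero, upperSL_one_zero]⟩
  | succ n ih =>
    obtain ⟨b', hb'⟩ := ih
    exact ⟨_, by rw [pow_succ, hb', upperSL_mul, pow_succ]⟩

/-- The `(p-1)/2`-th power of an upper triangular element is unipotent. -/
lemma PSL₂.exists_pow_eq {p : ℕ} [Fact p.Prime] {m : ℕ} (hm : 2 * m = p - 1)
    (a : (ZMod p)ˣ) (b : ZMod p) :
    ∃ j : ℕ, (QuotientGroup.mk (upperSL a b) : PSL₂ (ZMod p)) ^ m
      = (QuotientGroup.mk (upperSL 1 1)) ^ j := by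
  obtain ⟨b', hb'⟩ := exists_upperSL_pow a b m
  have ha : a ^ m * a ^ m = 1 := by
    rw [← pow_add, ← two_mul, hm, ZMod.units_pow_card_sub_one_eq_one]
  have ha' : (a ^ m)⁻¹ = a ^ m := inv_eq_of_mul_eq_one_left ha
  refine ⟨(((a ^ m : (ZMod p)ˣ) : ZMod p) * b').val, ?_⟩
  rw [← QuotientGroup.mk_pow, ← QuotientGroup.mk_pow, hb', upperSL_one_pow, ZMod.natCast_zmod_val,
    eq_comm, QuotientGroup.eq]
  refine Matrix.SpecialLinearGroup.mem_center_iff.2 ⟨((a ^ m : (ZMod p)ˣ) : ZMod p), ?_, ?_⟩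
  · rw [Fintype.card_fin, sq, ← Units.val_mul, ha, Units.val_one]
  · generalize a ^ m = c at *
    have hc : (c : ZMod p) * c = 1 := by rw [← Units.val_mul, ha, Units.val_one]
    rw [Matrix.SpecialLinearGroup.coe_mul, Matrix.SpecialLinearGroup.coe_inv]
    ext i j
    fin_cases i <;> fin_cases j <;>
      simp [upperSL, Matrix.adjugate_fin_two, Matrix.mul_apply, Fin.sum_univ_two, ha']
    linear_combination b' * hc

end ProjectiveSpecialLinear

section TamePart

/-- A character of a group of order `p·m'` whose kernel is a `p`-group. -/
lemma exists_generator_of_isPGroup_ker {I k : Type} [Group I] [Finite I] [Field k] {p m' : ℕ}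
    [CharP k p] (hp : p.Prime) (hcard : Nat.card I = p * m') (hm' : ¬ p ∣ m') (θ : I →* kˣ)
    (hθ : IsPGroup p θ.ker) {g : I} (hg : orderOf g = p) :
    θ.ker = Subgroup.zpowers g ∧ ∃ h, orderOf (θ h) = m' := by
  have : Fact p.Prime := ⟨hp⟩
  have hgker : g ∈ θ.ker := by
    rw [MonoidHom.mem_ker]
    have h1 : (θ g : k) ^ p = 1 := by
      rw [← Units.val_pow_eq_pow_val, ← map_pow, ← hg, pow_orderOf_eq_one]; simp
    have h2 : ((θ g : k) - 1) ^ p = 0 := by rw [sub_pow_char, h1, one_pow, sub_self]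
    exact Units.ext (sub_eq_zero.1 (eq_zero_of_pow_eq_zero h2))
  have hle : Subgroup.zpowers g ≤ θ.ker := Subgroup.zpowers_le.2 hgker
  have hker : Nat.card θ.ker = p := by
    obtain ⟨n, hn⟩ := IsPGroup.iff_card.1 hθ
    have h1 : p ^ n ∣ p * m' := hn ▸ hcard ▸ Subgroup.card_subgroup_dvd_card _
    have h2 : n ≤ 1 := by
      by_contra! h
      have : p ^ 2 ∣ p * m' := (pow_dvd_pow p h).trans h1
      rw [sq] at this
      exact hm' (Nat.dvd_of_mul_dvd_mul_left hp.pos this)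
    have h3 : p ≤ p ^ n := by
      rw [← hn, ← hg, ← Nat.card_zpowers]
      exact Nat.card_le_card_of_injective _ (Subgroup.inclusion_injective hle)
    have h4 : p ^ n ≤ p := (Nat.pow_le_pow_right hp.pos h2).trans_eq (pow_one p)
    omega
  refine ⟨(Subgroup.eq_of_le_of_card_ge hle (by rw [hker, Nat.card_zpowers, hg])).symm, ?_⟩
  have hrange : Nat.card θ.range = m' := by
    have h1 := θ.ker.card_mul_index
    rw [hker, hcard, Subgroup.index_ker] at h1
    exact Nat.eq_of_mul_eq_mul_left hp.pos h1
  have : Finite θ.range := Set.finite_range θ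
  have hcyc : IsCyclic θ.range := inferInstance
  obtain ⟨⟨_, h, rfl⟩, hy⟩ := IsCyclic.exists_ofOrder_eq_natCard (α := θ.range)
  refine ⟨h, ?_⟩
  rw [← hrange, ← hy, ← Subgroup.orderOf_coe]

variable {k E : Type} [Field k] [Field E] [Algebra (RatFunc k) E] {O : ValuationSubring E}
  (hO : O.comap (algebraMap (RatFunc k) E) = inftyPlace k)
  [FiniteDimensional (RatFunc k) E] [IsAlgClosed k]

include hO in
/-- The structure of the inertia group at infinity of a `PSL₂(𝔽_p)`-cover. -/
lemma exists_inertia_generators {p : ℕ} [CharP k p] [Fact p.Prime] (hp7 : 7 ≤ p) {m m' J : ℕ}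
    (hm : 2 * m = p - 1) (e : PSL₂ (ZMod p) ≃* (E ≃ₐ[RatFunc k] E)) (hm' : ¬ p ∣ m')
    (hcard : Nat.card (inertiaIn k O) = p * m')
    (hjump : ∀ g ∈ inertiaIn k O, orderOf g = p → HasLowerJump O g J)
    (hJ : J * m = (p - 2) * m') :
    m' = m ∧ J = p - 2 ∧ ∃ (e' : PSL₂ (ZMod p) ≃* (E ≃ₐ[RatFunc k] E)) (π : E)
      (α : (ZMod p)ˣ) (β : ZMod p) (ζ : k), IsUnif O.valuation (constMap k E) π ∧
      e' (QuotientGroup.mk (upperSL 1 1)) ∈ inertiaIn k O ∧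
      O.valuation (e' (QuotientGroup.mk (upperSL 1 1)) π - π) = O.valuation π ^ ((J : ℤ) + 1) ∧
      e' (QuotientGroup.mk (upperSL α β)) ∈ inertiaIn k O ∧
      Twist O.valuation (constMap k E) (e' (QuotientGroup.mk (upperSL α β)) : E ≃+* E) π ζ ∧
      IsPrimitiveRoot ζ m := by
  have hp : p.Prime := Fact.out
  obtain ⟨g, hg⟩ := exists_prime_orderOf_dvd_card' (G := inertiaIn k O) p (by simp [hcard])
  have hgE : orderOf (g : E ≃ₐ[RatFunc k] E) = p := by rw [Subgroup.orderOf_coe, hg]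
  obtain ⟨π, hπ, hπJ⟩ := hjump g g.2 hgE
  replace hπ := hπ.isUnif hO
  obtain ⟨e', he'⟩ := PSL₂.exists_equiv_of_orderOf (by omega) e hgE
  set θ := twistHom hπ (inertiaIn k O) (fun g hg => fixes_of_mem hO hg) hπ.ne_zero with hθ
  obtain ⟨hker, h, hh⟩ := exists_generator_of_isPGroup_ker hp hcard hm' θ
    (isPGroup_ker_twistHom hp hπ _ _) hg
  have hconj : h * g * h⁻¹ ∈ Subgroup.zpowers g := by
    rw [← hker]
    exact (MonoidHom.normal_ker θ).conj_mem g (by rw [hker]; exact Subgroup.mem_zpowers g) h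
  obtain ⟨j, hj⟩ := mem_powers_iff_mem_zpowers.2 hconj
  obtain ⟨α, β, hαβ⟩ := PSL₂.exists_upperSL (x := e'.symm h) (j := j) (by
    apply e'.injective
    rw [map_mul, map_mul, map_pow, he', e'.apply_symm_apply]
    have := congrArg (fun x : inertiaIn k O => (x : E ≃ₐ[RatFunc k] E) * h) hj
    simp at this
    exact this.symm)
  have hhe : e' (QuotientGroup.mk (upperSL α β)) = h := by rw [← hαβ, e'.apply_symm_apply]
  have hdvd : m' ∣ m := by
    rw [← hh]
    apply orderOf_dvd_of_pow_eq_one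
    obtain ⟨i, hi⟩ := PSL₂.exists_pow_eq hm α β
    have h1 : h ^ m = g ^ i := by
      apply Subtype.ext
      rw [Subgroup.coe_pow, Subgroup.coe_pow, ← hhe, ← he', ← map_pow, ← map_pow, hi]
    rw [← map_pow, h1, ← MonoidHom.mem_ker, hker]
    exact pow_mem (Subgroup.mem_zpowers g) i
  have hdvd' : m ∣ m' := by
    have hcop : Nat.Coprime m (p - 2) := by
      have h1 : p - 2 + 1 = 2 * m := by omega
      have h2 : Nat.Coprime (p - 2 + 1) (p - 2) := by simp
      rw [h1] at h2
      exact Nat.Coprime.coprime_mul_left h2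
    exact hcop.dvd_of_dvd_mul_left (hJ ▸ Dvd.intro_left _ rfl)
  have hmm : m' = m := Nat.dvd_antisymm hdvd hdvd'
  have hJ' : J = p - 2 := by
    rw [hmm] at hJ
    exact Nat.eq_of_mul_eq_mul_right (by omega) hJ
  refine ⟨hmm, hJ', e', π, α, β, θ h, hπ, ?_, ?_, ?_, ?_, ?_⟩
  · rw [he']; exact g.2
  · rw [he', hπJ, ← zpow_natCast]; simp
  · rw [hhe]; exact h.2
  · rw [hhe]; exact twistHom_spec hπ _ _ _ h
  · rw [← hmm, ← hh]
    exact IsPrimitiveRoot.coe_units_iff.2 (IsPrimitiveRoot.orderOf _)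

end TamePart

section Chains

variable {k E Γ : Type} [Field k] [Field E] [LinearOrderedCommGroupWithZero Γ]
  {v : Valuation E Γ} {κ : k →+* E} {π : E} {g s : E ≃+* E} {a ζ : k} {J : ℤ} {z₀ z₁ z₂ : E}

/-- A Jordan chain of length three for `g`, triangular for `s`. -/
structure JordanChain (κ : k →+* E) (g s : E ≃+* E) (a : k) (z₀ z₁ z₂ : E) : Prop where
  apply₀ : g z₀ = z₀ + z₁
  apply₁ : g z₁ = z₁ + z₂
  apply₂ : g z₂ = z₂
  tame₀ : ∃ c d, s z₀ = κ a * z₀ + (κ c * z₁ + κ d * z₂)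
  tame₁ : ∃ c, s z₁ = z₁ + κ c * z₂

namespace JordanChain

lemma eq_zero (hz : JordanChain κ g s a z₀ z₁ z₂) (h0 : z₀ = 0) : z₁ = 0 ∧ z₂ = 0 := by
  have h1 : z₁ = 0 := by have := hz.apply₀; simpa [h0] using this.symm
  have h2 : z₂ = 0 := by have := hz.apply₁; simpa [h1] using this.symm
  exact ⟨h1, h2⟩

variable {n : ℤ} (hz : JordanChain κ g s a z₀ z₁ z₂) (h : IsUnif v κ π) (hg : Fixes v κ g)
  (hJ1 : 1 ≤ J) (hJ : v (g π - π) = v π ^ (J + 1)) (hn : v z₀ = v π ^ n)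

include hz h hg hJ1 hJ

lemma val₁_le (hn : v z₀ ≤ v π ^ n) : v z₁ ≤ v π ^ (n + J) := by
  have := jump_le h hg hJ1 hJ hn
  rwa [hz.apply₀, add_sub_cancel_left] at this

lemma val₂_le (hn : v z₁ ≤ v π ^ n) : v z₂ ≤ v π ^ (n + J) := by
  have := jump_le h hg hJ1 hJ hn
  rwa [hz.apply₁, add_sub_cancel_left] at this

lemma val₁_eq (hn : v z₀ = v π ^ n) (hnk : (n : k) ≠ 0) : v z₁ = v π ^ (n + J) := by
  have := (jump_apply h hg hJ1 hJ hn).1 hnk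
  rwa [hz.apply₀, add_sub_cancel_left] at this

lemma val₁_le_succ (hn : v z₀ = v π ^ n) (hnk : (n : k) = 0) : v z₁ ≤ v π ^ (n + J + 1) := by
  have := (jump_apply h hg hJ1 hJ hn).2 hnk
  rwa [hz.apply₀, add_sub_cancel_left] at this

lemma val₂_eq (hn : v z₁ = v π ^ n) (hnk : (n : k) ≠ 0) : v z₂ = v π ^ (n + J) := by
  have := (jump_apply h hg hJ1 hJ hn).1 hnk
  rwa [hz.apply₁, add_sub_cancel_left] at this

lemma val₂_le_succ (hn : v z₁ = v π ^ n) (hnk : (n : k) = 0) : v z₂ ≤ v π ^ (n + J + 1) := by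
  have := (jump_apply h hg hJ1 hJ hn).2 hnk
  rwa [hz.apply₁, add_sub_cancel_left] at this

include hn in
lemma cast_eq_zero : (n : k) = 0 ∨ ((n + J : ℤ) : k) = 0 ∨ ((n + J + J : ℤ) : k) = 0 := by
  by_contra! hne
  have h1 := hz.val₁_eq h hg hJ1 hJ hn hne.1
  have h2 := hz.val₂_eq h hg hJ1 hJ h1 hne.2.1
  have h3 := (jump_apply h hg hJ1 hJ h2).1 hne.2.2
  rw [hz.apply₂, sub_self, map_zero, eq_comm] at h3
  exact h.zpow_ne _ h3

include hn in
lemma zpow_eq (hs : Fixes v κ s) (hζ : Twist v κ s π ζ) : ζ ^ n = a := by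
  refine (hζ.of_val h hs hn).unique h ?_
  obtain ⟨c, d, hcd⟩ := hz.tame₀
  have h1 := hz.val₁_le h hg hJ1 hJ hn.le
  have h2 := hz.val₂_le h hg hJ1 hJ h1
  change v _ < v _
  rw [hcd, add_sub_cancel_left, hn, h.lt_iff]
  refine h.add (h.mono (b := n + 1) ?_ le_rfl) (h.mono (b := n + 1) ?_ le_rfl)
  · have := h.mul (a := 0) (x := κ c) (by simpa using h.const_le c) h1
    exact h.mono this (by omega)
  · have := h.mul (a := 0) (x := κ d) (by simpa using h.const_le d) h2
    exact h.mono this (by omega)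

include hn in
lemma zpow_add_eq_one (hnk : (n : k) ≠ 0) (hs : Fixes v κ s) (hζ : Twist v κ s π ζ) :
    ζ ^ (n + J) = 1 := by
  have h1 := hz.val₁_eq h hg hJ1 hJ hn hnk
  refine (hζ.of_val h hs h1).unique h ?_
  obtain ⟨c, hc⟩ := hz.tame₁
  have h2 := hz.val₂_le h hg hJ1 hJ h1.le
  change v _ < v _
  rw [hc, map_one, one_mul, add_sub_cancel_left, h1, h.lt_iff]
  have := h.mul (a := 0) (x := κ c) (by simpa using h.const_le c) h2
  exact h.mono this (by omega)

end JordanChain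

/-- The valuation of the determinant of three Jordan chains in general position. -/
lemma val_det_jordanChain {aB aC : k} {z₀' z₁' z₂' z₀'' z₁'' z₂'' : E}
    (hA : JordanChain κ g s a z₀ z₁ z₂) (hB : JordanChain κ g s aB z₀' z₁' z₂')
    (hC : JordanChain κ g s aC z₀'' z₁'' z₂'')
    (h : IsUnif v κ π) (hg : Fixes v κ g) (hJ1 : 1 ≤ J) (hJ : v (g π - π) = v π ^ (J + 1))
    {n n' n'' : ℤ} (hn : v z₀ = v π ^ n) (hn' : v z₀' = v π ^ n') (hn'' : v z₀'' = v π ^ n'')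
    (h0 : (n : k) = 0) (h0' : (n' : k) ≠ 0) (h1' : ((n' + J : ℤ) : k) = 0)
    (h0'' : (n'' : k) ≠ 0) (h1'' : ((n'' + J : ℤ) : k) ≠ 0) :
    v (Matrix.of ![![z₀, z₁, z₂], ![z₀', z₁', z₂'], ![z₀'', z₁'', z₂'']]).det
      = v π ^ (n + n' + n'' + 3 * J) := by
  have a1 := hA.val₁_le_succ h hg hJ1 hJ hn h0
  have a2 := hA.val₂_le h hg hJ1 hJ a1
  have b1 := hB.val₁_eq h hg hJ1 hJ hn' h0'
  have b2 := hB.val₂_le_succ h hg hJ1 hJ b1 h1'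
  have c1 := hC.val₁_eq h hg hJ1 hJ hn'' h0''
  have c2 := hC.val₂_eq h hg hJ1 hJ c1 h1''
  have hmain := h.mul_eq (h.mul_eq hn b1) c2
  rw [show n + (n' + J) + (n'' + J + J) = n + n' + n'' + 3 * J by ring] at hmain
  refine h.eq_of_sub hmain ?_
  have t1 := h.mono (h.mul (h.mul hn.le b2) c1.le) (b := n + n' + n'' + 3 * J + 1) (by omega)
  have t2 := h.mono (h.mul (h.mul a1 hn'.le) c2.le) (b := n + n' + n'' + 3 * J + 1) (by omega)
  have t3 := h.mono (h.mul (h.mul a1 b2) hn''.le) (b := n + n' + n'' + 3 * J + 1) (by omega)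
  have t4 := h.mono (h.mul (h.mul a2 hn'.le) c1.le) (b := n + n' + n'' + 3 * J + 1) (by omega)
  have t5 := h.mono (h.mul (h.mul a2 b1.le) hn''.le) (b := n + n' + n'' + 3 * J + 1) (by omega)
  have := h.sub (h.add t3 t4) (h.add (h.add t1 t2) t5)
  rw [Matrix.det_fin_three]
  convert this using 2
  simp
  ring

end Chains

section NoCover

open Matrix

lemma adMat_upperSL {F T : Type} [Field F] [Field T] (ι : F →+* T) (a : Fˣ) (b : F) :
    (adMat (upperSL a b)).map ι = !![1, 0, -(ι a * ι b);
      2 * (ι b * (ι a)⁻¹), (ι a)⁻¹ ^ 2, -ι b ^ 2; 0, 0, ι a ^ 2] := by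
  ext i j
  fin_cases i <;> fin_cases j <;> simp [adMat, upperSL, map_ofNat]

lemma adMat_transvection {F T : Type} [Field F] [Field T] (ι : F →+* T) :
    (adMat (SpecialLinearGroup.transvection (one_ne_zero : (1 : Fin 2) ≠ 0) (1 : F))).map ι
      = !![1, 1, 0; 0, 1, 0; -2, -1, 1] := by
  ext i j
  fin_cases i <;> fin_cases j <;>
    simp [adMat, SpecialLinearGroup.transvection_coe, Matrix.single, map_ofNat]

variable {k E : Type} [Field k] [Field E] [Algebra (RatFunc k) E] {p : ℕ} [CharP k p]

/-- The representation of the Galois group coming from the adjoint representation of `PSL₂`. -/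
noncomputable def adRep (k : Type) [Field k] {E : Type} [Field E] [Algebra (RatFunc k) E] {p : ℕ}
    [CharP k p] (e : PSL₂ (ZMod p) ≃* (E ≃ₐ[RatFunc k] E)) :
    (E ≃ₐ[RatFunc k] E) →* Matrix (Fin 3) (Fin 3) k :=
  (adHom (ZMod.castHom (dvd_refl p) k)).comp e.symm.toMonoidHom

variable {e : PSL₂ (ZMod p) ≃* (E ≃ₐ[RatFunc k] E)}

lemma adRep_inv_apply (A : SpecialLinearGroup (Fin 2) (ZMod p)) :
    adRep k e (e (QuotientGroup.mk A))⁻¹ = (adMat A).map (ZMod.castHom (dvd_refl p) k) := by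
  rw [← adHom_inv_mk, ← map_inv]
  simp [adRep]

variable [Fact p.Prime]

lemma adRep_fixed (h2 : (2 : k) ≠ 0) {c : Fin 3 → k} (hc : ∀ σ, (adRep k e σ).mulVec c = c) :
    c = 0 := by
  have h1 := hc (e (QuotientGroup.mk (upperSL 1 1)))⁻¹
  have h3 := hc (e (QuotientGroup.mk (SpecialLinearGroup.transvection one_ne_zero 1)))⁻¹
  rw [adRep_inv_apply, adMat_upperSL] at h1
  rw [adRep_inv_apply, adMat_transvection] at h3
  have h10 := congrFun h1 0
  have h11 := congrFun h1 1
  have h20 := congrFun h3 0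
  generalize ZMod.castHom (dvd_refl p) k = ι at h10 h11 h20
  simp [Matrix.mulVec, dotProduct, Fin.sum_univ_succ] at h10 h11 h20
  ext i
  fin_cases i
  · simpa [h2, h10, h20] using h11
  · exact h20
  · exact h10

variable [Algebra (Polynomial k) E]

lemma Equi.jordanChain {N : Fin 3 → E} (hN : Equi (adRep k e) N) (h2 : (2 : k) ≠ 0)
    (α : (ZMod p)ˣ) (β : ZMod p) :
    JordanChain (constMap k E) (e (QuotientGroup.mk (upperSL 1 1)) : E ≃+* E)
      (e (QuotientGroup.mk (upperSL α β)) : E ≃+* E)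
      ((ZMod.castHom (dvd_refl p) k α)⁻¹ ^ 2)
      (N 1) (2 * N 0 - N 2) (-2 * N 2) := by
  have hg := hN.apply (e (QuotientGroup.mk (upperSL 1 1)))
  have hs := hN.apply (e (QuotientGroup.mk (upperSL α β)))
  simp only [adRep_inv_apply, adMat_upperSL, Fin.sum_univ_three] at hg hs
  generalize e (QuotientGroup.mk (upperSL 1 1)) = γ at *
  generalize e (QuotientGroup.mk (upperSL α β)) = τ at *
  generalize ZMod.castHom (dvd_refl p) k = ι at *
  have g0 := hg 0
  have g1 := hg 1
  have g2 := hg 2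
  have s0 := hs 0
  have s1 := hs 1
  have s2 := hs 2
  simp [map_ofNat] at g0 g1 g2 s0 s1 s2
  have h2E : (2 : E) ≠ 0 := by
    rw [← map_ofNat (constMap k E) 2]; simpa using h2
  have d2 : constMap k E 2⁻¹ * 2 = 1 := by
    rw [map_inv₀, map_ofNat, inv_mul_cancel₀ h2E]
  refine ⟨?_, ?_, ?_, ⟨ι β * (ι α)⁻¹, (ι β ^ 2 - ι β * (ι α)⁻¹) * 2⁻¹, ?_⟩,
    ⟨(2 * (ι α * ι β) + ι α ^ 2 - 1) * 2⁻¹, ?_⟩⟩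
  · change γ (N 1) = _
    rw [g1]; ring
  · change γ (2 * N 0 - N 2) = _
    rw [map_sub, map_mul, map_ofNat, g0, g2]; ring
  · change γ (-2 * N 2) = _
    rw [map_mul, map_neg, map_ofNat, g2]
  · change τ (N 1) = _
    rw [s1]
    simp only [map_sub, map_mul, map_pow, map_inv₀ (constMap k E) (ι α), inv_pow, map_inv₀ (constMap k E) (ι α ^ 2)]
    linear_combination (constMap k E (ι β) ^ 2 - constMap k E (ι β) * (constMap k E (ι α))⁻¹) * N 2 * d2
  · change τ (2 * N 0 - N 2) = _
    rw [map_sub, map_mul, map_ofNat, s0, s2]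
    simp only [map_sub, map_mul, map_add, map_pow, map_one, map_ofNat]
    linear_combination (2 * (constMap k E (ι α) * constMap k E (ι β)) + constMap k E (ι α) ^ 2 - 1) * N 2 * d2

end NoCover

section NoCover

open Matrix

variable {k E : Type} [Field k] [Field E] [Algebra (RatFunc k) E] [Algebra (Polynomial k) E]
  [IsScalarTower (Polynomial k) (RatFunc k) E] {O : ValuationSubring E}
  (hO : O.comap (algebraMap (RatFunc k) E) = inftyPlace k)
  [FiniteDimensional (RatFunc k) E] [IsGalois (RatFunc k) E] [IsAlgClosed k] {π : E}
  (hπ : IsUnif O.valuation (constMap k E) π)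

include hπ

/-- A basis of equivariant vectors whose leading terms at infinity are independent. -/
lemma exists_reduced_equi [Algebra.Etale (Polynomial k) (integralClosure (Polynomial k) E)]
    {ι : Type} [Fintype ι] [DecidableEq ι] {R : (E ≃ₐ[RatFunc k] E) →* Matrix ι ι k}
    (hR : ∀ σ, (R σ).det = 1) (i₀ : ι)
    (hval : ∀ N : ι → E, Equi R N → N ≠ 0 → ∃ n : ℤ, n < 0 ∧ O.valuation (N i₀) = O.valuation π ^ n) :
    ∃ N : Matrix ι ι E, (∀ i, Equi R (N i)) ∧ (∃ c : k, c ≠ 0 ∧ N.det = constMap k E c) ∧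
      ∀ i j, i ≠ j → ∀ q : ℕ,
        O.valuation (N i i₀) ≠ O.valuation (coord k E) ^ q * O.valuation (N j i₀) := by
  classical
  have hrow : ∀ N : Matrix ι ι E, (∃ c : k, c ≠ 0 ∧ N.det = constMap k E c) → ∀ i, N i ≠ 0 := by
    rintro N ⟨c, hc, hdet⟩ i hi
    refine hc ((map_eq_zero (constMap k E)).1 ?_)
    rw [← hdet]
    exact Matrix.det_eq_zero_of_row_eq_zero i fun j => congrFun hi j
  have hne : ∃ d : ℕ, ∃ N : Matrix ι ι E, (∀ i, Equi R (N i)) ∧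
      (∃ c : k, c ≠ 0 ∧ N.det = constMap k E c) ∧ ∃ n : ι → ℤ,
      (∀ i, n i < 0 ∧ O.valuation (N i i₀) = O.valuation π ^ n i) ∧ (d : ℤ) = -∑ i, n i := by
    obtain ⟨N, hN, hdet⟩ := exists_equi_det_const hR
    choose n hn using fun i => hval (N i) (hN i) (hrow N hdet i)
    have : 0 ≤ -∑ i, n i := by
      rw [Left.nonneg_neg_iff]
      exact Finset.sum_nonpos fun i _ => (hn i).1.le
    exact ⟨(-∑ i, n i).toNat, N, hN, hdet, n, hn, Int.toNat_of_nonneg this⟩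
  obtain ⟨N, hN, hdet, n, hn, hsum⟩ := Nat.find_spec hne
  refine ⟨N, hN, hdet, fun i j hij q hq => ?_⟩
  have hy : coord k E ^ q * N j i₀ ≠ 0 := by
    rw [← O.valuation.ne_zero_iff, map_mul, map_pow, ← hq, (hn i).2]
    exact hπ.zpow_ne _
  obtain ⟨c, hc⟩ := hπ.exists_const_mul hy (x := N i i₀) (by rw [hq, map_mul, map_pow])
  set f : Polynomial k := Polynomial.C (-c) * Polynomial.X ^ q with hf
  set N' := N.updateRow i (N i + algebraMap _ E f • N j) with hN'
  have hdet' : N'.det = N.det := Matrix.det_updateRow_add_smul_self N hij _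
  have hEq : ∀ l, Equi R (N' l) := by
    intro l
    by_cases hl : l = i
    · subst hl
      rw [hN', Matrix.updateRow_self]
      exact (hN l).add ((hN j).smul f)
    · rw [hN', Matrix.updateRow_ne hl]
      exact hN l
  obtain ⟨a, ha0, ha⟩ := hval (N' i) (hEq i) (hrow N' (by rwa [hdet']) i)
  have hlt : n i < a := by
    rw [← hπ.zpow_lt, ← ha, ← (hn i).2]
    refine lt_of_eq_of_lt ?_ (hc.trans_eq (by rw [hq, map_mul, map_pow]))
    congr 1
    rw [hN', Matrix.updateRow_self, hf]
    simp only [Pi.add_apply, Pi.smul_apply, smul_eq_mul, map_mul, map_pow, algebraMap_X_eq,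
      algebraMap_C_eq, map_neg]
    ring
  have hsum' : ∑ l, Function.update n i a l = ∑ l, n l + (a - n i) := by
    rw [Finset.sum_update_of_mem (Finset.mem_univ i), ← Finset.add_sum_erase _ _ (Finset.mem_univ i),
      Finset.sdiff_singleton_eq_erase]
    ring
  have hle : 0 ≤ -∑ l, Function.update n i a l := by
    rw [Left.nonneg_neg_iff]
    refine Finset.sum_nonpos fun l _ => ?_
    by_cases hl : l = i
    · subst hl; simpa using ha0.le
    · simpa [hl] using (hn l).1.le
  refine Nat.find_min hne (m := (-∑ l, Function.update n i a l).toNat) ?_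
    ⟨N', hEq, by rwa [hdet'], Function.update n i a, fun l => ?_, Int.toNat_of_nonneg hle⟩
  · zify
    rw [hsum, Int.toNat_of_nonneg hle, hsum']
    linarith
  · by_cases hl : l = i
    · subst hl; simpa using ⟨ha0, ha⟩
    · rw [Function.update_of_ne hl, hN', Matrix.updateRow_ne hl]
      exact hn l

variable {p : ℕ} [CharP k p] [Fact p.Prime] {e : PSL₂ (ZMod p) ≃* (E ≃ₐ[RatFunc k] E)}

include hO in
lemma Equi.exists_val_neg (h2 : (2 : k) ≠ 0) {J : ℤ} (hJ1 : 1 ≤ J)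
    (hg : Fixes O.valuation (constMap k E) (e (QuotientGroup.mk (upperSL 1 1)) : E ≃+* E))
    (hJ : O.valuation (e (QuotientGroup.mk (upperSL 1 1)) π - π) = O.valuation π ^ (J + 1))
    {N : Fin 3 → E} (hN : Equi (adRep k e) N) (hN0 : N ≠ 0) :
    ∃ n : ℤ, n < 0 ∧ O.valuation (N 1) = O.valuation π ^ n := by
  have hz := hN.jordanChain h2 1 0
  have hv2 : O.valuation (2 : E) = 1 := by
    rw [← map_ofNat (constMap k E) 2]
    exact hπ.const 2 h2
  have h2E : (2 : E) ≠ 0 := by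
    rw [← O.valuation.ne_zero_iff, hv2]; exact one_ne_zero
  have h1 : N 1 ≠ 0 := by
    intro h0
    obtain ⟨h1, h2⟩ := hz.eq_zero h0
    have hN2 : N 2 = 0 := by simpa [h2E] using h2
    have hN1 : N 0 = 0 := by simpa [h2E, hN2] using h1
    apply hN0
    ext i; fin_cases i
    exacts [hN1, h0, hN2]
  obtain ⟨n, hn⟩ := hπ.disc _ h1
  refine ⟨n, ?_, hn⟩
  by_contra! hn0
  have b0 : O.valuation (N 1) ≤ O.valuation π ^ (0 : ℤ) := hπ.mono hn.le hn0
  have b1 := hz.val₁_le hπ hg hJ1 hJ b0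
  have b2 := hz.val₂_le hπ hg hJ1 hJ b1
  replace b1 := hπ.mono b1 (b := 0) (by omega)
  replace b2 := hπ.mono b2 (b := 0) (by omega)
  rw [zpow_zero] at b0 b1 b2
  have c2 : O.valuation (N 2) ≤ 1 := by
    rwa [map_mul, Valuation.map_neg, hv2, one_mul] at b2
  have c0 : O.valuation (N 0) ≤ 1 := by
    have := O.valuation.map_add_le b1 c2
    rwa [sub_add_cancel, map_mul, hv2, one_mul] at this
  obtain ⟨c, hc, hfix⟩ := hN.exists_const hO (fun i => by fin_cases i <;> assumption)
  have hc0 := adRep_fixed h2 hfix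
  apply hN0
  ext i
  rw [hc, hc0]; simp

end NoCover

section NoCover

open Matrix

variable {k E : Type} [Field k] [Field E] [Algebra (RatFunc k) E] [Algebra (Polynomial k) E]
  [IsScalarTower (Polynomial k) (RatFunc k) E] {O : ValuationSubring E}
  (hO : O.comap (algebraMap (RatFunc k) E) = inftyPlace k)
  [FiniteDimensional (RatFunc k) E] [IsGalois (RatFunc k) E] [IsAlgClosed k]
  [Algebra.Etale (Polynomial k) (integralClosure (Polynomial k) E)]
  {p : ℕ} [CharP k p] [Fact p.Prime] {e : PSL₂ (ZMod p) ≃* (E ≃ₐ[RatFunc k] E)}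

include hO in
theorem not_psl2_cover (hp7 : 7 ≤ p) {m m' J : ℕ}
    (hm : 2 * m = p - 1) (e : PSL₂ (ZMod p) ≃* (E ≃ₐ[RatFunc k] E)) (hm' : ¬ p ∣ m')
    (hcard : Nat.card (inertiaIn k O) = p * m')
    (hjump : ∀ g ∈ inertiaIn k O, orderOf g = p → HasLowerJump O g J)
    (hJ : J * m = (p - 2) * m') : False := by
  obtain ⟨hmm, hJp, e, π, α, β, ζ, hπ, hgI, hgJ, hsI, hsζ, hζ⟩ :=
    exists_inertia_generators hO hp7 hm e hm' hcard hjump hJ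
  have hp : p.Prime := Fact.out
  have hcast : ∀ n : ℤ, (n : k) = 0 ↔ (p : ℤ) ∣ n := CharP.intCast_eq_zero_iff k p
  have h2 : (2 : k) ≠ 0 := by
    have := (hcast 2).not.2 fun h => by have := Int.le_of_dvd (by norm_num) h; omega
    exact_mod_cast this
  have hg := fixes_of_mem hO hgI
  have hs := fixes_of_mem hO hsI
  have hJ1 : (1 : ℤ) ≤ J := by omega
  obtain ⟨N, hN, ⟨c, hc, hdet⟩, hred⟩ := exists_reduced_equi hπ (R := adRep k e)
    (fun σ => det_adHom _ _) 1 fun N hN hN0 => hN.exists_val_neg hO hπ h2 hJ1 hg hgJ hN0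
  have hchain := fun i => (hN i).jordanChain h2 α β
  have hrow : ∀ i, N i ≠ 0 := fun i hi => by
    refine hc ((map_eq_zero (constMap k E)).1 ?_)
    rw [← hdet]
    exact Matrix.det_eq_zero_of_row_eq_zero i fun j => congrFun hi j
  choose n hn0 hn using fun i => (hN i).exists_val_neg hO hπ h2 hJ1 hg hgJ (hrow i)
  have hpJ : (p : ℤ) = J + 2 := by omega
  have hpm : (p : ℤ) = 2 * m + 1 := by omega
  have hres : ∀ i, (p : ℤ) ∣ n i ∨ (p : ℤ) ∣ n i - 2 ∨ (p : ℤ) ∣ n i - 4 := fun i => by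
    have := (hchain i).cast_eq_zero hπ hg hJ1 hgJ (hn i)
    simp only [hcast] at this
    rcases this with h | h | h
    · exact Or.inl h
    · right; left
      have := dvd_sub h (dvd_refl (p : ℤ))
      rwa [show n i + J - p = n i - 2 by omega] at this
    · right; right
      have := dvd_sub h (dvd_mul_left (p : ℤ) 2)
      rwa [show n i + J + J - 2 * p = n i - 4 by omega] at this
  have htw : ∀ i j, (m : ℤ) ∣ n i - n j := fun i j => by
    rw [← hζ.zpow_eq_one_iff_dvd, zpow_sub₀ (hζ.ne_zero (by omega)),
      (hchain i).zpow_eq hπ hg hJ1 hgJ (hn i) hs hsζ, (hchain j).zpow_eq hπ hg hJ1 hgJ (hn j) hs hsζ,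
      div_self]
    rw [← (hchain j).zpow_eq hπ hg hJ1 hgJ (hn j) hs hsζ]
    exact zpow_ne_zero _ (hζ.ne_zero (by omega))
  have hone : ∀ i, ¬ (p : ℤ) ∣ n i → (m : ℤ) ∣ n i - 1 := fun i hi => by
    have h1 := (hchain i).zpow_add_eq_one hπ hg hJ1 hgJ (hn i) ((hcast _).not.2 hi) hs hsζ
    rw [hζ.zpow_eq_one_iff_dvd] at h1
    have := dvd_sub h1 (dvd_mul_left (m : ℤ) 2)
    rwa [show n i + J - 2 * m = n i - 1 by omega] at this
  obtain ⟨e₀, he₀⟩ := hπ.disc _ (coord_ne_zero (k := k) (E := E))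
  have he₀neg : e₀ < 0 := by
    have := one_lt_val_coord (E := E) hO
    rwa [he₀, ← zpow_zero (O.valuation π), hπ.zpow_lt] at this
  have hram := ramification_dvd_card hO hπ (e := -e₀) (by rw [neg_neg, he₀])
  rw [hcard, hmm] at hram
  have hdist : ∀ i j, i ≠ j → ¬ (p : ℤ) ∣ n i - n j := by
    have key : ∀ i j, i ≠ j → n i ≤ n j → ¬ (p : ℤ) ∣ n i - n j := by
      intro i j hij hle hdvd
      have hcop : IsCoprime (p : ℤ) m := by
        refine ⟨1, -2, ?_⟩; rw [hpm]; ring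
      have h1 : ((p * m : ℕ) : ℤ) ∣ n i - n j := by
        push_cast
        exact hcop.mul_dvd hdvd (htw i j)
      obtain ⟨q, hq⟩ := hram.trans h1
      have hq0 : q ≤ 0 := by
        by_contra! h
        have : 0 < -e₀ * q := mul_pos (by omega) h
        omega
      refine hred i j hij (-q).toNat ?_
      rw [hn, hn, he₀, ← zpow_natCast, ← _root_.zpow_mul, ← zpow_add₀ hπ.ne,
        Int.toNat_of_nonneg (by omega)]
      congr 1
      linear_combination hq
    intro i j hij hdvd
    rcases le_total (n i) (n j) with h | h
    · exact key i j hij h hdvd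
    · exact key j i hij.symm h (by rw [← neg_sub]; exact hdvd.neg_right)
  have hex : ∀ r : ℤ, (r = 0 ∨ r = 2 ∨ r = 4) → ∃ i, (p : ℤ) ∣ n i - r := by
    by_contra! h
    obtain ⟨r, hr, h⟩ := h
    have hnot : ∀ s t : ℤ, ¬ ∀ i : Fin 3, (p : ℤ) ∣ n i - s ∨ (p : ℤ) ∣ n i - t := by
      intro s t hst
      have hpair : ∀ u i j, i ≠ j → (p : ℤ) ∣ n i - u → (p : ℤ) ∣ n j - u → False := by
        intro u i j hij hi hj
        refine hdist i j hij ?_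
        have := dvd_sub hi hj
        rwa [sub_sub_sub_cancel_right] at this
      have p01 := fun u => hpair u 0 1 (by decide)
      have p02 := fun u => hpair u 0 2 (by decide)
      have p12 := fun u => hpair u 1 2 (by decide)
      rcases hst 0 with h0 | h0 <;> rcases hst 1 with h1 | h1 <;> rcases hst 2 with h2 | h2 <;>
        first
          | exact p01 _ h0 h1
          | exact p02 _ h0 h2
          | exact p12 _ h1 h2
    rcases hr with rfl | rfl | rfl
    · exact hnot 2 4 fun i => by have := hres i; have := h i; simp_all
    · exact hnot 0 4 fun i => by have := hres i; have := h i; simp_all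
    · exact hnot 0 2 fun i => by have := hres i; have := h i; simp_all
  obtain ⟨i, hi⟩ := hex 0 (by simp)
  obtain ⟨i', hi'⟩ := hex 2 (by simp)
  obtain ⟨i'', hi''⟩ := hex 4 (by simp)
  rw [sub_zero] at hi
  have hsmall : ∀ d : ℤ, 0 < d → d < 7 → ¬ (p : ℤ) ∣ d := fun d hd hd7 hdvd => by
    have := Int.le_of_dvd hd hdvd
    omega
  have hni' : ¬ (p : ℤ) ∣ n i' := fun h => hsmall 2 (by norm_num) (by norm_num)
    (by have := dvd_sub h hi'; rwa [sub_sub_cancel] at this)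
  have hni'' : ¬ (p : ℤ) ∣ n i'' := fun h => hsmall 4 (by norm_num) (by norm_num)
    (by have := dvd_sub h hi''; rwa [sub_sub_cancel] at this)
  have hii' : i ≠ i' := fun h => hni' (h ▸ hi)
  have hii'' : i ≠ i'' := fun h => hni'' (h ▸ hi)
  have hij : i' ≠ i'' := fun h => hsmall 2 (by norm_num) (by norm_num) (by
    have := dvd_sub (h ▸ hi') hi''
    rwa [sub_sub_sub_cancel_left] at this)
  have hJi' : (p : ℤ) ∣ n i' + J := by
    have := dvd_add hi' (dvd_refl (p : ℤ))
    rwa [show n i' - 2 + p = n i' + J by omega] at this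
  have hJi'' : ¬ (p : ℤ) ∣ n i'' + J := fun h => hsmall 2 (by norm_num) (by norm_num) (by
    have := dvd_sub (dvd_sub h hi'') (dvd_refl (p : ℤ))
    rwa [show n i'' + J - (n i'' - 4) - p = 2 by omega] at this)
  have hval := val_det_jordanChain (hchain i) (hchain i') (hchain i'') hπ hg hJ1 hgJ (hn i) (hn i')
    (hn i'') ((hcast _).2 hi) ((hcast _).not.2 hni') ((hcast _).2 hJi') ((hcast _).not.2 hni'')
    ((hcast _).not.2 hJi'')
  have hdetval : ∃ d : k, d ≠ 0 ∧ (Matrix.of ![![N i 1, 2 * N i 0 - N i 2, -2 * N i 2],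
      ![N i' 1, 2 * N i' 0 - N i' 2, -2 * N i' 2],
      ![N i'' 1, 2 * N i'' 0 - N i'' 2, -2 * N i'' 2]]).det = constMap k E d := by
    have h4 : ∀ d : k, constMap k E (4 * d) = 4 * constMap k E d := fun d => by
      rw [map_mul, map_ofNat]
    have h4c : (4 : k) * c ≠ 0 := mul_ne_zero (by
      rw [show (4 : k) = 2 * 2 by norm_num]; exact mul_ne_zero h2 h2) hc
    have hswap : ∀ x : E, x = 4 * N.det ∨ x = -(4 * N.det) → ∃ d : k, d ≠ 0 ∧ x = constMap k E d := by
      rintro x (rfl | rfl)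
      · exact ⟨_, h4c, by rw [h4, hdet]⟩
      · exact ⟨_, neg_ne_zero.2 h4c, by rw [map_neg, h4, hdet]⟩
    apply hswap
    clear * - hii' hii'' hij
    rw [Matrix.det_fin_three, Matrix.det_fin_three]
    fin_cases i <;> fin_cases i' <;> fin_cases i'' <;> simp at hii' hii'' hij ⊢ <;>
      first
        | (left; ring1)
        | (right; ring1)
  obtain ⟨d, hd, hdd⟩ := hdetval
  rw [hdd, hπ.const d hd, ← zpow_zero (O.valuation π), hπ.zpow_inj] at hval
  obtain ⟨a, ha⟩ := hi
  obtain ⟨b, hb⟩ := hi'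
  obtain ⟨c, hc⟩ := hi''
  have hp0 : (0 : ℤ) < p := by omega
  have hb1 : b ≤ -1 := by
    have := hn0 i'
    by_contra! h
    have : 0 ≤ (p : ℤ) * b := mul_nonneg hp0.le (by omega)
    omega
  have hc1 : c ≤ -1 := by
    have := hn0 i''
    by_contra! h
    have : 0 ≤ (p : ℤ) * c := mul_nonneg hp0.le (by omega)
    omega
  have ha1 : a ≤ 1 - m := by
    have h1 : (m : ℤ) ∣ a - 1 := by
      have h3 := dvd_sub (dvd_add (htw i i'') (hone i'' hni'')) (dvd_mul_right (m : ℤ) (2 * a))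
      rwa [show n i - n i'' + (n i'' - 1) - m * (2 * a) = a - 1 by rw [ha, hpm]; ring] at h3
    have h4 : a < 0 := by
      have := hn0 i
      by_contra! h
      have : 0 ≤ (p : ℤ) * a := mul_nonneg hp0.le h
      omega
    have := Int.le_of_dvd (by omega) (h1.neg_right)
    omega
  have e1 := mul_le_mul_of_nonneg_left ha1 hp0.le
  have e2 := mul_le_mul_of_nonneg_left hb1 hp0.le
  have e3 := mul_le_mul_of_nonneg_left hc1 hp0.le
  have e4 : (p : ℤ) * 3 ≤ p * m := mul_le_mul_of_nonneg_left (by omega) hp0.le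
  rw [mul_sub] at e1
  omega

end NoCover

section Trinomial

variable {k E : Type} [Field k] [Field E] [Algebra (RatFunc k) E] {p : ℕ}

/-- The roots in `E` of the trinomial `Y ^ p + Y ^ 2 - X ^ 2`. -/
def triRoots (k E : Type) [Field k] [Field E] [Algebra (RatFunc k) E] (p : ℕ) : Set E :=
  {x | x ^ p + x ^ 2 = coord k E ^ 2}

lemma triRoots_ne_zero (hp : p ≠ 0) {x : E} (hx : x ∈ triRoots k E p) : x ≠ 0 := by
  rintro rfl
  simp only [triRoots, Set.mem_ofPred_eq, zero_pow hp, ne_eq, OfNat.ofNat_ne_zero,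
    not_false_eq_true, zero_pow, add_zero] at hx
  exact pow_ne_zero 2 (coord_ne_zero (k := k) (E := E)) hx.symm

lemma triRoots_apply {x : E} (σ : E ≃+* E) (hσ : σ (coord k E) ^ 2 = coord k E ^ 2)
    (hx : x ∈ triRoots k E p) : σ x ∈ triRoots k E p := by
  have := congrArg σ hx
  simpa only [triRoots, Set.mem_ofPred_eq, map_add, map_pow, hσ] using this

lemma triRoots_apply_algEquiv {x : E} (σ : E ≃ₐ[RatFunc k] E)
    (hx : x ∈ triRoots k E p) : σ x ∈ triRoots k E p :=
  triRoots_apply (σ : E ≃+* E) (by simp [coord]) hx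

lemma triRoots_charP [CharP k p] : CharP E p :=
  charP_of_injective_ringHom (constMap k E).injective p

variable [CharP k p] [Fact p.Prime] {x y : E}

lemma triRoots_sub (hx : x ∈ triRoots k E p) (hy : y ∈ triRoots k E p) (hxy : x ≠ y) :
    (x - y) ^ (p - 1) + (x + y) = 0 := by
  have : CharP E p := triRoots_charP (k := k)
  have hp : 0 < p := (Fact.out : p.Prime).pos
  refine (mul_eq_zero.1 ?_).resolve_left (sub_ne_zero.2 hxy)
  rw [mul_add, ← pow_succ', Nat.sub_add_cancel hp, sub_pow_char]
  simp only [triRoots, Set.mem_ofPred_eq] at hx hy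
  linear_combination hx - hy

omit [CharP k p] [Fact p.Prime] in
lemma coord_div_sq (hp : 2 < p) (hx : x ∈ triRoots k E p) :
    (coord k E / x) ^ 2 = x ^ (p - 2) + 1 := by
  have h0 := triRoots_ne_zero (by omega) hx
  rw [div_pow, div_eq_iff (pow_ne_zero 2 h0), add_mul, ← pow_add, Nat.sub_add_cancel hp.le,
    one_mul]
  exact hx.symm

lemma coord_div_sub (hp : 2 < p) (hx : x ∈ triRoots k E p) (hy : y ∈ triRoots k E p)
    (hxy : x ≠ y) :
    coord k E ^ (p - 2) * (coord k E / y - coord k E / x) ^ (p - 1) +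
      (coord k E / x + coord k E / y) * (coord k E / x * (coord k E / y)) ^ (p - 2) = 0 := by
  have h := triRoots_sub hx hy hxy
  have hx0 := triRoots_ne_zero (by omega) hx
  have hy0 := triRoots_ne_zero (by omega) hy
  set T := coord k E
  obtain ⟨n, rfl⟩ : ∃ n, p = n + 2 := ⟨p - 2, by omega⟩
  simp only [Nat.add_sub_cancel, show n + 2 - 1 = n + 1 by omega] at h ⊢
  have h1 : T / y - T / x = T * (x - y) / (x * y) := by field_simp
  have h2 : T / x + T / y = T * (x + y) / (x * y) := by field_simp; ring
  rw [h1, h2]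
  have h3 : T ^ n * (T * (x - y) / (x * y)) ^ (n + 1) +
      T * (x + y) / (x * y) * (T / x * (T / y)) ^ n =
      T ^ (2 * n + 1) / (x * y) ^ (n + 1) * ((x - y) ^ (n + 1) + (x + y)) := by
    rw [div_pow, mul_pow, show T / x * (T / y) = T ^ 2 / (x * y) by field_simp, div_pow]
    field_simp
    ring
  rw [h3, h, mul_zero]

end Trinomial

section AtInfinity

variable {k E : Type} [Field k] [Field E] [Algebra (RatFunc k) E] {p m : ℕ}
  [CharP k p] [Fact p.Prime] {O : ValuationSubring E} {π x y : E}
  (hO : O.comap (algebraMap (RatFunc k) E) = inftyPlace k) (h : IsUnif O.valuation (constMap k E) π)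
include hO h

omit [CharP k p] [Fact p.Prime] in
lemma triRoots_val (hp : 2 < p) {e n : ℤ} (he : O.valuation (coord k E) = O.valuation π ^ (-e))
    (hx : x ∈ triRoots k E p) (hn : O.valuation x = O.valuation π ^ n) :
    0 < e ∧ n * p = -(2 * e) := by
  have hT := one_lt_val_coord (k := k) hO
  have hx1 : 1 < O.valuation x := by
    by_contra! hle
    have : O.valuation (coord k E ^ 2) ≤ 1 := by
      rw [← show x ^ p + x ^ 2 = _ from hx]
      refine (O.valuation.map_add _ _).trans (max_le ?_ ?_) <;> rw [map_pow] <;>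
        exact pow_le_one₀ zero_le hle
    rw [map_pow] at this
    exact absurd this (not_le.2 (one_lt_pow₀ hT two_ne_zero))
  have hlt : O.valuation (x ^ 2) < O.valuation (x ^ p) := by
    rw [map_pow, map_pow]
    exact pow_lt_pow_right₀ hx1 hp
  have hval : O.valuation x ^ p = O.valuation (coord k E) ^ 2 := by
    rw [← map_pow, ← map_pow, ← show x ^ p + x ^ 2 = _ from hx,
      O.valuation.map_add_eq_of_lt_left hlt]
  constructor
  · rw [he, ← zpow_zero (O.valuation π), h.zpow_lt] at hT
    omega
  · rw [hn, he, ← zpow_natCast, ← zpow_mul, ← zpow_natCast, ← zpow_mul, h.zpow_inj] at hval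
    push_cast at hval
    linarith

omit hO in
lemma triRoots_val_sub (hp : 2 < p) (hx : x ∈ triRoots k E p) (hy : y ∈ triRoots k E p)
    (hxy : x ≠ y) (hv : O.valuation x = O.valuation y) (hv1 : 1 < O.valuation x) :
    O.valuation (x - y) ^ (p - 1) = O.valuation x := by
  have hrel := triRoots_sub hx hy hxy
  have h2 : (2 : k) ≠ 0 := by
    have := (CharP.cast_eq_zero_iff k p 2).not.2 fun h => by
      have := Nat.le_of_dvd two_pos h; omega
    simpa using this
  have hle : O.valuation (x - y) ≤ O.valuation x :=
    (O.valuation.map_sub _ _).trans (by rw [hv, max_self])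
  have heq : O.valuation (x - y) ^ (p - 1) = O.valuation (x + y) := by
    rw [← map_pow, eq_neg_of_add_eq_zero_left hrel, Valuation.map_neg]
  have hlt : O.valuation (x - y) < O.valuation x := by
    refine lt_of_le_of_ne hle fun hE => ?_
    have h1 : O.valuation (x + y) ≤ O.valuation x :=
      (O.valuation.map_add _ _).trans (by rw [hv, max_self])
    rw [← heq, hE] at h1
    have := lt_self_pow₀ hv1 (show 1 < p - 1 by omega)
    exact absurd h1 (not_le.2 this)
  rw [heq]
  have h3 : O.valuation (constMap k E 2 * x) = O.valuation x := by
    rw [map_mul, h.const _ h2, one_mul]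
  have h4 : x + y = constMap k E 2 * x - (x - y) := by
    rw [map_ofNat]; ring
  rw [h4, O.valuation.map_sub_eq_of_lt_left (by rwa [h3]), h3]

end AtInfinity

section TrinomialInertia

variable {k E : Type} [Field k] [Field E] [Algebra (RatFunc k) E] {p m : ℕ}
  [CharP k p] [Fact p.Prime] {O : ValuationSubring E} {π x y : E}
  [FiniteDimensional (RatFunc k) E] [IsGalois (RatFunc k) E] [IsAlgClosed k]
  (hO : O.comap (algebraMap (RatFunc k) E) = inftyPlace k) (h : IsUnif O.valuation (constMap k E) π)
include hO h

omit [FiniteDimensional (RatFunc k) E] [IsGalois (RatFunc k) E] [IsAlgClosed k] in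
lemma triRoots_exists_val (hp : 2 < p) (hm : 2 * m = p - 1)
    (hcard : 2 ≤ (triRoots k E p).ncard) :
    ∃ f : ℤ, 0 < f ∧ O.valuation (coord k E) = O.valuation π ^ (-(p * m * f)) ∧
      (∀ x ∈ triRoots k E p, O.valuation x = O.valuation π ^ (-(2 * m * f))) ∧
      ∀ x ∈ triRoots k E p, ∀ y ∈ triRoots k E p, x ≠ y →
        O.valuation (x - y) = O.valuation π ^ (-f) := by
  have hP : p.Prime := Fact.out
  obtain ⟨a, b, ha, hb, hab⟩ := (Set.one_lt_ncard_iff (Set.finite_of_ncard_pos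
    (by omega : 0 < (triRoots k E p).ncard))).1 hcard
  obtain ⟨e', he'⟩ := h.disc (coord k E) coord_ne_zero
  obtain ⟨e, rfl⟩ : ∃ e, e' = -e := ⟨-e', by simp⟩
  have hval : ∀ x ∈ triRoots k E p, ∃ n : ℤ, O.valuation x = O.valuation π ^ n ∧
      0 < e ∧ n * p = -(2 * e) := fun x hx => by
    obtain ⟨n, hn⟩ := h.disc x (triRoots_ne_zero hP.ne_zero hx)
    exact ⟨n, hn, triRoots_val hO h hp he' hx hn⟩
  obtain ⟨n, hn, he, hne⟩ := hval a ha
  have hp0 : (0 : ℤ) < p := by exact_mod_cast hP.pos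
  have hn0 : n < 0 := by
    by_contra! hn0
    have := mul_nonneg hn0 hp0.le
    omega
  have hvn : ∀ x ∈ triRoots k E p, O.valuation x = O.valuation π ^ n := fun x hx => by
    obtain ⟨n', hn', -, hne'⟩ := hval x hx
    rw [hn', mul_right_cancel₀ hp0.ne' (hne'.trans hne.symm)]
  have h1 : ∀ x ∈ triRoots k E p, 1 < O.valuation x := fun x hx => by
    rw [hvn x hx, ← zpow_zero (O.valuation π), h.zpow_lt]; exact hn0
  have hsub : ∀ x ∈ triRoots k E p, ∀ y ∈ triRoots k E p, x ≠ y → ∃ d : ℤ,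
      O.valuation (x - y) = O.valuation π ^ d ∧ d * (2 * m) = n := fun x hx y hy hxy => by
    obtain ⟨d, hd⟩ := h.disc (x - y) (sub_ne_zero.2 hxy)
    refine ⟨d, hd, ?_⟩
    have := triRoots_val_sub h hp hx hy hxy (by rw [hvn x hx, hvn y hy]) (h1 x hx)
    rw [hvn x hx, hd, ← zpow_natCast, ← zpow_mul, h.zpow_inj, ← hm] at this
    exact_mod_cast this
  obtain ⟨d, -, hd⟩ := hsub a ha b hb hab
  have hm0 : (0 : ℤ) < m := by omega
  refine ⟨-d, ?_, ?_, ?_, ?_⟩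
  · by_contra! hd0
    have := mul_nonneg (show 0 ≤ d by omega) (show (0 : ℤ) ≤ 2 * m by omega)
    omega
  · rw [he', h.zpow_inj]
    rw [← hd] at hne
    linarith
  · intro x hx
    rw [hvn x hx, h.zpow_inj, ← hd]; ring
  · intro x hx y hy hxy
    obtain ⟨d', hd', hdd⟩ := hsub x hx y hy hxy
    rw [hd', neg_neg, h.zpow_inj]
    exact mul_right_cancel₀ (show (2 * m : ℤ) ≠ 0 by omega) (hdd.trans hd.symm)

variable (hfix : ∀ g : E ≃ₐ[RatFunc k] E, (∀ x ∈ triRoots k E p, g x = x) → g = 1)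

include hfix

lemma triRoots_card_inertia (hp : 2 < p) (hm : 2 * m = p - 1)
    (hcard : (triRoots k E p).ncard = p) :
    Nat.card (inertiaIn k O) = p * m ∧
      O.valuation (coord k E) = O.valuation π ^ (-(p * m : ℤ)) := by
  have hP : p.Prime := Fact.out
  have hm0 : m ≠ 0 := by omega
  have : NeZero m := ⟨hm0⟩
  obtain ⟨f, hf, hT, hx, hxy⟩ := triRoots_exists_val hO h hp hm (by omega)
  have hfin : (triRoots k E p).Finite := Set.finite_of_ncard_pos (by omega)
  obtain ⟨a, ha⟩ := Set.nonempty_of_ncard_ne_zero (s := triRoots k E p) (by omega)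
  set I := inertiaIn k O
  have hI : ∀ g ∈ I, Fixes O.valuation (constMap k E) (g : E ≃+* E) := fun g hg => fixes_of_mem hO hg
  let θ := twistHom h I hI h.ne_zero
  have hθ : ∀ g : I, ∀ z : E, ∀ n : ℤ, O.valuation z = O.valuation π ^ n →
      Twist O.valuation (constMap k E) ((g : E ≃ₐ[RatFunc k] E) : E ≃+* E) z ((θ g : k) ^ n) :=
    fun g z n hz => Twist.of_val h (hI g g.2) (twistHom_spec h I hI h.ne_zero g) hz
  let S := MulAction.stabilizer I a
  have hroot : ∀ g : S, (θ g : kˣ) ^ (-f) ∈ rootsOfUnity m k := by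
    intro g
    have hga : (g : E ≃ₐ[RatFunc k] E) a = a := g.2
    have ha0 := triRoots_ne_zero hP.ne_zero ha
    have hw : O.valuation (coord k E / a ^ m) = O.valuation π ^ (-(m * f)) := by
      rw [map_div₀, map_pow, hx a ha, hT, ← zpow_natCast, ← zpow_mul, ← zpow_sub₀ h.ne, h.zpow_inj]
      have : (p : ℤ) = 2 * m + 1 := by omega
      rw [this]; ring
    have h1 := hθ g _ _ hw
    have h2 : Twist O.valuation (constMap k E) ((g : E ≃ₐ[RatFunc k] E) : E ≃+* E)
        (coord k E / a ^ m) 1 := by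
      have h3 : (g : E ≃ₐ[RatFunc k] E) (coord k E / a ^ m) = coord k E / a ^ m := by
        rw [map_div₀, map_pow, hga]; simp [coord]
      have h4 : coord k E / a ^ m ≠ 0 := div_ne_zero coord_ne_zero (pow_ne_zero _ ha0)
      generalize coord k E / a ^ m = w at h3 h4
      rw [Twist, map_one, one_mul, show ((g : E ≃ₐ[RatFunc k] E) : E ≃+* E) w = w from h3, sub_self,
        map_zero]
      exact zero_lt_iff.2 ((map_ne_zero O.valuation).2 h4)
    have h5 := h1.unique h h2
    rw [mem_rootsOfUnity]
    ext
    rw [← zpow_natCast, ← zpow_mul]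
    push_cast
    rw [← h5]
    congr 1; ring
  have hinj : Function.Injective fun g : S => (⟨_, hroot g⟩ : rootsOfUnity m k) := by
    intro g g' hgg
    have h0 : (θ (g⁻¹ * g' : S) : kˣ) ^ (-f) = 1 := by
      have := congrArg Subtype.val hgg
      simp only at this
      rw [Subgroup.coe_mul, map_mul, Subgroup.coe_inv, map_inv, mul_zpow, inv_zpow, this]
      simp
    have h1 : g⁻¹ * g' = 1 := by
      generalize g⁻¹ * g' = s at h0
      have hsa : (s : E ≃ₐ[RatFunc k] E) a = a := s.2
      refine Subtype.ext (Subtype.ext (hfix _ fun c hc => ?_))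
      by_cases hca : c = a
      · rw [hca]; exact hsa
      have h2 := hθ s _ _ (hxy c hc a ha hca)
      have h3 : ((θ s : kˣ) : k) ^ (-f) = 1 := by
        rw [← Units.val_zpow_eq_zpow_val, h0, Units.val_one]
      rw [h3] at h2
      by_contra hne
      have h4 := hxy _ (triRoots_apply_algEquiv (s : E ≃ₐ[RatFunc k] E) hc) c hc hne
      have h5 : ((s : E ≃ₐ[RatFunc k] E) : E ≃+* E) (c - a) - constMap k E 1 * (c - a) =
          (s : E ≃ₐ[RatFunc k] E) c - c := by
        rw [map_one, one_mul, map_sub]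
        change (s : E ≃ₐ[RatFunc k] E) c - (s : E ≃ₐ[RatFunc k] E) a - _ = _
        rw [hsa]; ring
      rw [Twist, h5, h4, hxy c hc a ha hca] at h2
      exact lt_irrefl _ h2
    exact (inv_mul_eq_one.1 h1)
  have hS : Nat.card S ≤ m := by
    have : Finite (rootsOfUnity m k) := inferInstance
    exact (Nat.card_le_card_of_injective _ hinj).trans (card_rootsOfUnity k m)
  have horb : Nat.card (MulAction.orbit I a) ≤ p := by
    rw [← hcard]
    refine Set.ncard_le_ncard ?_ hfin
    rintro _ ⟨g, rfl⟩
    exact triRoots_apply_algEquiv _ ha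
  have hle : Nat.card I ≤ p * m := by
    rw [← Nat.card_congr (MulAction.orbitProdStabilizerEquivGroup I a), Nat.card_prod]
    exact Nat.mul_le_mul horb hS
  have hdvd := ramification_dvd_card hO h hT
  have hpos : 0 < Nat.card I := Nat.card_pos
  have hle2 := Int.le_of_dvd (by exact_mod_cast hpos) hdvd
  have hpm : (0 : ℤ) < p * m := by
    have := Nat.mul_pos hP.pos (Nat.pos_of_ne_zero hm0); exact_mod_cast this
  have hf1 : f = 1 := by
    have h1 : (p * m : ℤ) * f ≤ p * m * 1 := by
      rw [mul_one]; exact hle2.trans (by exact_mod_cast hle)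
    have := le_of_mul_le_mul_left h1 hpm
    omega
  subst hf1
  rw [mul_one] at hle2 hT
  exact ⟨le_antisymm hle (by exact_mod_cast hle2), hT⟩

lemma triRoots_hasLowerJump (hp : 2 < p) (hm : 2 * m = p - 1)
    (hcard : (triRoots k E p).ncard = p) {g : E ≃ₐ[RatFunc k] E} (hg : g ∈ inertiaIn k O)
    (hgp : orderOf g = p) : HasLowerJump O g (p - 2) := by
  have hP : p.Prime := Fact.out
  have hF := fixes_of_mem hO hg
  obtain ⟨f, hf, hT, hx, hxy⟩ := triRoots_exists_val hO h hp hm (by omega)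
  have hT' := (triRoots_card_inertia hO h hfix hp hm hcard).2
  have hpm : (p * m : ℤ) ≠ 0 := by
    have := Nat.mul_ne_zero hP.ne_zero (show m ≠ 0 by omega); exact_mod_cast this
  have hf1 : f = 1 := by
    rw [hT', h.zpow_inj, neg_inj] at hT
    exact (mul_left_cancel₀ hpm ((mul_one _).trans hT)).symm
  subst hf1
  obtain ⟨x, hxr, hgx⟩ : ∃ x ∈ triRoots k E p, g x ≠ x := by
    by_contra! hall
    rw [hfix g hall, orderOf_one] at hgp
    omega
  have hne : g π ≠ π := fun hgπ => by
    have hx0 := triRoots_ne_zero hP.ne_zero hxr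
    have hx1 : O.valuation x⁻¹ ≤ 1 := by
      rw [map_inv₀, hx x hxr, ← zpow_neg, ← zpow_zero (O.valuation π), h.zpow_le]
      omega
    have hne' : g x⁻¹ - x⁻¹ ≠ 0 := by
      rw [map_inv₀, sub_ne_zero]; exact fun h => hgx (inv_injective h)
    obtain ⟨a, ha⟩ := h.disc _ hne'
    have h1 := jump_subring (J := a) h hF (by simp [hgπ]) hx1
    have h2 : O.valuation (g x⁻¹ - x⁻¹) ≤ _ := h1
    rw [ha, h.zpow_le] at h2
    omega
  have htw : Twist O.valuation (constMap k E) (g : E ≃+* E) π 1 := by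
    let θ := twistHom h (inertiaIn k O) (fun g hg => fixes_of_mem hO hg) h.ne_zero
    have h1 : (θ ⟨g, hg⟩ : k) ^ p = 1 := by
      rw [← Units.val_pow_eq_pow_val, ← map_pow,
        show (⟨g, hg⟩ : inertiaIn k O) ^ p = 1 from Subtype.ext (hgp ▸ pow_orderOf_eq_one g)]
      simp
    have h2 : ((θ ⟨g, hg⟩ : k) - 1) ^ p = 0 := by rw [sub_pow_char, h1, one_pow, sub_self]
    exact (twistHom_eq_iff h _ (fun g hg => fixes_of_mem hO hg) h.ne_zero ⟨g, hg⟩).1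
      (sub_eq_zero.1 (eq_zero_of_pow_eq_zero h2))
  have hlt : O.valuation (g π - π) < O.valuation π := by simpa [Twist] using htw
  obtain ⟨n, hn⟩ := h.disc _ (sub_ne_zero.2 hne)
  obtain ⟨J, rfl⟩ : ∃ J, n = J + 1 := ⟨n - 1, by ring⟩
  have hJ1 : 1 ≤ J := by
    rw [hn] at hlt
    have := (h.zpow_lt (a := J + 1) (b := 1)).1 (by rwa [zpow_one])
    omega
  have h1 := (jump_apply h hF hJ1 hn (hx x hxr)).1 (by
    have h1 : (-(2 * m * 1) : ℤ) = 1 - p := by omega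
    rw [h1]; simp)
  have h2 := hxy _ (triRoots_apply_algEquiv g hxr) x hxr hgx
  have h3 : O.valuation (g x - x) = _ := h1
  rw [h2, h.zpow_inj] at h3
  refine ⟨π, h.isUniformizer, ?_⟩
  rw [hn, ← zpow_natCast, h.zpow_inj]
  push_cast [hp.le]
  have : (p : ℤ) = 2 * m + 1 := by omega
  omega

end TrinomialInertia

section EtaleCriterion

open Polynomial

variable {k E : Type} [Field k] [IsAlgClosed k] [Field E] [Algebra (RatFunc k) E]
  [Algebra (Polynomial k) E] [IsScalarTower (Polynomial k) (RatFunc k) E]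

lemma exists_eq_span_of_isMaximal (M : Ideal (Polynomial k)) [hM : M.IsMaximal] :
    ∃ α : k, M = Ideal.span {X - C α} := by
  have key : ∀ α : k, M ≤ Ideal.span {X - C α} → M = Ideal.span {X - C α} := fun α hα =>
    hM.eq_of_le (PrincipalIdealRing.isMaximal_of_irreducible (irreducible_X_sub_C α)).ne_top hα
  obtain ⟨f, rfl⟩ := (IsPrincipalIdealRing.principal M).principal
  by_cases hf : f.degree = 0
  · exact absurd (Ideal.eq_top_of_isUnit_mem _ (Ideal.mem_span_singleton_self f)
      (isUnit_iff_degree_eq_zero.2 hf)) hM.ne_top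
  · obtain ⟨α, hα⟩ := IsAlgClosed.exists_root f hf
    refine ⟨α, key α ?_⟩
    exact (Ideal.span_singleton_le_span_singleton).2 (dvd_iff_isRoot.2 hα)

lemma perfectField_residueField (M : Ideal (Polynomial k)) [M.IsMaximal] :
    PerfectField M.ResidueField := by
  obtain ⟨α, hα⟩ := exists_eq_span_of_isMaximal M
  let i : k →+* M.ResidueField := (algebraMap (Polynomial k) M.ResidueField).comp C
  have hi : Function.Surjective i := by
    intro y
    obtain ⟨q, rfl⟩ := M.bijective_algebraMap_quotient_residueField.surjective y
    obtain ⟨f, rfl⟩ := Ideal.Quotient.mk_surjective q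
    refine ⟨f.eval α, ?_⟩
    change algebraMap (Polynomial k ⧸ M) M.ResidueField (Ideal.Quotient.mk M (C (f.eval α))) = _
    congr 1
    rw [Ideal.Quotient.eq, hα, Ideal.mem_span_singleton, dvd_iff_isRoot]
    simp
  have e : k ≃+* M.ResidueField := RingEquiv.ofBijective i ⟨i.injective, hi⟩
  have := IsAlgClosed.of_ringEquiv _ _ e
  infer_instance

variable [FiniteDimensional (RatFunc k) E] [IsGalois (RatFunc k) E]

/-- A Galois cover of the affine line with trivial inertia groups is étale. -/
lemma etale_of_inertia_trivial
    (hin : ∀ φ : integralClosure (Polynomial k) E →+* k, ∀ α : k,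
      (∀ f : Polynomial k, φ (algebraMap _ _ f) = f.eval α) →
      ∀ g : E ≃ₐ[RatFunc k] E, (∀ b, φ (g • b) = φ b) → g = 1) :
    Algebra.Etale (Polynomial k) (integralClosure (Polynomial k) E) := by
  set B := integralClosure (Polynomial k) E
  have : Module.Finite (Polynomial k) B :=
    IsIntegralClosure.finite (Polynomial k) (RatFunc k) E B
  have : FaithfulSMul (Polynomial k) B :=
    (faithfulSMul_iff_algebraMap_injective _ _).2 fun a b hab =>
      algebraMap_poly_injective (E := E) (congrArg Subtype.val hab)
  have : Module.IsTorsionFree (Polynomial k) B := inferInstance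
  have : Module.Flat (Polynomial k) B := inferInstance
  have : Algebra.FinitePresentation (Polynomial k) B :=
    Algebra.FinitePresentation.of_finiteType.1 inferInstance
  have hmax : ∀ (P : Ideal B) (_ : P.IsPrime), P.IsMaximal →
      Algebra.IsUnramifiedAt (Polynomial k) P := by
    intro P _ hP
    have hM : (P.under (Polynomial k)).IsMaximal := inferInstance
    have := perfectField_residueField (P.under (Polynomial k))
    obtain ⟨α, hα⟩ := exists_eq_span_of_isMaximal (P.under (Polynomial k))
    have hmem : algebraMap (Polynomial k) B (X - C α) ∈ P := by
      change _ ∈ P.under (Polynomial k)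
      rw [hα]
      exact Ideal.mem_span_singleton_self _
    obtain ⟨φ, hφ, hker⟩ := exists_residueHom P α hmem
    rw [← Ideal.ramificationIdx_eq_one_iff,
      ← Ideal.ramificationIdxIn_eq_ramificationIdx (P.under (Polynomial k)) P (E ≃ₐ[RatFunc k] E),
      ← Ideal.card_inertia_eq_ramificationIdxIn (G := E ≃ₐ[RatFunc k] E) _ P, Nat.card_eq_one_iff_unique]
    refine ⟨⟨fun g g' => ?_⟩, ⟨1⟩⟩
    have h1 : ∀ g : P.inertia (E ≃ₐ[RatFunc k] E), g = 1 := fun g =>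
      Subtype.ext (hin φ α hφ g fun b => by
        have := g.2 b
        rw [← sub_eq_zero, ← map_sub, ← RingHom.mem_ker, hker]
        exact this)
    rw [h1 g, h1 g']
  have : Algebra.FormallyUnramified (Polynomial k) B := by
    rw [← Algebra.unramifiedLocus_eq_univ_iff, Algebra.unramifiedLocus_eq_compl_support,
      Set.compl_univ_iff, Set.eq_empty_iff_forall_notMem]
    intro q hq
    obtain ⟨P, hP, hle⟩ := q.asIdeal.exists_le_maximal q.2.ne_top
    have hP' : (⟨P, hP.isPrime⟩ : PrimeSpectrum B) ∈ Module.support B (Ω[B⁄Polynomial k]) :=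
      Module.mem_support_mono hle hq
    have h1 : (⟨P, hP.isPrime⟩ : PrimeSpectrum B) ∈ Algebra.unramifiedLocus (Polynomial k) B :=
      hmax P hP.isPrime hP
    rw [Algebra.unramifiedLocus_eq_compl_support] at h1
    exact h1 hP'
  exact Algebra.Etale.of_formallyUnramified_of_flat

end EtaleCriterion

section TrinomialFibre

open Polynomial

variable {k E : Type} [Field k] [Field E] [Algebra (RatFunc k) E]
  [Algebra (Polynomial k) E] [IsScalarTower (Polynomial k) (RatFunc k) E] {p : ℕ} {x y : E}

lemma isIntegral_triRoots (hp : 2 < p) (hx : x ∈ triRoots k E p) :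
    IsIntegral (Polynomial k) x := by
  have hmon : (X ^ p + X ^ 2 - C (X ^ 2) : Polynomial (Polynomial k)).Monic := by
    rw [add_sub_assoc]
    refine monic_X_pow_add (lt_of_le_of_lt (b := 2) ?_ (by exact_mod_cast hp))
    compute_degree!
  refine ⟨_, hmon, ?_⟩
  simp only [eval₂_sub, eval₂_add, eval₂_pow, eval₂_X, eval₂_C, map_pow, algebraMap_X_eq]
  rw [← show x ^ p + x ^ 2 = _ from hx, sub_self]

/-- A root of the trinomial as an integral function. -/
def triRoot (hp : 2 < p) (hx : x ∈ triRoots k E p) : integralClosure (Polynomial k) E :=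
  ⟨x, isIntegral_triRoots hp hx⟩

lemma isIntegral_coord_div (hp : 2 < p) (hx : x ∈ triRoots k E p) :
    IsIntegral (Polynomial k) (coord k E / x) := by
  refine IsIntegral.of_pow two_pos ?_
  rw [coord_div_sq hp hx]
  exact ((isIntegral_triRoots hp hx).pow _).add isIntegral_one

/-- The quotient of the coordinate by a root of the trinomial, as an integral function. -/
noncomputable def triUnit (hp : 2 < p) (hx : x ∈ triRoots k E p) : integralClosure (Polynomial k) E :=
  ⟨coord k E / x, isIntegral_coord_div hp hx⟩

variable (φ : integralClosure (Polynomial k) E →+* k)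

lemma triUnit_residue_sq (hp : 2 < p) (hx : x ∈ triRoots k E p) (h0 : φ (triRoot hp hx) = 0) :
    φ (triUnit hp hx) ^ 2 = 1 := by
  have : triUnit hp hx ^ 2 = triRoot hp hx ^ (p - 2) + 1 := Subtype.ext (coord_div_sq hp hx)
  rw [← map_pow, this, map_add, map_pow, h0, zero_pow (by omega), zero_add, map_one]

variable [CharP k p] [Fact p.Prime]

lemma triRoot_residue_eq_zero (hp : 2 < p) (hx : x ∈ triRoots k E p) (hy : y ∈ triRoots k E p)
    (hxy : x ≠ y) (h : φ (triRoot hp hx) = φ (triRoot hp hy)) : φ (triRoot hp hx) = 0 := by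
  have : (triRoot hp hx - triRoot hp hy) ^ (p - 1) + (triRoot hp hx + triRoot hp hy) = 0 :=
    Subtype.ext (triRoots_sub hx hy hxy)
  have := congrArg φ this
  rw [map_add, map_pow, map_sub, h, sub_self, zero_pow (by omega), zero_add, map_add, map_zero, h,
    ← two_mul] at this
  rw [h]
  refine (mul_eq_zero.1 this).resolve_left ?_
  exact_mod_cast (CharP.cast_eq_zero_iff k p 2).not.2 fun h => by
    have := Nat.le_of_dvd two_pos h; omega

lemma triUnit_residue_ne (hp : 2 < p) (hx : x ∈ triRoots k E p) (hy : y ∈ triRoots k E p)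
    (hxy : x ≠ y) (h0 : φ (triRoot hp hx) = 0) :
    φ (triUnit hp hx) ≠ φ (triUnit hp hy) := by
  intro h
  have hrel : (algebraMap (Polynomial k) _ X) ^ (p - 2) * (triUnit hp hy - triUnit hp hx) ^ (p - 1)
      + (triUnit hp hx + triUnit hp hy) * (triUnit hp hx * triUnit hp hy) ^ (p - 2) = 0 := by
    refine Subtype.ext (Eq.trans ?_ (coord_div_sub hp hx hy hxy))
    push_cast
    rw [algebraMap_X_eq]
    rfl
  have h1 := congrArg φ hrel
  rw [map_add, map_mul, map_pow φ (_ - _), map_sub, h, sub_self, zero_pow (by omega), mul_zero,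
    zero_add, map_mul, map_add, map_pow, map_mul, h, map_zero, ← two_mul, ← sq, ← h,
    triUnit_residue_sq φ hp hx h0, one_pow, mul_one] at h1
  have h2 : φ (triUnit hp hx) ≠ 0 := fun h2 => by
    have := triUnit_residue_sq φ hp hx h0
    rw [h2] at this; simp at this
  refine mul_ne_zero ?_ h2 h1
  exact_mod_cast (CharP.cast_eq_zero_iff k p 2).not.2 fun h => by
    have := Nat.le_of_dvd two_pos h; omega

/-- Inertia groups act trivially on the roots of the trinomial. -/
lemma triRoots_inertia (hp : 2 < p) {g : E ≃ₐ[RatFunc k] E} (hg : ∀ b, φ (g • b) = φ b)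
    (hx : x ∈ triRoots k E p) : g x = x := by
  by_contra hne
  have hgx := triRoots_apply_algEquiv g hx
  have h1 : g • triRoot hp hx = triRoot hp hgx := rfl
  have h2 : g • triUnit hp hx = triUnit hp hgx := Subtype.ext (by
    change g (coord k E / x) = coord k E / g x
    rw [map_div₀]; simp [coord])
  have h3 := hg (triRoot hp hx)
  rw [h1] at h3
  have h4 := hg (triUnit hp hx)
  rw [h2] at h4
  exact triUnit_residue_ne φ hp hgx hx hne (triRoot_residue_eq_zero φ hp hgx hx hne h3) h4

end TrinomialFibre

section PermGroup

open Equiv.Perm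

/-- A permutation group of prime degree, of order divisible by the degree and normalized by a swap,
contains the alternating group. -/
lemma alternatingGroup_le_of_swap_normalizes {α : Type*} [Fintype α] [DecidableEq α]
    (h0 : (Fintype.card α).Prime) {H : Subgroup (Equiv.Perm α)}
    (h1 : Fintype.card α ∣ Nat.card H) {τ : Equiv.Perm α} (hτ : τ.IsSwap)
    (hn : ∀ σ ∈ H, τ * σ * τ⁻¹ ∈ H) : alternatingGroup α ≤ H := by
  classical
  have hinv : τ⁻¹ = τ := by
    obtain ⟨x, y, _, rfl⟩ := hτ
    simp
  have hsq : τ * τ = 1 := by nth_rw 1 [← hinv]; exact inv_mul_cancel τ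
  rw [hinv] at hn
  let K : Subgroup (Equiv.Perm α) :=
    { carrier := {σ | σ ∈ H ∨ τ * σ ∈ H}
      one_mem' := Or.inl H.one_mem
      mul_mem' := by
        rintro a b (ha | ha) (hb | hb)
        · exact Or.inl (H.mul_mem ha hb)
        · refine Or.inr ?_
          have := H.mul_mem (hn a ha) hb
          rwa [show τ * a * τ * (τ * b) = τ * a * (τ * τ) * b by group, hsq, mul_one,
            mul_assoc] at this
        · exact Or.inr (by rw [← mul_assoc]; exact H.mul_mem ha hb)
        · refine Or.inl ?_
          have := H.mul_mem (hn _ ha) hb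
          rwa [show τ * (τ * a) * τ * (τ * b) = (τ * τ) * a * (τ * τ) * b by group, hsq, mul_one,
            one_mul] at this
      inv_mem' := by
        rintro a (ha | ha)
        · exact Or.inl (H.inv_mem ha)
        · refine Or.inr ?_
          have := hn _ (H.inv_mem ha)
          rwa [mul_inv_rev, hinv, mul_assoc, mul_assoc, hsq, mul_one] at this }
  have hHK : H ≤ K := fun σ hσ => Or.inl hσ
  have hK : K = ⊤ := subgroup_eq_top_of_swap_mem h0
    (by rw [← Nat.card_eq_fintype_card (α := K)]; exact h1.trans (Subgroup.card_dvd_of_le hHK))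
    (show τ ∈ K from Or.inr (by rw [hsq]; exact H.one_mem)) hτ
  refine alternatingGroup_le_of_index_le_two ?_
  by_cases hH : H = ⊤
  · simp [hH]
  refine (Subgroup.index_eq_two_iff'.2 ⟨τ, fun σ => ?_⟩).le
  have hτH : τ ∉ H := fun hmem => hH <| top_le_iff.1 <| hK ▸ fun σ hσ => hσ.elim id fun h => by
    have := H.mul_mem hmem h
    rwa [← mul_assoc, hsq, one_mul] at this
  have hσ : σ ∈ K := hK ▸ Subgroup.mem_top σ
  rw [xor_iff_or_and_not_and]
  refine ⟨hσ.symm, fun h => hτH ?_⟩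
  simpa using H.mul_mem h.1 (H.inv_mem h.2)

end PermGroup

section SplittingField

open Polynomial

variable (k : Type) [Field k] (p : ℕ)

/-- The trinomial `Y ^ p + Y ^ 2 - X ^ 2` over the rational function field. -/
noncomputable def triPoly : Polynomial (RatFunc k) := X ^ p + X ^ 2 - C (RatFunc.X ^ 2)

variable {k p}

lemma triPoly_monic (hp : 2 < p) : (triPoly k p).Monic := by
  rw [triPoly, add_sub_assoc]
  refine monic_X_pow_add (lt_of_le_of_lt (b := 2) ?_ (by exact_mod_cast hp))
  compute_degree!

lemma triPoly_natDegree (hp : 2 < p) : (triPoly k p).natDegree = p := by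
  rw [triPoly, add_sub_assoc]
  refine (natDegree_add_eq_left_of_natDegree_lt ?_).trans (natDegree_X_pow p)
  rw [natDegree_X_pow]
  refine lt_of_le_of_lt (b := 2) ?_ hp
  compute_degree!

lemma two_ne_zero_of_charP {F : Type} [Field F] [CharP F p] (hp : 2 < p) : (2 : F) ≠ 0 := by
  exact_mod_cast (CharP.cast_eq_zero_iff F p 2).not.2 fun h => by
    have := Nat.le_of_dvd two_pos h; omega

lemma derivative_triPoly [CharP k p] : derivative (triPoly k p) = C 2 * X := by
  have : CharP (RatFunc k) p := charP_of_injective_algebraMap (algebraMap k (RatFunc k)).injective p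
  rw [triPoly, derivative_sub, derivative_add, derivative_X_pow, derivative_X_sq, derivative_C,
    CharP.cast_eq_zero, C_0, zero_mul, zero_add, sub_zero]

lemma triPoly_separable [CharP k p] (hp : 2 < p) : (triPoly k p).Separable := by
  have : CharP (RatFunc k) p := charP_of_injective_algebraMap (algebraMap k (RatFunc k)).injective p
  have h2 := two_ne_zero_of_charP (F := RatFunc k) hp
  rw [Separable, derivative_triPoly]
  refine (isCoprime_mul_unit_left_right (isUnit_C.2 h2.isUnit) _ _).2 ?_
  have h0 : (RatFunc.X : RatFunc k) ^ 2 ≠ 0 := pow_ne_zero 2 RatFunc.X_ne_zero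
  refine ⟨-C ((RatFunc.X ^ 2)⁻¹), C ((RatFunc.X ^ 2)⁻¹) * (X ^ (p - 1) + X), ?_⟩
  have hX : (X : Polynomial (RatFunc k)) ^ p = X ^ (p - 1) * X := by
    rw [← pow_succ]; congr 1; omega
  have hC : (C ((RatFunc.X ^ 2)⁻¹) * C (RatFunc.X ^ 2) : Polynomial (RatFunc k)) = 1 := by
    rw [← C_mul, inv_mul_cancel₀ h0, C_1]
  rw [triPoly, hX]
  linear_combination hC

variable {E : Type} [Field E] [Algebra (RatFunc k) E]

lemma triRoots_eq_rootSet (hp : 2 < p) : triRoots k E p = (triPoly k p).rootSet E := by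
  ext x
  rw [mem_rootSet_of_ne (p := triPoly k p) (triPoly_monic hp).ne_zero]
  simp [triPoly, triRoots, sub_eq_zero, coord]

lemma nodal_triRoots (hp : 2 < p) {x : Fin p → E} (hx : Function.Injective x)
    (hr : ∀ i, x i ∈ triRoots k E p) :
    Lagrange.nodal Finset.univ x = X ^ p + X ^ 2 - C (coord k E ^ 2) := by
  have hlt : (X ^ 2 - C (coord k E ^ 2)).degree < (p : WithBot ℕ) :=
    lt_of_le_of_lt (b := 2) (by compute_degree!) (by exact_mod_cast hp)
  have hmon : (X ^ p + (X ^ 2 - C (coord k E ^ 2))).Monic := monic_X_pow_add hlt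
  have hdeg : (X ^ p + (X ^ 2 - C (coord k E ^ 2)) : Polynomial E).degree = (p : WithBot ℕ) := by
    rw [degree_add_eq_left_of_degree_lt (by rwa [degree_X_pow]), degree_X_pow]
  have hn : (Lagrange.nodal Finset.univ x).degree = p := by simp [Lagrange.degree_nodal]
  rw [add_sub_assoc]
  refine eq_of_degree_sub_lt_of_eval_index_eq Finset.univ hx.injOn ?_ fun i hi => ?_
  · rw [Finset.card_univ, Fintype.card_fin, ← hn]
    exact degree_sub_lt_left (hn.trans hdeg.symm) Lagrange.nodal_ne_zero
      (Lagrange.nodal_monic.leadingCoeff.trans hmon.leadingCoeff.symm)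
  · rw [Lagrange.eval_nodal_at_node hi]
    simp [← add_sub_assoc, show x i ^ p + x i ^ 2 = _ from hr i]

variable [IsSplittingField (RatFunc k) E (triPoly k p)]

lemma eq_one_of_fixes_triRoots (hp : 2 < p) (g : E ≃ₐ[RatFunc k] E)
    (hg : ∀ x ∈ triRoots k E p, g x = x) : g = 1 := by
  have := AlgHom.ext_of_adjoin_eq_top (φ₁ := (g : E →ₐ[RatFunc k] E)) (φ₂ := AlgHom.id _ E)
    (IsSplittingField.adjoin_rootSet E (triPoly k p)) fun x hx =>
      hg x (by rw [triRoots_eq_rootSet hp]; exact hx)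
  ext x
  exact DFunLike.congr_fun this x

variable [CharP k p]

lemma triRoots_ncard (hp : 2 < p) : (triRoots k E p).ncard = p := by
  rw [triRoots_eq_rootSet hp, ← Nat.card_coe_set_eq, Nat.card_eq_fintype_card,
    card_rootSet_eq_natDegree (triPoly_separable hp) (IsSplittingField.splits E (triPoly k p)),
    triPoly_natDegree hp]

lemma isGalois_triPoly (hp : 2 < p) : IsGalois (RatFunc k) E :=
  IsGalois.of_separable_splitting_field (triPoly_separable hp)

end SplittingField

section InfinitePoint

/-- There is a point over any place of the base. -/
lemma exists_valuationSubring_comap {K L : Type*} [Field K] [Field L] (f : K →+* L)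
    (A : ValuationSubring K) : ∃ O : ValuationSubring L, O.comap f = A := by
  obtain ⟨O, hO⟩ := (LocalSubring.map f A.toLocalSubring).exists_le_valuationSubring
  rw [LocalSubring.le_def] at hO
  obtain ⟨hle, hloc⟩ := hO
  have hmem : ∀ a ∈ A, f a ∈ O := fun a ha => hle ⟨a, ha, rfl⟩
  refine ⟨O, ?_⟩
  ext a
  rw [ValuationSubring.mem_comap]
  refine ⟨fun ha => ?_, hmem a⟩
  by_contra hna
  have hinv : a⁻¹ ∈ A := (A.mem_or_inv_mem a).resolve_left hna
  have ha0 : a ≠ 0 := fun h => hna (h ▸ A.zero_mem)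
  have hu : IsUnit (⟨f a⁻¹, ⟨a⁻¹, hinv, rfl⟩⟩ : (LocalSubring.map f A.toLocalSubring).toSubring) := by
    refine hloc.1 _ (isUnit_iff_exists_inv.2 ⟨⟨f a, ha⟩, Subtype.ext ?_⟩)
    change f a⁻¹ * f a = 1
    rw [← map_mul, inv_mul_cancel₀ ha0, map_one]
  obtain ⟨⟨_, b, hb, rfl⟩, hmul⟩ := isUnit_iff_exists_inv.1 hu
  have : f a⁻¹ * f b = 1 := congrArg Subtype.val hmul
  rw [← map_mul, ← map_one f] at this
  have hab : b = a := by
    have := f.injective this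
    rwa [inv_mul_eq_one₀ ha0, eq_comm] at this
  exact hna (hab ▸ hb)

end InfinitePoint

section Sign

variable {k E : Type} [Field k] [Field E] [Algebra (RatFunc k) E] {p : ℕ} [CharP k p]
  [Fact p.Prime] {x : Fin p → E}

open Finset Polynomial

omit [Fact p.Prime] in
lemma prod_sub_triRoots (hp : 2 < p) (hx : Function.Injective x) (hr : ∀ i, x i ∈ triRoots k E p)
    (i : Fin p) : ∏ j ∈ {i}ᶜ, (x i - x j) = 2 * x i := by
  classical
  have : CharP E p := triRoots_charP (k := k)
  have h := Lagrange.eval_nodal_derivative_eval_node_eq (v := x) (mem_univ i)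
  rw [nodal_triRoots hp hx hr, Lagrange.eval_nodal] at h
  have h2 : univ.erase i = {i}ᶜ := by ext; simp
  rw [← h2, ← h, derivative_sub, derivative_add, derivative_X_pow, derivative_X_sq, derivative_C,
    CharP.cast_eq_zero, C_0, zero_mul, zero_add, sub_zero, eval_mul, eval_C, eval_X]

omit [CharP k p] in
lemma prod_triRoots (hp : 2 < p) (hx : Function.Injective x) (hr : ∀ i, x i ∈ triRoots k E p) :
    ∏ i, x i = coord k E ^ 2 := by
  have h := congrArg (eval 0) (nodal_triRoots hp hx hr)
  have hodd : Odd p := (Fact.out : p.Prime).odd_of_ne_two (by omega)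
  rw [Lagrange.eval_nodal] at h
  simp only [zero_sub, prod_neg, card_univ, Fintype.card_fin, hodd.neg_one_pow, eval_sub, eval_add,
    eval_pow, eval_X, eval_C] at h
  rw [zero_pow (by omega), zero_pow two_ne_zero] at h
  linear_combination -h

lemma sign_eq_one_of_triRoots [IsAlgClosed k] (hp : 2 < p) (hx : Function.Injective x)
    (hr : ∀ i, x i ∈ triRoots k E p) (g : E ≃ₐ[RatFunc k] E) (σ : Equiv.Perm (Fin p))
    (hσ : ∀ i, x (σ i) = g (x i)) : σ.sign = 1 := by
  have : CharP E p := triRoots_charP (k := k)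
  set D : E := ∏ i, ∏ j ∈ Ioi i, (x i - x j) with hD
  have hD0 : D ≠ 0 := prod_ne_zero_iff.2 fun i _ => prod_ne_zero_iff.2 fun j hj =>
    sub_ne_zero.2 (hx.ne (mem_Ioi.1 hj).ne)
  have hgD : g D = σ.sign * D := by
    rw [hD, ← Equiv.Perm.prod_Ioi_comp_eq_sign_mul_prod σ fun i j => (neg_sub _ _).symm]
    simp only [map_prod, map_sub, hσ]
  obtain ⟨c, hc⟩ : ∃ c : k, D ^ 2 = constMap k E c * coord k E ^ 2 := by
    have h1 := prod_prod_Ioi_mul_eq_prod_prod_off_diag fun i j : Fin p => x j - x i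
    have h2 : ∀ i : Fin p, ∏ j ∈ {i}ᶜ, (x i - x j) = 2 * x i := prod_sub_triRoots hp hx hr
    simp only [h2, prod_mul_distrib, prod_triRoots hp hx hr, prod_const, card_univ,
      Fintype.card_fin] at h1
    have h3 : ∏ i : Fin p, ∏ j ∈ Ioi i, (x j - x i) =
        (∏ i : Fin p, ∏ j ∈ Ioi i, (-1 : E)) * D := by
      rw [hD, ← prod_mul_distrib]
      refine prod_congr rfl fun i _ => ?_
      rw [← prod_mul_distrib]
      exact prod_congr rfl fun j _ => by ring
    obtain ⟨e, he, hee⟩ : ∃ e : k, constMap k E e = ∏ i : Fin p, ∏ j ∈ Ioi i, (-1 : E) ∧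
        e * e = 1 := by
      refine ⟨∏ i : Fin p, ∏ j ∈ Ioi i, (-1 : k), by simp [map_prod], ?_⟩
      rw [← prod_mul_distrib]
      refine prod_eq_one fun i _ => ?_
      rw [← prod_mul_distrib]
      exact prod_eq_one fun j _ => by ring
    have hee' : constMap k E e * constMap k E e = 1 := by rw [← map_mul, hee, map_one]
    rw [h3, ← he, ← hD] at h1
    refine ⟨e * 2 ^ p, ?_⟩
    rw [map_mul, map_pow, map_ofNat]
    linear_combination (constMap k E e) * h1 - D ^ 2 * hee'
  obtain ⟨d, rfl⟩ := IsAlgClosed.exists_pow_nat_eq c two_pos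
  rw [map_pow, ← mul_pow] at hc
  have hgc : ∀ c, g (constMap k E c) = constMap k E c := fun c => by simp [constMap]
  have hgT : g (coord k E) = coord k E := by simp [coord]
  have hfix : g D = D := by
    rcases sq_eq_sq_iff_eq_or_eq_neg.1 hc with h | h <;> simp [h, hgc, hgT]
  rw [hfix] at hgD
  rcases Int.units_eq_one_or σ.sign with h | h
  · exact h
  · rw [h] at hgD
    have : (2 : E) * D = 0 := by
      push_cast at hgD
      linear_combination hgD
    exact absurd this (mul_ne_zero (two_ne_zero_of_charP hp) hD0)

end Sign

section Flip

open Polynomial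

variable {k E : Type} [Field k] [Field E] [Algebra (RatFunc k) E] {p : ℕ}

/-- `s` lifts the involution `X ↦ -X` of the line. -/
structure IsFlip (k : Type) {E : Type} [Field k] [Field E] [Algebra (RatFunc k) E]
    (s : E ≃+* E) : Prop where
  coord : s (coord k E) = -coord k E
  const : ∀ c, s (constMap k E c) = constMap k E c

/-- Ring homomorphisms out of the rational function field are determined by the constants and
the coordinate. -/
lemma ratFunc_hom_ext {R : Type*} [CommRing R] {f g : E →+* R}
    (hc : ∀ c, f (constMap k E c) = g (constMap k E c)) (hX : f (coord k E) = g (coord k E)) :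
    f.comp (algebraMap (RatFunc k) E) = g.comp (algebraMap (RatFunc k) E) := by
  refine IsLocalization.ringHom_ext (nonZeroDivisors (Polynomial k)) (Polynomial.ringHom_ext ?_ ?_)
  · intro c
    simpa [constMap] using hc c
  · simpa [coord] using hX

/-- A ring automorphism fixing the constants and the coordinate is a Galois automorphism. -/
lemma exists_algEquiv_of_ringEquiv (s : E ≃+* E) (hX : s (coord k E) = coord k E)
    (hc : ∀ c, s (constMap k E c) = constMap k E c) :
    ∃ g : E ≃ₐ[RatFunc k] E, ∀ x, g x = s x := by
  have h := ratFunc_hom_ext (k := k) (f := (s : E →+* E)) (g := RingHom.id E) hc hX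
  exact ⟨AlgEquiv.ofRingEquiv (f := s) fun r => congrArg (fun f => f r) h, fun x => rfl⟩

/-- Embeddings of the base field extend to splitting fields. -/
lemma exists_lift_of_splits {K L F : Type*} [Field K] [Field L] [Field F] [Algebra K L]
    (f : Polynomial K) [IsSplittingField K L f] (τ : K →+* F) (hf : (f.map τ).Splits) :
    ∃ s : L →+* F, s.comp (algebraMap K L) = τ := by
  let _ : Algebra K F := τ.toAlgebra
  exact ⟨(IsSplittingField.lift (F := F) L f hf : L →ₐ[K] F), AlgHom.comp_algebraMap _⟩

lemma exists_isFlip (p : ℕ) [IsSplittingField (RatFunc k) E (triPoly k p)] [FiniteDimensional (RatFunc k) E] :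
    ∃ s : E ≃+* E, IsFlip k s := by
  have hinj : Function.Injective
      ((algebraMap (RatFunc k) E).comp ((algebraMap (Polynomial k) (RatFunc k)).comp
        (aeval (-X : Polynomial k) : Polynomial k →ₐ[k] Polynomial k).toRingHom)) := by
    refine (algebraMap (RatFunc k) E).injective.comp ((RatFunc.algebraMap_injective k).comp ?_)
    refine Function.HasLeftInverse.injective ⟨aeval (-X : Polynomial k), fun f => ?_⟩
    change (aeval (-X : Polynomial k)) (aeval (-X : Polynomial k) f) = f
    have : (aeval (-X : Polynomial k)).comp (aeval (-X : Polynomial k)) = AlgHom.id k _ := by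
      ext; simp
    exact DFunLike.congr_fun this f
  let τ : RatFunc k →+* E := IsFractionRing.lift hinj
  have hτX : τ RatFunc.X = -coord k E := by
    rw [← RatFunc.algebraMap_X, IsFractionRing.lift_algebraMap]
    simp [coord]
  have hτC : ∀ c, τ (RatFunc.C c) = constMap k E c := fun c => by
    rw [← RatFunc.algebraMap_C, IsFractionRing.lift_algebraMap]
    simp [constMap]
  have hmap : (triPoly k p).map τ = (triPoly k p).map (algebraMap (RatFunc k) E) := by
    simp [triPoly, hτX, coord]
  obtain ⟨s, hs⟩ := exists_lift_of_splits (L := E) (triPoly k p) τ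
    (hmap ▸ IsSplittingField.splits E (triPoly k p))
  have hsX : s (coord k E) = -coord k E := (congrArg (fun f => f RatFunc.X) hs).trans hτX
  have hsC : ∀ c, s (constMap k E c) = constMap k E c := fun c =>
    (congrArg (fun f => f (RatFunc.C c)) hs).trans (hτC c)
  have hss := ratFunc_hom_ext (k := k) (f := s.comp s) (g := RingHom.id E) (fun c => by simp [hsC])
    (by simp [hsX])
  let ss : E →ₐ[RatFunc k] E := { s.comp s with commutes' := fun r => congrArg (fun f => f r) hss }
  have hsurj : Function.Surjective s := fun y => by
    obtain ⟨x, hx⟩ := (Algebra.IsAlgebraic.algHom_bijective ss).2 y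
    exact ⟨s x, hx⟩
  exact ⟨RingEquiv.ofBijective s ⟨s.injective, hsurj⟩, hsX, hsC⟩

namespace IsFlip

variable {s : E ≃+* E}

lemma coord_sq (hs : IsFlip k s) : s (_root_.coord k E) ^ 2 = _root_.coord k E ^ 2 := by
  rw [hs.coord, neg_sq]

lemma symm (hs : IsFlip k s) : IsFlip k s.symm where
  coord := by rw [RingEquiv.symm_apply_eq, map_neg, hs.coord, neg_neg]
  const c := by rw [RingEquiv.symm_apply_eq, hs.const]

lemma mul_algEquiv (hs : IsFlip k s) (g : E ≃ₐ[RatFunc k] E) :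
    IsFlip k ((g : E ≃+* E).trans s) where
  coord := by simpa [_root_.coord] using hs.coord
  const c := by simpa [constMap] using hs.const c

variable [Algebra (Polynomial k) E] [IsScalarTower (Polynomial k) (RatFunc k) E]

lemma isIntegral (hs : IsFlip k s) {x : E} (hx : IsIntegral (Polynomial k) x) :
    IsIntegral (Polynomial k) (s x) := by
  refine hx.map_of_comp_eq (aeval (-X : Polynomial k) : Polynomial k →ₐ[k] Polynomial k).toRingHom
    (s : E →+* E) (Polynomial.ringHom_ext (fun c => ?_) ?_)
  · simpa [algebraMap_C_eq] using (hs.const c).symm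
  · simpa [algebraMap_X_eq] using hs.coord.symm

/-- A flip acting on integral functions. -/
noncomputable def integralHom (hs : IsFlip k s) :
    integralClosure (Polynomial k) E →+* integralClosure (Polynomial k) E :=
  ((s : E →+* E).comp (algebraMap (integralClosure (Polynomial k) E) E)).codRestrict
    (integralClosure (Polynomial k) E).toSubring fun b => hs.isIntegral b.2

end IsFlip

end Flip

section SwapFlip

open Polynomial

variable {k E : Type} [Field k] [Field E] [Algebra (RatFunc k) E]
  [Algebra (Polynomial k) E] [IsScalarTower (Polynomial k) (RatFunc k) E]

lemma exists_residueHom_zero [IsAlgClosed k] :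
    ∃ φ : integralClosure (Polynomial k) E →+* k, ∀ f : Polynomial k,
      φ (algebraMap _ _ f) = f.eval 0 := by
  have hmax : (Ideal.span {(X - C (0 : k) : Polynomial k)}).IsMaximal :=
    PrincipalIdealRing.isMaximal_of_irreducible (irreducible_X_sub_C (0 : k))
  have : FaithfulSMul (Polynomial k) (integralClosure (Polynomial k) E) :=
    (faithfulSMul_iff_algebraMap_injective _ _).2 fun a b hab =>
      algebraMap_poly_injective (E := E) (congrArg Subtype.val hab)
  obtain ⟨Q, hQm, hQ⟩ := Ideal.exists_maximal_ideal_liesOver_of_isIntegral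
    (S := integralClosure (Polynomial k) E) (Ideal.span {(X - C (0 : k) : Polynomial k)})
  obtain ⟨φ, hφ, -⟩ := exists_residueHom Q (0 : k) (algebraMap_X_sub_C_mem Q 0)
  exact ⟨φ, hφ⟩

variable {φ : integralClosure (Polynomial k) E →+* k}
  (hφ : ∀ f : Polynomial k, φ (algebraMap _ _ f) = f.eval 0)

include hφ

/-- A flip can be corrected by a Galois automorphism so that it fixes a given point over zero. -/
lemma IsFlip.exists_residue_eq [FiniteDimensional (RatFunc k) E] [IsGalois (RatFunc k) E]
    {s : E ≃+* E} (hs : IsFlip k s) :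
    ∃ (s' : E ≃+* E) (hs' : IsFlip k s'), ∀ b, φ (hs'.integralHom b) = φ b := by
  have hconst : ∀ {t : E ≃+* E} (ht : IsFlip k t) (c : k),
      ht.integralHom (algebraMap (Polynomial k) _ (C c)) = algebraMap (Polynomial k) _ (C c) :=
    fun ht c => Subtype.ext (by
      have := ht.const c
      rw [← algebraMap_C_eq] at this
      exact this)
  have hX : hs.integralHom (algebraMap (Polynomial k) _ X) = -algebraMap (Polynomial k) _ X :=
    Subtype.ext (by
      have := hs.coord
      rw [← algebraMap_X_eq] at this
      exact this)
  have hu : ∀ {ψ : integralClosure (Polynomial k) E →+* k},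
      (∀ c, ψ (algebraMap _ _ (C c)) = c) → ψ (algebraMap _ _ X) = 0 →
      (RingHom.ker ψ).under (Polynomial k) = Ideal.span {X} := fun {ψ} hc hX => by
    have h : ψ.comp (algebraMap _ _) = evalRingHom 0 := Polynomial.ringHom_ext
      (fun c => by simpa using hc c) (by simpa using hX)
    ext f
    rw [Ideal.mem_span_singleton, X_dvd_iff, coeff_zero_eq_eval_zero]
    change ψ (algebraMap _ _ f) = 0 ↔ _
    rw [show ψ (algebraMap _ _ f) = f.eval 0 from DFunLike.congr_fun h f]
  have hφC : ∀ c, φ (algebraMap (Polynomial k) _ (C c)) = c := fun c => by simp [hφ]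
  have hφX : φ (algebraMap (Polynomial k) _ X) = 0 := by simp [hφ]
  have := RingHom.ker_isPrime φ
  have := RingHom.ker_isPrime (φ.comp hs.integralHom)
  obtain ⟨g, hg⟩ := Algebra.IsInvariant.exists_smul_of_under_eq (Polynomial k)
    (integralClosure (Polynomial k) E) (E ≃ₐ[RatFunc k] E) (RingHom.ker φ)
    (RingHom.ker (φ.comp hs.integralHom)) (by
      rw [hu hφC hφX, hu (fun c => by rw [RingHom.comp_apply, hconst hs, hφC])
        (by rw [RingHom.comp_apply, hX, map_neg, hφX, neg_zero])])
  refine ⟨_, hs.mul_algEquiv g, fun b => ?_⟩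
  have hker : ∀ b, φ b = 0 → φ ((hs.mul_algEquiv g).integralHom b) = 0 := fun b hb => by
    have : g • b ∈ RingHom.ker (φ.comp hs.integralHom) := by
      rw [hg]
      exact Ideal.smul_mem_pointwise_smul _ _ _ hb
    exact this
  have := hker (b - algebraMap (Polynomial k) _ (C (φ b))) (by rw [map_sub, hφC, sub_self])
  rwa [map_sub, hconst, map_sub, hφC, sub_eq_zero] at this

variable {p : ℕ} [CharP k p] [Fact p.Prime] {x : Fin p → E}

/-- A flip fixing a point over zero transposes the two roots vanishing there. -/
lemma IsFlip.isSwap (hp : 2 < p) (hx : Function.Injective x) (hr : ∀ i, x i ∈ triRoots k E p)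
    {s : E ≃+* E} (hs : IsFlip k s) (hres : ∀ b, φ (hs.integralHom b) = φ b)
    {τ : Equiv.Perm (Fin p)} (hτ : ∀ i, x (τ i) = s (x i)) : τ.IsSwap := by
  classical
  have hunit : ∀ i, φ (triRoot hp (hr i)) = 0 →
      φ (triUnit hp (hr i)) = 1 ∨ φ (triUnit hp (hr i)) = -1 := fun i h0 =>
    sq_eq_sq_iff_eq_or_eq_neg.1 ((triUnit_residue_sq φ hp (hr i) h0).trans (one_pow 2).symm)
  have hmoved : ∀ i ∈ τ.support, φ (triRoot hp (hr i)) = 0 := fun i hi => by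
    rw [Equiv.Perm.mem_support] at hi
    refine triRoot_residue_eq_zero φ hp (hr i) (hr (τ i)) (hx.ne hi.symm) ?_
    rw [← hres]
    exact congrArg φ (Subtype.ext (hτ i).symm)
  obtain ⟨i, hi⟩ : ∃ i, φ (triRoot hp (hr i)) = 0 := by
    have : ∏ i, triRoot hp (hr i) = algebraMap (Polynomial k) _ (X ^ 2) := Subtype.ext (by
      change (integralClosure (Polynomial k) E).val (∏ i, triRoot hp (hr i)) =
        algebraMap (Polynomial k) E (X ^ 2)
      rw [map_prod, map_pow, algebraMap_X_eq]
      exact prod_triRoots hp hx hr)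
    have h0 := congrArg φ this
    rw [hφ, map_prod] at h0
    simpa [Finset.prod_eq_zero_iff] using h0
  have hne : τ i ≠ i := fun h => by
    have hneg : hs.integralHom (triUnit hp (hr i)) = -triUnit hp (hr i) := Subtype.ext (by
      change s (_root_.coord k E / x i) = -(_root_.coord k E / x i)
      rw [map_div₀, hs.coord, ← hτ, h, neg_div])
    have h1 := hres (triUnit hp (hr i))
    rw [hneg, map_neg] at h1
    have h2 := triUnit_residue_sq φ hp (hr i) hi
    have h3 : (2 : k) * φ (triUnit hp (hr i)) = 0 := by linear_combination -h1
    rw [(mul_eq_zero.1 h3).resolve_left (two_ne_zero_of_charP hp)] at h2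
    simp at h2
  rw [← Equiv.Perm.card_support_eq_two]
  refine le_antisymm ?_ (Equiv.Perm.two_le_card_support_of_ne_one fun h => hne (by rw [h]; rfl))
  refine (Finset.card_le_card_of_injOn (t := {1, -1}) (fun i => φ (triUnit hp (hr i)))
    (fun i hi => by simpa using hunit i (hmoved i hi)) fun i hi j _ h => ?_).trans
    Finset.card_le_two
  by_contra hij
  exact triUnit_residue_ne φ hp (hr i) (hr j) (hx.ne hij) (hmoved i hi) h

end SwapFlip

section GaloisGroup

variable {k E : Type} [Field k] [Field E] [Algebra (RatFunc k) E] {p : ℕ}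

lemma exists_rootPerm {x : Fin p → E} (hx : Function.Injective x)
    (hr : Set.range x = triRoots k E p) (s : E ≃+* E)
    (hs : s (coord k E) ^ 2 = coord k E ^ 2) :
    ∃ τ : Equiv.Perm (Fin p), ∀ i, x (τ i) = s (x i) := by
  have h : ∀ i, ∃ j, x j = s (x i) := fun i => by
    have := triRoots_apply s hs (hr ▸ Set.mem_range_self i)
    rwa [← hr] at this
  choose f hf using h
  have hinj : Function.Injective f := fun i j hij => hx (s.injective (by rw [← hf, ← hf, hij]))
  exact ⟨Equiv.ofBijective f (Finite.injective_iff_bijective.1 hinj), hf⟩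

/-- The Galois group of the trinomial is the alternating group. -/
lemma triPoly_galois_group [Algebra (Polynomial k) E] [IsScalarTower (Polynomial k) (RatFunc k) E]
    [Polynomial.IsSplittingField (RatFunc k) E (triPoly k p)] [FiniteDimensional (RatFunc k) E]
    [IsGalois (RatFunc k) E] [IsAlgClosed k] [CharP k p] [Fact p.Prime] (hp : 2 < p)
    (hdvd : p ∣ Nat.card (E ≃ₐ[RatFunc k] E)) :
    Nonempty (alternatingGroup (Fin p) ≃* (E ≃ₐ[RatFunc k] E)) := by
  have hfin : (triRoots k E p).Finite := Set.finite_of_ncard_ne_zero (by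
    rw [triRoots_ncard hp]; omega)
  obtain ⟨x, hx, hr⟩ : ∃ x : Fin p → E, Function.Injective x ∧ Set.range x = triRoots k E p := by
    have := hfin.to_subtype
    have e := (Finite.equivFinOfCardEq (α := triRoots k E p) (n := p)
      ((Nat.card_coe_set_eq _).trans (triRoots_ncard hp))).symm
    exact ⟨fun i => e i, Subtype.val_injective.comp e.injective, by
      rw [show (fun i => (e i : E)) = Subtype.val ∘ e from rfl, e.surjective.range_comp,
        Subtype.range_coe]⟩
  have hr' : ∀ i, x i ∈ triRoots k E p := fun i => hr ▸ Set.mem_range_self i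
  choose ρ hρ using fun g : E ≃ₐ[RatFunc k] E =>
    exists_rootPerm hx hr (g : E ≃+* E) (by simp [coord])
  let R : (E ≃ₐ[RatFunc k] E) →* Equiv.Perm (Fin p) := MonoidHom.mk' ρ fun g h =>
    Equiv.ext fun i => hx (by
      rw [hρ, Equiv.Perm.mul_apply, hρ]
      exact congrArg g (hρ h i).symm)
  have hinj : Function.Injective R := (injective_iff_map_eq_one R).2 fun g hg =>
    eq_one_of_fixes_triRoots (p := p) hp g fun y hy => by
      rw [← hr] at hy
      obtain ⟨i, rfl⟩ := hy
      have := hρ g i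
      rw [show ρ g = 1 from hg] at this
      exact this.symm
  have hle : R.range ≤ alternatingGroup (Fin p) := by
    rintro _ ⟨g, rfl⟩
    exact sign_eq_one_of_triRoots hp hx hr' g _ (hρ g)
  obtain ⟨φ, hφ⟩ := exists_residueHom_zero (k := k) (E := E)
  obtain ⟨s₀, hs₀⟩ := exists_isFlip (k := k) (E := E) p
  obtain ⟨s, hs, hres⟩ := hs₀.exists_residue_eq hφ
  obtain ⟨τ, hτ⟩ := exists_rootPerm hx hr s hs.coord_sq
  have hswap := hs.isSwap hφ hp hx hr' hres hτ
  have hge : alternatingGroup (Fin p) ≤ R.range := by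
    refine alternatingGroup_le_of_swap_normalizes (by simpa using Fact.out) ?_ hswap ?_
    · rw [Fintype.card_fin]
      exact hdvd.trans (Nat.card_congr (MonoidHom.ofInjective hinj).toEquiv).dvd
    · rintro _ ⟨g, rfl⟩
      obtain ⟨g', hg'⟩ := exists_algEquiv_of_ringEquiv (k := k)
        (s.symm.trans ((g : E ≃+* E).trans s))
        (by
          change s (g (s.symm (coord k E))) = _
          have hg : g (coord k E) = coord k E := by simp [coord]
          rw [hs.symm.coord, map_neg, hg, map_neg, hs.coord, neg_neg])
        (fun c => by
          change s (g (s.symm (constMap k E c))) = _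
          have hg : g (constMap k E c) = constMap k E c := by simp [constMap]
          rw [hs.symm.const, hg, hs.const])
      refine ⟨g', Equiv.ext fun i => hx ?_⟩
      have h1 : x (τ⁻¹ i) = s.symm (x i) := by
        rw [RingEquiv.eq_symm_apply, ← hτ, ← Equiv.Perm.mul_apply, mul_inv_cancel, Equiv.Perm.one_apply]
      rw [Equiv.Perm.mul_apply, Equiv.Perm.mul_apply, hτ]
      refine (hρ g' i).trans ((hg' _).trans ?_)
      rw [show R g = ρ g from rfl, hρ, h1]
      rfl
  exact ⟨((MonoidHom.ofInjective hinj).trans (MulEquiv.subgroupCongr (hle.antisymm hge))).symm⟩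

end GaloisGroup

section Existence

/-- The alternating cover given by the splitting field of `Y ^ p + Y ^ 2 - X ^ 2`. -/
lemma exists_alternating_cover (k : Type) [Field k] [IsAlgClosed k] {p m : ℕ} [Fact p.Prime]
    [CharP k p] (hp : 2 < p) (hm : 2 * m = p - 1) :
    ∃ (E : Type) (_ : Field E) (_ : Algebra (RatFunc k) E)
      (_ : Algebra (Polynomial k) E) (_ : IsScalarTower (Polynomial k) (RatFunc k) E),
      FiniteDimensional (RatFunc k) E ∧ IsGalois (RatFunc k) E ∧
      Algebra.Etale (Polynomial k) (integralClosure (Polynomial k) E) ∧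
      Nonempty (alternatingGroup (Fin p) ≃* (E ≃ₐ[RatFunc k] E)) ∧
      ∃ O : ValuationSubring E,
        O.comap (algebraMap (RatFunc k) E) = inftyPlace k ∧
        Nat.card (inertiaIn k O) = p * m ∧
        ∀ g ∈ inertiaIn k O, orderOf g = p → HasLowerJump O g (p - 2) := by
  let E := (triPoly k p).SplittingField
  have hsplit : Polynomial.IsSplittingField (RatFunc k) E (triPoly k p) := inferInstance
  have hfd : FiniteDimensional (RatFunc k) E := inferInstance
  have hgal : IsGalois (RatFunc k) E := isGalois_triPoly (p := p) hp
  have hfix := eq_one_of_fixes_triRoots (k := k) (E := E) (p := p) hp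
  have hcard := triRoots_ncard (k := k) (E := E) (p := p) hp
  obtain ⟨O, hO⟩ := exists_valuationSubring_comap (algebraMap (RatFunc k) E) (inftyPlace k)
  obtain ⟨π, h⟩ := exists_isUnif hO
  have hI := (triRoots_card_inertia hO h hfix hp hm hcard).1
  refine ⟨E, inferInstance, inferInstance, inferInstance, inferInstance, hfd, hgal, ?_, ?_, O, hO,
    hI, fun g hg hgp => triRoots_hasLowerJump hO h hfix hp hm hcard hg hgp⟩
  · exact etale_of_inertia_trivial fun φ α hφ g hg =>
      hfix g fun x hx => triRoots_inertia φ hp hg hx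
  · exact triPoly_galois_group hp
      ((Dvd.intro _ hI.symm).trans (Subgroup.card_subgroup_dvd_card _))

end Existence

/-- **Bouw–Pries**: for `p ≥ 7` and `m = (p-1)/2`, there is an `A_p`-Galois cover
of the projective line branched only at `∞` whose inertia group at a point over
`∞` has order `p·m` with order-`p` elements of lower jump `p-2` (upper jump
`σ = (p-2)/m`); but there is no `PSL₂(𝔽_p)`-Galois cover of the projective line
branched only at `∞` whose inertia group at a point over `∞` has order `p·m'`
with `p ∤ m'` and lower jump `J` of its order-`p` elements satisfying
`J/m' = (p-2)/m`. -/
theorem bouw_pries_conductor_Ap_not_PSL2p (k : Type) [Field k] [IsAlgClosed k]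
    (p : ℕ) (hp : p.Prime) (hp7 : 7 ≤ p) [CharP k p] (m : ℕ) (hm : m = (p - 1) / 2) :
    (∃ (E : Type) (_ : Field E) (_ : Algebra (RatFunc k) E)
      (_ : Algebra (Polynomial k) E) (_ : IsScalarTower (Polynomial k) (RatFunc k) E),
      FiniteDimensional (RatFunc k) E ∧ IsGalois (RatFunc k) E ∧
      Algebra.Etale (Polynomial k) (integralClosure (Polynomial k) E) ∧
      Nonempty (alternatingGroup (Fin p) ≃* (E ≃ₐ[RatFunc k] E)) ∧
      ∃ O : ValuationSubring E,
        O.comap (algebraMap (RatFunc k) E) = inftyPlace k ∧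
        Nat.card (inertiaIn k O) = p * m ∧
        ∀ g ∈ inertiaIn k O, orderOf g = p → HasLowerJump O g (p - 2)) ∧
    ¬ (∃ (E : Type) (_ : Field E) (_ : Algebra (RatFunc k) E)
      (_ : Algebra (Polynomial k) E) (_ : IsScalarTower (Polynomial k) (RatFunc k) E),
      FiniteDimensional (RatFunc k) E ∧ IsGalois (RatFunc k) E ∧
      Algebra.Etale (Polynomial k) (integralClosure (Polynomial k) E) ∧
      Nonempty (PSL₂ (ZMod p) ≃* (E ≃ₐ[RatFunc k] E)) ∧
      ∃ O : ValuationSubring E,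
        O.comap (algebraMap (RatFunc k) E) = inftyPlace k ∧
        ∃ m' J : ℕ, ¬ p ∣ m' ∧ Nat.card (inertiaIn k O) = p * m' ∧
          (∀ g ∈ inertiaIn k O, orderOf g = p → HasLowerJump O g J) ∧
          J * m = (p - 2) * m') := by
  have : Fact p.Prime := ⟨hp⟩
  have hodd := hp.odd_of_ne_two (by omega)
  have hm2 : 2 * m = p - 1 := by
    obtain ⟨r, rfl⟩ := hodd
    omega
  refine ⟨exists_alternating_cover k (by omega) hm2, ?_⟩
  rintro ⟨E, _, _, _, _, _, _, _, ⟨e⟩, O, hO, m', J, hm', hcard, hjump, hJ⟩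
  exact not_psl2_cover hO hp7 hm2 e hm' hcard hjump hJ
end

section
/- Let p be a prime and let ζ be a primitive p-th root of unity in a field of characteristic zero (for instance in the cyclotomic field ℚ(ζ_p)); set λ = ζ - 1. Then λ^p divides λ^{p-1} + p in the ring ℤ[ζ]. Equivalently, with respect to the unique valuation v on ℚ(ζ_p) extending the p-adic valuation normalized by v(p) = 1, one has v(λ^{p-1} + p) > 1. -/
/-- `(ζ - 1) ^ (n - 1)` divides `n` for a primitive `n`-th root of unity `ζ`. -/
theorem IsPrimitiveRoot.sub_one_pow_dvd_natCast {R : Type*} [CommRing R] [IsDomain R]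
    {n : ℕ} (hn : 0 < n) {ζ : R} (hζ : IsPrimitiveRoot ζ n) :
    (ζ - 1) ^ (n - 1) ∣ (n : R) := by
  obtain ⟨m, rfl⟩ := Nat.exists_eq_add_one_of_ne_zero hn.ne'
  rw [Nat.add_sub_cancel, Nat.cast_succ, ← hζ.prod_one_sub_pow_eq_order]
  calc (ζ - 1) ^ m = ∏ _k ∈ Finset.range m, (ζ - 1) := by simp
    _ ∣ _ := Finset.prod_dvd_prod_of_dvd _ _ fun k _ => by
      rw [← neg_sub (ζ ^ (k + 1)) 1, dvd_neg]
      exact sub_one_dvd_pow_sub_one ζ (k + 1)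

theorem IsPrimitiveRoot.sub_one_mul_natCast_dvd {R : Type*} [CommRing R] [IsDomain R]
    {p : ℕ} (hp : p.Prime) {ζ : R} (hζ : IsPrimitiveRoot ζ p) :
    (ζ - 1) * (p : R) ∣ (ζ - 1) ^ (p - 1) + (p : R) := by
  have hne : ζ - 1 ≠ 0 := sub_ne_zero.mpr (hζ.ne_one hp.one_lt)
  have hbinom := add_pow_prime_eq hp (ζ - 1) 1
  set S := ∑ k ∈ Finset.Ioo 0 p, (ζ - 1) ^ (k - 1) * 1 ^ (p - k - 1) * ↑(p.choose k / p) with hS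
  have hdvd : ζ - 1 ∣ S - 1 := by
    have hmem : 1 ∈ Finset.Ioo 0 p := by simp [hp.one_lt]
    rw [hS, ← Finset.add_sum_erase _ _ hmem]
    simp only [Nat.choose_one_right, Nat.div_self hp.pos, tsub_self, pow_zero, one_pow,
      Nat.cast_one, mul_one, add_sub_cancel_left]
    refine Finset.dvd_sum fun k hk => Dvd.dvd.mul_right (dvd_pow_self _ ?_) _
    simp only [Finset.mem_erase, Finset.mem_Ioo] at hk
    omega
  have hzero : (ζ - 1) ^ (p - 1) + p * S = 0 := by
    apply mul_left_cancel₀ hne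
    rw [sub_add_cancel, hζ.pow_eq_one, one_pow,
      ← mul_pow_sub_one hp.ne_zero (ζ - 1)] at hbinom
    linear_combination -hbinom
  obtain ⟨t, ht⟩ := hdvd
  exact ⟨-t, by linear_combination hzero - p * ht⟩

theorem IsPrimitiveRoot.sub_one_pow_dvd_sub_one_pow_add {R : Type*} [CommRing R] [IsDomain R]
    {p : ℕ} (hp : p.Prime) {ζ : R} (hζ : IsPrimitiveRoot ζ p) :
    (ζ - 1) ^ p ∣ (ζ - 1) ^ (p - 1) + (p : R) := by
  refine dvd_trans ?_ (hζ.sub_one_mul_natCast_dvd hp)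
  rw [← mul_pow_sub_one hp.ne_zero (ζ - 1)]
  exact mul_dvd_mul_left _ (hζ.sub_one_pow_dvd_natCast hp.pos)

/-- Let `p` be a prime and `ζ` a primitive `p`-th root of unity in a field of
characteristic zero, and set `λ = ζ - 1`.  Then `λ^p` divides `λ^(p-1) + p`
in the ring `ℤ[ζ]`; equivalently, the valuation of `λ^(p-1) + p` at the prime
above `p` is greater than `1 = v(p)`. -/
theorem lambda_pow_dvd_lambda_pow_add_p {F : Type} [Field F] [CharZero F]
    (p : ℕ) (hp : p.Prime) (ζ : F) (hζ : IsPrimitiveRoot ζ p) :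
    ∃ c ∈ Algebra.adjoin ℤ ({ζ} : Set F),
      (ζ - 1) ^ (p - 1) + (p : F) = (ζ - 1) ^ p * c := by
  set A := Algebra.adjoin ℤ ({ζ} : Set F)
  let z : A := ⟨ζ, Algebra.self_mem_adjoin_singleton ℤ ζ⟩
  have hz : IsPrimitiveRoot z p := IsPrimitiveRoot.coe_submonoidClass_iff.mp hζ
  obtain ⟨c, hc⟩ := hz.sub_one_pow_dvd_sub_one_pow_add hp
  exact ⟨c, c.2, by simpa [z] using congrArg (Subtype.val : A → F) hc⟩
end

section
/- Let k be an algebraically closed field of characteristic p > 0, let a ∈ k be nonzero, let s and t be positive integers with p ∤ t, and set n = p + t. Then for every x_0 ∈ k, the polynomial Y^n − a·x_0^s·Y^t + 1 ∈ k[Y] is separable. (This is the verification that Abhyankar's map f : Y → 𝔸^1_k defined by y^n − a x^s y^t + 1 = 0 is étale over the affine line.) -/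
open Polynomial

/-- **Abhyankar's covers of the affine line are étale**: let `k` be an
algebraically closed field of characteristic `p > 0`, let `a ∈ k` be nonzero,
let `s, t ≥ 1` with `p ∤ t`, and set `n = p + t`.  Then for every `x₀ ∈ k` the
fiber polynomial `Y^n − a·x₀^s·Y^t + 1 ∈ k[Y]` is separable; i.e. the map
`f : Y → 𝔸¹_k` defined by `y^n − a x^s y^t + 1 = 0` is étale over the affine
line. -/
theorem abhyankar_cover_etale (k : Type) [Field k] [IsAlgClosed k]
    (p : ℕ) (hp : p.Prime) [CharP k p]
    (a : k) (ha : a ≠ 0) (s t : ℕ) (hs : 1 ≤ s) (ht : 1 ≤ t) (hpt : ¬ (p : ℕ) ∣ t)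
    (n : ℕ) (hn : n = p + t) :
    ∀ x₀ : k,
      (Polynomial.X ^ n - Polynomial.C (a * x₀ ^ s) * Polynomial.X ^ t + 1 :
        Polynomial k).Separable := by
  intro x₀
  have ht0 : (t : k) ≠ 0 := fun h => hpt ((CharP.cast_eq_zero_iff k p t).mp h)
  have hn' : (n : k) = t := by simp [hn]
  obtain ⟨m, rfl⟩ : ∃ m, t = m + 1 := ⟨t - 1, by lia⟩
  obtain rfl : n = p + m + 1 := by lia
  have hinv : C (((m + 1 : ℕ) : k)⁻¹) * C ((m + 1 : ℕ) : k) = 1 := by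
    rw [← C_mul, inv_mul_cancel₀ ht0, C_1]
  refine ⟨1, -(C (((m + 1 : ℕ) : k)⁻¹) * X), ?_⟩
  rw [derivative_add, derivative_sub, derivative_C_mul, derivative_X_pow, derivative_X_pow,
    derivative_one, hn', Nat.add_sub_cancel, Nat.add_sub_cancel]
  linear_combination (C (a * x₀ ^ s) * X ^ (m + 1) - X ^ (p + m + 1)) * hinv
end
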